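/- arXiv:2508.00266 — 2 statements merged into one kernel-verified Lean document; each statement's English description precedes it below -/
import Mathlib

section
/- (Capelli's Lemma) Let K be any field and let f, g ∈ K[x]. Suppose α ∈ K̄ is any root of f. Then f(g(x)) is irreducible over K if and only if both f(x) is irreducible over K and g(x) − α is irreducible over K(α). -/
open Polynomial IntermediateField

/-- A nonzero polynomial with a root `x` is irreducible iff its degree is that of the minimal
polynomial of `x`. -/
theorem irreducible_iff_natDegree_minpoly_eq {F L : Type*} [Field F] [Field L] [Algebra F L]
    {p : F[X]} {x : L} (hp : p ≠ 0) (hx : aeval x p = 0) :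
    Irreducible p ↔ (minpoly F x).natDegree = p.natDegree := by
  have hint : IsIntegral F x := IsAlgebraic.isIntegral ⟨p, hp, hx⟩
  have hirr := minpoly.irreducible hint
  have hdvd := minpoly.dvd F x hx
  refine ⟨fun h => natDegree_eq_of_degree_eq
    (degree_eq_degree_of_associated (hirr.associated_of_dvd h hdvd)), fun h => ?_⟩
  exact (associated_of_dvd_of_natDegree_le hdvd hp h.ge).irreducible hirr

/-- The tower law for `K(β) / K(α) / K` when `α = g(β)`. -/
theorem natDegree_minpoly_mul_natDegree_minpoly {K L : Type*} [Field K] [Field L] [Algebra K L]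
    {α β : L} (hβ : IsIntegral K β) {g : K[X]} (hg : aeval β g = α) :
    (minpoly K α).natDegree * (minpoly K⟮α⟯ β).natDegree = (minpoly K β).natDegree := by
  have hα : IsIntegral K α := hg ▸ IsIntegral.of_mem_of_fg _ hβ.fg_adjoin_singleton _
    (aeval_mem_adjoin_singleton K β)
  have hadjoin : K⟮α⟯⟮β⟯.restrictScalars K = K⟮β⟯ := by
    rw [adjoin_simple_adjoin_simple]
    refine le_antisymm (adjoin_le_iff.2 ?_) (adjoin.mono _ _ _ (by simp))
    rintro x (rfl | rfl)
    · exact hg ▸ algebra_adjoin_le_adjoin K {β} (aeval_mem_adjoin_singleton K β)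
    · exact mem_adjoin_simple_self K x
  rw [← adjoin.finrank hα, ← adjoin.finrank hβ.tower_top, ← adjoin.finrank hβ,
    Module.finrank_mul_finrank, ← hadjoin]
  rfl

/-- **Capelli's Lemma.** Let `K` be any field and `f, g ∈ K[x]`. Suppose `α` (in a fixed
algebraic closure of `K`) is any root of `f`. Then `f(g(x))` is irreducible over `K` if and
only if both `f(x)` is irreducible over `K` and `g(x) - α` is irreducible over `K(α)`. -/
theorem capelli (K : Type*) [Field K] (f g : K[X]) (α : AlgebraicClosure K)
    (hα : Polynomial.aeval α f = 0) :
    Irreducible (f.comp g) ↔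
      Irreducible f ∧
        Irreducible (g.map (algebraMap K ↥K⟮α⟯) - C (AdjoinSimple.gen K α)) := by
  rcases eq_or_ne f 0 with rfl | hf
  · simp
  rcases Nat.eq_zero_or_pos g.natDegree with hg | hg
  · obtain ⟨c, rfl⟩ := natDegree_eq_zero.1 hg
    rw [comp_C, map_C, ← C_sub]
    exact iff_of_false (not_irreducible_C _) fun h => not_irreducible_C _ h.2
  set q := g.map (algebraMap K ↥K⟮α⟯) - C (AdjoinSimple.gen K α) with hq
  have hqdeg : q.natDegree = g.natDegree := by rw [hq, natDegree_sub_C, natDegree_map]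
  have hq0 : q ≠ 0 := ne_zero_of_natDegree_gt (hqdeg ▸ hg)
  obtain ⟨β, hβ⟩ := IsAlgClosed.exists_aeval_eq_zero (AlgebraicClosure K) q
    (degree_ne_of_natDegree_ne (hqdeg.trans_ne hg.ne'))
  have hgβ : aeval β g = α := by
    simpa [hq, sub_eq_zero, aeval_map_algebraMap] using hβ
  have hcomp : aeval β (f.comp g) = 0 := by rw [aeval_comp, hgβ, hα]
  have hcomp0 : f.comp g ≠ 0 := by
    rw [Ne, comp_eq_zero_iff]
    rintro (h | ⟨-, h⟩)
    · exact hf h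
    · rw [h, natDegree_C] at hg
      exact hg.false
  have hαint : IsIntegral K α := Algebra.IsIntegral.isIntegral α
  have hβint : IsIntegral K β := Algebra.IsIntegral.isIntegral β
  have hle₁ := natDegree_le_of_dvd (minpoly.dvd K α hα) hf
  have hle₂ := natDegree_le_of_dvd (minpoly.dvd K⟮α⟯ β hβ) hq0
  have hpos₁ := minpoly.natDegree_pos hαint
  rw [irreducible_iff_natDegree_minpoly_eq hcomp0 hcomp, irreducible_iff_natDegree_minpoly_eq hf hα,
    irreducible_iff_natDegree_minpoly_eq hq0 hβ, natDegree_comp, ← hqdeg,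
    ← natDegree_minpoly_mul_natDegree_minpoly hβint hgβ]
  have hpos₂ : 0 < (minpoly K⟮α⟯ β).natDegree := minpoly.natDegree_pos hβint.tower_top
  exact mul_eq_mul_iff_eq_and_eq_of_pos hle₁ hle₂ hpos₁ (hpos₂.trans_le hle₂)
end

section
/- Let K be a number field containing a primitive q-th root of unity, q = p^r a power of a prime p, c an algebraic integer in K, and f(x) = x^q + c with 0 not preperiodic for f. Let α_1, …, α_s ∈ K be strictly preperiodic for f, and suppose there are no i ≠ j with f^ℓ(α_i) = α_j for some ℓ ≥ 0. Let M_n(𝛂) = ⋃_{i=0}^n ⋃_{j=1}^s f^{-i}(α_j) and G_n(𝛂) = Gal(K(M_n(𝛂))/K). Then there exists a constant C such that q^(s(q^n − 1)/(q − 1)) ≤ C · [K(M_n(𝛂)) : K] for all n ≥ 1; that is, the index of G_n(𝛂) in ([C_q]^n)^s is bounded independently of n, so G_∞(𝛂) has finite index in ([C_q]^∞)^s. -/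
open Polynomial IntermediateField NumberField

noncomputable section

/-- The `n`-fold composition iterate `f^n` of a polynomial, with `f^0 = X`. -/
def polyIter {K : Type*} [Field K] (f : K[X]) : ℕ → K[X]
  | 0 => X
  | n + 1 => f.comp (polyIter f n)

/-- `x` is periodic for `φ` if `φ^[n] x = x` for some `n ≥ 1`. -/
def IsPeriodicPoint {A : Type*} (φ : A → A) (x : A) : Prop := ∃ n, 0 < n ∧ φ^[n] x = x

/-- `x` is preperiodic for `φ` if some forward iterate of `x` is periodic. -/
def IsPreperiodicPoint {A : Type*} (φ : A → A) (x : A) : Prop :=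
  ∃ m, IsPeriodicPoint φ (φ^[m] x)

/-- `K_n(β) = K(β)(f^{-n}(β))`, the extension of `K` generated by `β` together with all `n`-th
preimages of `β` under `f`, inside a fixed algebraic closure of `K`. -/
def KK {K : Type*} [Field K] (f : K[X]) (β : AlgebraicClosure K) (n : ℕ) :
    IntermediateField K (AlgebraicClosure K) :=
  IntermediateField.adjoin K ({β} ∪ {x | Polynomial.aeval x (polyIter f n) = β})

/-- The Galois group of `E ⊔ F` over `E`; when `E ≤ F` this is `Gal(F/E)`. -/
def relGal {K L : Type*} [Field K] [Field L] [Algebra K L] (E F : IntermediateField K L) :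
    Type _ :=
  ↥(IntermediateField.extendScalars (le_sup_left : E ≤ E ⊔ F)) ≃ₐ[↥E]
    ↥(IntermediateField.extendScalars (le_sup_left : E ≤ E ⊔ F))

instance {K L : Type*} [Field K] [Field L] [Algebra K L] (E F : IntermediateField K L) :
    Group (relGal E F) :=
  inferInstanceAs (Group (_ ≃ₐ[_] _))

/-- The degree `[E ⊔ F : E]`; when `E ≤ F` this is `[F : E]`. -/
def relDeg {K L : Type*} [Field K] [Field L] [Algebra K L] (E F : IntermediateField K L) : ℕ :=
  Module.finrank ↥E ↥(IntermediateField.extendScalars (le_sup_left : E ≤ E ⊔ F))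

end

namespace Pade

/-- The numerator of the diagonal Padé approximant of `(1 + X) ^ ν`. -/
noncomputable def num (ν : ℚ) (k : ℕ) : ℚ[X] :=
  ∑ i ∈ Finset.range (k + 1),
    C (Ring.choose (-(k : ℚ) - 1) (k - i) * Ring.choose ((k : ℚ) - ν) i) *
        (X ^ i * (1 + X) ^ (k - i))

/-- The power series whose truncation is the denominator of the diagonal Padé approximant. -/
noncomputable def denSeries (ν : ℚ) (k : ℕ) : PowerSeries ℚ :=
  PowerSeries.mk fun j => Ring.choose ((k : ℚ) - ν) j * Ring.choose ((j : ℚ) - k - 1) k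

/-- The denominator of the diagonal Padé approximant of `(1 + X) ^ ν`. -/
noncomputable def den (ν : ℚ) (k : ℕ) : ℚ[X] :=
  PowerSeries.trunc (k + 1) (denSeries ν k)

theorem factorial_mul_choose (r : ℚ) (j : ℕ) :
    (j.factorial : ℚ) * Ring.choose r j = ∏ i ∈ Finset.range j, (r - i) := by
  rw [← nsmul_eq_mul, ← Ring.descPochhammer_eq_factorial_smul_choose]
  induction j with
  | zero => simp
  | succ j ih =>
    rw [descPochhammer_succ_right, Polynomial.smeval_mul, ih, Finset.prod_range_succ]
    simp [Polynomial.smeval_sub, Polynomial.smeval_natCast]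

theorem denSeries_eq (ν : ℚ) (k : ℕ) :
    denSeries ν k = ∑ i ∈ Finset.range (k + 1),
      PowerSeries.C (Ring.choose (-(k : ℚ) - 1) (k - i) * Ring.choose ((k : ℚ) - ν) i) *
        (PowerSeries.X ^ i * PowerSeries.binomialSeries ℚ ((k : ℚ) - ν - i)) := by
  ext j
  rw [map_sum]
  simp only [denSeries, PowerSeries.coeff_mk, PowerSeries.coeff_C_mul, PowerSeries.coeff_X_pow_mul',
    PowerSeries.binomialSeries_coeff, smul_eq_mul, mul_one]
  have h : Ring.choose ((j : ℚ) - k - 1) k = ∑ i ∈ Finset.range (k + 1),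
      (Nat.choose j i : ℚ) * Ring.choose (-(k : ℚ) - 1) (k - i) := by
    rw [show (j : ℚ) - k - 1 = j + (-(k : ℚ) - 1) by ring, Ring.add_choose_eq k (Commute.all _ _),
      Finset.Nat.sum_antidiagonal_eq_sum_range_succ_mk]
    simp [Ring.choose_natCast]
  rw [h, Finset.mul_sum]
  refine Finset.sum_congr rfl fun i _ => ?_
  split_ifs with hij
  · have := Ring.choose_smul_choose ((k : ℚ) - ν) hij
    rw [nsmul_eq_mul] at this
    linear_combination (Ring.choose (-(k : ℚ) - 1) (k - i)) * this
  · rw [Nat.choose_eq_zero_of_lt (by omega)]; simp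

theorem num_eq (ν : ℚ) (k : ℕ) :
    (num ν k : PowerSeries ℚ) = PowerSeries.binomialSeries ℚ ν * denSeries ν k := by
  rw [denSeries_eq, num, Finset.mul_sum]
  rw [← Polynomial.coeToPowerSeries.ringHom_apply, map_sum]
  refine Finset.sum_congr rfl fun i hi => ?_
  have hi' : i ≤ k := Nat.lt_succ_iff.mp (Finset.mem_range.mp hi)
  simp only [map_mul, map_pow, map_add, map_one, Polynomial.coeToPowerSeries.ringHom_apply,
    Polynomial.coe_C, Polynomial.coe_X]
  rw [← PowerSeries.binomialSeries_nat (R := ℚ) (A := ℚ) (k - i),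
    show ((k - i : ℕ) : ℚ) = ν + ((k : ℚ) - ν - i) by push_cast [hi']; ring,
    PowerSeries.binomialSeries_add]
  ring

theorem choose_sub_eq_zero {k j : ℕ} (h1 : k < j) (h2 : j ≤ 2 * k) :
    Ring.choose ((j : ℚ) - k - 1) k = 0 := by
  rw [show (j : ℚ) - k - 1 = ((j - k - 1 : ℕ) : ℚ) by
    rw [Nat.sub_sub, Nat.cast_sub (by omega)]; push_cast; ring, Ring.choose_natCast,
    Nat.choose_eq_zero_of_lt (by omega), Nat.cast_zero]

theorem abs_choose_sub {k j : ℕ} (h1 : j ≤ k) :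
    Ring.choose ((j : ℚ) - k - 1) k = (-1) ^ k * Nat.choose (2 * k - j) k := by
  rw [show (j : ℚ) - k - 1 = -((k + 1 - j : ℕ) : ℚ) by
    rw [Nat.cast_sub (by omega)]; push_cast; ring, Ring.choose_neg]
  rw [show (((k + 1 - j : ℕ) : ℚ) + k - 1) = ((2 * k - j : ℕ) : ℚ) by
    rw [Nat.cast_sub (by omega), Nat.cast_sub (by omega)]; push_cast; ring, Ring.choose_natCast]
  simp [Units.smul_def, Int.negOnePow]

theorem denSeries_sub (ν : ℚ) (k : ℕ) : ∃ R : PowerSeries ℚ,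
    denSeries ν k = (den ν k : PowerSeries ℚ) + PowerSeries.X ^ (2 * k + 1) * R ∧
      PowerSeries.constantCoeff R = Ring.choose ((k : ℚ) - ν) (2 * k + 1) := by
  have : PowerSeries.X ^ (2 * k + 1) ∣ denSeries ν k - (den ν k : PowerSeries ℚ) := by
    rw [PowerSeries.X_pow_dvd_iff]
    intro m hm
    rw [map_sub, den, Polynomial.coeff_coe, PowerSeries.coeff_trunc]
    split_ifs with h
    · simp
    · simp [denSeries, choose_sub_eq_zero (show k < m by omega) (by omega)]
  obtain ⟨R, hR⟩ := this
  refine ⟨R, by rw [← hR]; ring, ?_⟩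
  have h2 := congrArg (PowerSeries.coeff (2 * k + 1)) hR
  rw [PowerSeries.coeff_X_pow_mul', if_pos le_rfl, Nat.sub_self,
    PowerSeries.coeff_zero_eq_constantCoeff_apply] at h2
  rw [← h2, map_sub, den, Polynomial.coeff_coe, PowerSeries.coeff_trunc, if_neg (by omega)]
  simp only [denSeries, PowerSeries.coeff_mk]
  rw [show (((2 * k + 1 : ℕ) : ℚ) - k - 1) = (k : ℚ) by push_cast; ring, Ring.choose_natCast]
  simp

theorem natDegree_num (ν : ℚ) (k : ℕ) : (num ν k).natDegree ≤ k := by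
  refine Polynomial.natDegree_sum_le_of_forall_le _ _ fun i hi => ?_
  have hi' : i ≤ k := Nat.lt_succ_iff.mp (Finset.mem_range.mp hi)
  refine (Polynomial.natDegree_C_mul_le _ _).trans (Polynomial.natDegree_mul_le.trans ?_)
  have h1 : ((1 + X : ℚ[X]) ^ (k - i)).natDegree ≤ k - i := by
    refine Polynomial.natDegree_pow_le.trans ?_
    have : (1 + X : ℚ[X]).natDegree ≤ 1 := by compute_degree
    nlinarith
  have h2 : (X ^ i : ℚ[X]).natDegree ≤ i := by simp
  omega

theorem natDegree_den (ν : ℚ) (k : ℕ) : (den ν k).natDegree ≤ k :=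
  Nat.lt_succ_iff.mp (PowerSeries.natDegree_trunc_lt _ _)

theorem coeff_den (ν : ℚ) {k j : ℕ} (hj : j ≤ k) : (den ν k).coeff j =
    Ring.choose ((k : ℚ) - ν) j * ((-1) ^ k * Nat.choose (2 * k - j) k) := by
  rw [den, PowerSeries.coeff_trunc, if_pos (by omega), denSeries, PowerSeries.coeff_mk,
    abs_choose_sub hj]

theorem choose_ne_zero_of_not_int {ν : ℚ} (hν : ∀ z : ℤ, ν ≠ z) (j : ℕ) :
    Ring.choose ν j ≠ 0 := by
  have h := factorial_mul_choose ν j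
  intro h0
  rw [h0, mul_zero, eq_comm, Finset.prod_eq_zero_iff] at h
  obtain ⟨i, -, hi⟩ := h
  exact hν i (by push_cast; linarith)

/-- The remainder series: `num - (1 + X) ^ ν * den` vanishes to order exactly `2 * k + 1`. -/
theorem num_sub (ν : ℚ) (k : ℕ) : ∃ R : PowerSeries ℚ,
    (num ν k : PowerSeries ℚ) - PowerSeries.binomialSeries ℚ ν * (den ν k : PowerSeries ℚ) =
      PowerSeries.X ^ (2 * k + 1) * R ∧
      PowerSeries.constantCoeff R = Ring.choose ((k : ℚ) - ν) (2 * k + 1) := by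
  obtain ⟨R, h1, h2⟩ := denSeries_sub ν k
  refine ⟨PowerSeries.binomialSeries ℚ ν * R, ?_, by simp [h2]⟩
  rw [num_eq, h1]; ring

theorem wronskian (ν : ℚ) (hν : ∀ z : ℤ, ν ≠ z) (k : ℕ) : ∃ κ : ℚ, κ ≠ 0 ∧
    num ν k * den ν (k + 1) - num ν (k + 1) * den ν k = C κ * X ^ (2 * k + 1) := by
  obtain ⟨R, h1, h2⟩ := num_sub ν k
  obtain ⟨R', h1', -⟩ := num_sub ν (k + 1)
  set D := num ν k * den ν (k + 1) - num ν (k + 1) * den ν k with hD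
  have hser : (D : PowerSeries ℚ) = PowerSeries.X ^ (2 * k + 1) *
      (R * (den ν (k + 1) : PowerSeries ℚ) - PowerSeries.X ^ 2 *
          (R' * (den ν k : PowerSeries ℚ))) := by
    have e1 := sub_eq_iff_eq_add.mp h1
    have e2 := sub_eq_iff_eq_add.mp h1'
    rw [hD, Polynomial.coe_sub, Polynomial.coe_mul, Polynomial.coe_mul, e1, e2]
    ring
  have hdeg : D.natDegree ≤ 2 * k + 1 := by
    refine (Polynomial.natDegree_sub_le _ _).trans (max_le ?_ ?_) <;>
    refine Polynomial.natDegree_mul_le.trans ?_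
    · have := natDegree_num ν k; have := natDegree_den ν (k + 1); omega
    · have := natDegree_num ν (k + 1); have := natDegree_den ν k; omega
  refine ⟨D.coeff (2 * k + 1), ?_, ?_⟩
  · rw [← Polynomial.coeff_coe, hser, PowerSeries.coeff_X_pow_mul', if_pos le_rfl, Nat.sub_self,
      PowerSeries.coeff_zero_eq_constantCoeff_apply]
    simp only [map_sub, map_mul, map_pow, PowerSeries.constantCoeff_X, h2]
    rw [← PowerSeries.coeff_zero_eq_constantCoeff_apply, Polynomial.coeff_coe, coeff_den _
        (by omega)]
    have h3 : Ring.choose ((k : ℚ) - ν) (2 * k + 1) ≠ 0 :=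
      choose_ne_zero_of_not_int (fun z hz => hν (k - z) (by push_cast; linarith)) _
    have h4 : ((2 * (k + 1) - 0).choose (k + 1) : ℚ) ≠ 0 := by
      exact_mod_cast (Nat.choose_pos (by omega)).ne'
    simp only [Ring.choose_zero_right, one_mul]
    simp [h3]
    simpa using h4
  · ext m
    rw [Polynomial.coeff_C_mul_X_pow]
    split_ifs with hm
    · rw [hm]
    · rcases lt_or_gt_of_ne hm with h | h
      · rw [← Polynomial.coeff_coe, hser, PowerSeries.coeff_X_pow_mul', if_neg (by omega)]
      · exact Polynomial.coeff_eq_zero_of_natDegree_lt (by omega)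

end Pade

namespace Pade

theorem factorial_dvd_prod_sub (b : ℤ) (j : ℕ) :
    (j.factorial : ℤ) ∣ ∏ i ∈ Finset.range j, (b - i) := by
  refine ⟨Ring.choose b j, ?_⟩
  have h : ∀ j : ℕ, (descPochhammer ℤ j).smeval b = ∏ i ∈ Finset.range j, (b - i) := by
    intro j
    induction j with
    | zero => simp
    | succ j ih =>
      rw [descPochhammer_succ_right, Polynomial.smeval_mul, ih, Finset.prod_range_succ]
      simp [Polynomial.smeval_sub, Polynomial.smeval_natCast]
  rw [← nsmul_eq_mul, ← Ring.descPochhammer_eq_factorial_smul_choose, h]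

theorem factorial_dvd_pow_mul_prod {l : ℕ} (hl : l.Prime) (a : ℤ) (j : ℕ) :
    (j.factorial : ℤ) ∣ (l : ℤ) ^ j * ∏ i ∈ Finset.range j, (a - l * i) := by
  have := Fact.mk hl
  obtain ⟨e, w, hw, hjw⟩ := Nat.exists_eq_pow_mul_and_not_dvd j.factorial_ne_zero l hl.one_lt.ne'
  have he : e ≤ j := by
    refine le_trans ?_ (padicValNat_factorial_le (p := l) j)
    exact (padicValNat_dvd_iff_le j.factorial_ne_zero).mp ⟨w, hjw⟩
  have hcop : IsCoprime (w : ℤ) (l : ℤ) :=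
    Nat.isCoprime_iff_coprime.mpr ((Nat.Prime.coprime_iff_not_dvd hl).mpr hw).symm
  rw [hjw]
  push_cast
  refine mul_dvd_mul (pow_dvd_pow _ he) ?_
  obtain ⟨u, v, huv⟩ := hcop
  have hcop2 : IsCoprime (w : ℤ) (v ^ j) := (IsCoprime.pow_right ⟨u, l, by linarith⟩)
  refine hcop2.dvd_of_dvd_mul_left ?_
  have h1 : (w : ℤ) ∣ ∏ i ∈ Finset.range j, (v * a - i) :=
    (Dvd.intro_left ((l : ℤ) ^ e) (by rw [hjw]; push_cast; rfl)).trans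
        (factorial_dvd_prod_sub (v * a) j)
  have h2 : v ^ j * ∏ i ∈ Finset.range j, (a - l * i) ≡
      ∏ i ∈ Finset.range j, (v * a - i) [ZMOD w] := by
    rw [← Finset.card_range j, ← Finset.prod_const, Finset.card_range, ← Finset.prod_mul_distrib]
    refine Int.ModEq.prod fun i _ => ?_
    refine (Int.modEq_iff_dvd).mpr ⟨-u * i, ?_⟩
    linear_combination (i : ℤ) * huv
  exact (Int.modEq_zero_iff_dvd).mp (h2.trans ((Int.modEq_zero_iff_dvd).mpr h1))

theorem exists_int_choose {l : ℕ} (hl : l.Prime) (a : ℤ) (j : ℕ) :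
    ∃ z : ℤ, (l : ℚ) ^ (2 * j) * Ring.choose ((a : ℚ) / l) j = z := by
  obtain ⟨z, hz⟩ := factorial_dvd_pow_mul_prod hl a j
  refine ⟨z, ?_⟩
  have hl0 : (l : ℚ) ≠ 0 := by exact_mod_cast hl.ne_zero
  have hj : (j.factorial : ℚ) ≠ 0 := by exact_mod_cast j.factorial_ne_zero
  apply mul_left_cancel₀ hj
  have h1 : (l : ℚ) ^ j * ∏ i ∈ Finset.range j, ((a : ℚ) - l * i) = j.factorial * z := by
    exact_mod_cast hz
  have h2 : (l : ℚ) ^ j * ∏ i ∈ Finset.range j, ((a : ℚ) / l - i) =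
      ∏ i ∈ Finset.range j, ((a : ℚ) - l * i) := by
    rw [← Finset.card_range j, ← Finset.prod_const, Finset.card_range, ← Finset.prod_mul_distrib]
    refine Finset.prod_congr rfl fun i _ => ?_
    field_simp
  rw [← h1, ← h2, ← factorial_mul_choose]
  ring

/-- The rational numbers `x` such that `l ^ (2 * j) * x` is an integer are closed under the
operations needed to handle products of power series. -/
theorem exists_int_coeff_den {l : ℕ} (hl : l.Prime) (k j : ℕ) :
    ∃ z : ℤ, (l : ℚ) ^ (2 * j) * (den (1 / l) k).coeff j = z := by
  rcases le_or_gt j k with h | h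
  · obtain ⟨z, hz⟩ := exists_int_choose hl (k * l - 1) j
    refine ⟨z * ((-1) ^ k * Nat.choose (2 * k - j) k), ?_⟩
    have hl0 : (l : ℚ) ≠ 0 := by exact_mod_cast hl.ne_zero
    rw [coeff_den _ h, show (k : ℚ) - 1 / l = ((k * l - 1 : ℤ) : ℚ) / l by
      push_cast; field_simp, ← mul_assoc, hz]
    push_cast; ring
  · exact ⟨0, by rw [coeff_eq_zero_of_natDegree_lt ((natDegree_den _ _).trans_lt h)]; simp⟩

theorem coeff_num_eq_sum (ν : ℚ) {k j : ℕ} (h : j ≤ 2 * k) :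
    (num ν k).coeff j = ∑ x ∈ Finset.HasAntidiagonal.antidiagonal j, Ring.choose ν x.1 *
        (den ν k).coeff x.2 := by
  obtain ⟨R, hR, -⟩ := num_sub ν k
  have h1 := congrArg (PowerSeries.coeff j) (sub_eq_iff_eq_add.mp hR)
  rw [map_add, PowerSeries.coeff_X_pow_mul', if_neg (by omega), zero_add, coeff_coe,
    PowerSeries.coeff_mul] at h1
  simpa using h1

theorem exists_int_coeff_num {l : ℕ} (hl : l.Prime) (k j : ℕ) :
    ∃ z : ℤ, (l : ℚ) ^ (2 * j) * (num (1 / l) k).coeff j = z := by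
  rcases le_or_gt j k with h | h
  · choose z hz using fun i => exists_int_coeff_den hl k i
    choose y hy using fun i => exists_int_choose hl 1 i
    refine ⟨∑ x ∈ Finset.HasAntidiagonal.antidiagonal j, y x.1 * z x.2, ?_⟩
    rw [coeff_num_eq_sum _ (by omega), Finset.mul_sum]
    push_cast
    refine Finset.sum_congr rfl fun x hx => ?_
    rw [← hz, ← hy, ← Finset.HasAntidiagonal.mem_antidiagonal.mp hx, mul_add, pow_add]
    push_cast; ring
  · exact ⟨0, by rw [coeff_eq_zero_of_natDegree_lt ((natDegree_num _ _).trans_lt h)]; simp⟩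

theorem abs_choose_le_one {ν : ℚ} (h0 : 0 ≤ ν) (h1 : ν ≤ 1) (j : ℕ) : |Ring.choose ν j| ≤ 1 := by
  have hj : (0 : ℚ) < j.factorial := by exact_mod_cast j.factorial_pos
  refine le_of_mul_le_mul_left ?_ hj
  rw [← Nat.abs_cast j.factorial, ← abs_mul, factorial_mul_choose, Nat.abs_cast, mul_one,
    Finset.abs_prod, ← Finset.prod_range_add_one_eq_factorial]
  push_cast
  refine Finset.prod_le_prod (fun _ _ => abs_nonneg _) fun i _ => ?_
  rw [abs_le]
  constructor <;> have : (0 : ℚ) ≤ i := by positivity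
  all_goals linarith

theorem abs_coeff_den_le {ν : ℚ} (h0 : 0 ≤ ν) (h1 : ν ≤ 1) {k j : ℕ} (h : j ≤ k) :
    |(den ν k).coeff j| ≤ Nat.choose k j * 4 ^ k := by
  rw [coeff_den _ h, abs_mul, abs_mul, abs_pow, abs_neg, abs_one, one_pow, one_mul, Nat.abs_cast]
  have h2 : (Nat.choose (2 * k - j) k : ℚ) ≤ 4 ^ k := by
    have : Nat.choose (2 * k - j) k ≤ 4 ^ k :=
      (Nat.choose_le_two_pow _ _).trans (by
        rw [show 4 = 2 ^ 2 by norm_num, ← pow_mul]; exact Nat.pow_le_pow_right (by norm_num)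
            (by omega))
    exact_mod_cast this
  refine mul_le_mul ?_ h2 (by positivity) (by positivity)
  have hj : (0 : ℚ) < j.factorial := by exact_mod_cast j.factorial_pos
  refine le_of_mul_le_mul_left ?_ hj
  rw [← Nat.abs_cast j.factorial, ← abs_mul, factorial_mul_choose, Nat.abs_cast,
    ← Nat.cast_mul, ← Nat.descFactorial_eq_factorial_mul_choose, Nat.descFactorial_eq_prod_range,
    Finset.abs_prod]
  push_cast
  refine Finset.prod_le_prod (fun _ _ => abs_nonneg _) fun i hi => ?_
  have hik : i + 1 ≤ k := by have := Finset.mem_range.mp hi; omega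
  have : (i : ℚ) + 1 ≤ k := by exact_mod_cast hik
  rw [Nat.cast_sub (by omega), abs_le]
  constructor <;> linarith

theorem sum_abs_coeff_den_le {ν : ℚ} (h0 : 0 ≤ ν) (h1 : ν ≤ 1) (k : ℕ) :
    ∑ j ∈ Finset.range (k + 1), |(den ν k).coeff j| ≤ 8 ^ k := by
  calc _ ≤ ∑ j ∈ Finset.range (k + 1), (Nat.choose k j * 4 ^ k : ℚ) :=
        Finset.sum_le_sum fun j hj => abs_coeff_den_le h0 h1
            (by have := Finset.mem_range.mp hj; omega)
    _ = 8 ^ k := by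
        rw [← Finset.sum_mul, ← Nat.cast_sum, Nat.sum_range_choose]
        push_cast; rw [← mul_pow]; norm_num

theorem abs_coeff_binomialSeries_mul_den_le {ν : ℚ} (h0 : 0 ≤ ν) (h1 : ν ≤ 1) (k m : ℕ) :
    |PowerSeries.coeff m (PowerSeries.binomialSeries ℚ ν * (den ν k : PowerSeries ℚ))| ≤ 8 ^ k := by
  rw [PowerSeries.coeff_mul]
  refine (Finset.abs_sum_le_sum_abs _ _).trans ?_
  calc _ ≤ ∑ x ∈ Finset.HasAntidiagonal.antidiagonal m, |(den ν k).coeff x.2| := by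
        refine Finset.sum_le_sum fun x _ => ?_
        rw [abs_mul, coeff_coe, PowerSeries.binomialSeries_coeff, smul_eq_mul, mul_one]
        exact mul_le_of_le_one_left (abs_nonneg _) (abs_choose_le_one h0 h1 _)
    _ = ∑ j ∈ Finset.range (m + 1), |(den ν k).coeff j| := by
        rw [Finset.Nat.sum_antidiagonal_eq_sum_range_succ_mk]
        exact Finset.sum_range_reflect (fun j => |(den ν k).coeff j|) (m + 1)
    _ ≤ ∑ j ∈ Finset.range (max m k + 1), |(den ν k).coeff j| :=
        Finset.sum_le_sum_of_subset_of_nonneg (Finset.range_mono (by simp)) fun _ _ _ =>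
            abs_nonneg _
    _ = ∑ j ∈ Finset.range (k + 1), |(den ν k).coeff j| := by
        symm
        refine Finset.sum_subset (Finset.range_mono (by simp)) fun j _ hj => ?_
        rw [coeff_eq_zero_of_natDegree_lt, abs_zero]
        have := natDegree_den ν k
        simp at hj; omega
    _ ≤ 8 ^ k := sum_abs_coeff_den_le h0 h1 k

theorem abs_coeff_num_le {ν : ℚ} (h0 : 0 ≤ ν) (h1 : ν ≤ 1) (k m : ℕ) :
    |(num ν k).coeff m| ≤ 8 ^ k := by
  rcases le_or_gt m k with h | h
  · refine le_trans (le_of_eq ?_) (abs_coeff_binomialSeries_mul_den_le h0 h1 k m)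
    obtain ⟨R, hR, -⟩ := num_sub ν k
    have h1 := congrArg (PowerSeries.coeff m) (sub_eq_iff_eq_add.mp hR)
    rw [map_add, PowerSeries.coeff_X_pow_mul', if_neg (by omega), zero_add, coeff_coe] at h1
    rw [h1]
  · rw [coeff_eq_zero_of_natDegree_lt ((natDegree_num _ _).trans_lt h), abs_zero]; positivity

theorem norm_aeval_le {P : ℚ[X]} {k : ℕ} (hP : P.natDegree ≤ k) {M : ℝ}
    (hM : ∑ j ∈ Finset.range (k + 1), |(P.coeff j : ℝ)| ≤ M) (t : ℂ) :
    ‖aeval t P‖ ≤ M * max 1 ‖t‖ ^ k := by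
  rw [aeval_eq_sum_range' (Nat.lt_succ_of_le hP)]
  refine (norm_sum_le _ _).trans ?_
  calc _ ≤ ∑ j ∈ Finset.range (k + 1), |(P.coeff j : ℝ)| * max 1 ‖t‖ ^ k := by
        refine Finset.sum_le_sum fun j hj => ?_
        rw [norm_smul, norm_pow]
        refine mul_le_mul (le_of_eq ?_) ?_ (by positivity) (abs_nonneg _)
        · rw [← Rat.norm_cast_real, Real.norm_eq_abs]
        · refine (pow_le_pow_left₀ (norm_nonneg _) (le_max_right 1 _) j).trans ?_
          exact pow_le_pow_right₀ (le_max_left _ _) (by have := Finset.mem_range.mp hj; omega)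
    _ ≤ _ := by rw [← Finset.sum_mul]; exact mul_le_mul_of_nonneg_right hM (by positivity)

theorem norm_aeval_den_le {ν : ℚ} (h0 : 0 ≤ ν) (h1 : ν ≤ 1) (k : ℕ) (t : ℂ) :
    ‖aeval t (den ν k)‖ ≤ 16 ^ k * max 1 ‖t‖ ^ k := by
  refine norm_aeval_le (natDegree_den ν k) ?_ t
  have := sum_abs_coeff_den_le h0 h1 k
  have h2 : (∑ j ∈ Finset.range (k + 1), |((den ν k).coeff j : ℝ)|) ≤ 8 ^ k :=
      by exact_mod_cast this
  exact h2.trans (pow_le_pow_left₀ (by norm_num) (by norm_num) _)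

theorem norm_aeval_num_le {ν : ℚ} (h0 : 0 ≤ ν) (h1 : ν ≤ 1) (k : ℕ) (t : ℂ) :
    ‖aeval t (num ν k)‖ ≤ 16 ^ k * max 1 ‖t‖ ^ k := by
  refine norm_aeval_le (natDegree_num ν k) ?_ t
  calc _ ≤ ∑ j ∈ Finset.range (k + 1), (8 : ℝ) ^ k :=
        Finset.sum_le_sum fun j _ => by exact_mod_cast abs_coeff_num_le h0 h1 k j
    _ ≤ 16 ^ k := by
        rw [Finset.sum_const, Finset.card_range, nsmul_eq_mul, show (16 : ℝ) = 2 * 8 by norm_num,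
          mul_pow]
        refine mul_le_mul_of_nonneg_right ?_ (by positivity)
        exact_mod_cast Nat.lt_two_pow_self (n := k)

theorem hasSum_congr_fun {f g : ℕ → ℂ} {a : ℂ} (h : ∀ m, f m = g m) : HasSum f a ↔ HasSum g a := by
  rw [funext h]

theorem hasSum_coeff_mul {F : PowerSeries ℚ} {t s : ℂ}
    (h : HasSum (fun m => ((PowerSeries.coeff m F : ℚ) : ℂ) * t ^ m) s) (P : ℚ[X]) :
    HasSum (fun m => ((PowerSeries.coeff m (F * (P : PowerSeries ℚ)) : ℚ) : ℂ) * t ^ m)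
      (s * aeval t P) := by
  induction P using Polynomial.induction_on with
  | C a =>
    rw [aeval_C, Polynomial.coe_C]
    refine (hasSum_congr_fun fun m => ?_).mpr (h.mul_right (algebraMap ℚ ℂ a))
    rw [PowerSeries.coeff_mul_C, eq_ratCast]; push_cast; ring
  | add P Q hP hQ =>
    rw [map_add, mul_add]
    refine (hasSum_congr_fun fun m => ?_).mpr (hP.add hQ)
    rw [Polynomial.coe_add, mul_add, map_add]; push_cast; ring
  | monomial n a ih =>
    have h1 : F * ((Polynomial.C a * X ^ (n + 1) : ℚ[X]) : PowerSeries ℚ) =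
        PowerSeries.X * (F * ((Polynomial.C a * X ^ n : ℚ[X]) : PowerSeries ℚ)) := by
      simp only [coe_mul, coe_pow, coe_X]; ring
    rw [h1]
    rw [← hasSum_nat_add_iff' 1]
    simp only [PowerSeries.coeff_succ_X_mul]
    have h2 : s * aeval t (Polynomial.C a * X ^ (n + 1)) -
        ∑ i ∈ Finset.range 1, ((PowerSeries.coeff i (PowerSeries.X *
          (F * ((Polynomial.C a * X ^ n : ℚ[X]) : PowerSeries ℚ))) : ℚ) : ℂ) * t ^ i =
        t * (s * aeval t (Polynomial.C a * X ^ n)) := by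
      simp only [Finset.sum_range_one, PowerSeries.coeff_zero_X_mul, map_mul, map_pow, aeval_X,
        Rat.cast_zero]
      ring
    rw [h2]
    refine (hasSum_congr_fun fun m => ?_).mpr (ih.mul_left t)
    ring

theorem hasSum_binomialSeries (ν : ℚ) {t : ℂ} (ht : ‖t‖ < 1) :
    HasSum (fun m => ((PowerSeries.coeff m (PowerSeries.binomialSeries ℚ ν) : ℚ) : ℂ) * t ^ m)
      ((1 + t) ^ (ν : ℂ)) := by
  have h := (Complex.one_add_cpow_hasFPowerSeriesOnBall_zero (a := (ν : ℂ))).hasSum (y := t)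
    (by rw [mem_eball_zero_iff, ← ofReal_norm, ENNReal.ofReal_lt_one]; exact ht)
  simp only [zero_add] at h
  refine (hasSum_congr_fun fun m => ?_).mpr h
  rw [binomialSeries_apply, PowerSeries.binomialSeries_coeff, smul_eq_mul, mul_one]
  have := Ring.map_choose (algebraMap ℚ ℂ) ν m
  simp only [eq_ratCast] at this
  rw [this]; simp

theorem norm_remainder_le {ν : ℚ} (h0 : 0 ≤ ν) (h1 : ν ≤ 1) (k : ℕ) {t : ℂ} (ht : ‖t‖ ≤ 1 / 2) :
    ‖aeval t (num ν k) - (1 + t) ^ (ν : ℂ) * aeval t (den ν k)‖ ≤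
        2 * 8 ^ k * ‖t‖ ^ (2 * k + 1) := by
  have hs := hasSum_coeff_mul (hasSum_binomialSeries ν (ht.trans_lt (by norm_num))) (den ν k)
  have hn : HasSum (fun m => ((num ν k).coeff m : ℂ) * t ^ m) (aeval t (num ν k)) := by
    rw [aeval_eq_sum_range]
    refine (hasSum_congr_fun fun m => ?_).mpr (hasSum_sum_of_ne_finset_zero
      (f := fun m => (num ν k).coeff m • t ^ m) fun b hb => ?_)
    · simp [Algebra.smul_def]
    · rw [coeff_eq_zero_of_natDegree_lt (by simp at hb; omega)]; simp
  have hd := hn.sub hs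
  obtain ⟨R, hR, -⟩ := num_sub ν k
  have hco : ∀ m, ((num ν k).coeff m : ℂ) * t ^ m -
      ((PowerSeries.coeff m
          (PowerSeries.binomialSeries ℚ ν * (den ν k : PowerSeries ℚ)) : ℚ) : ℂ) * t ^ m =
      ((PowerSeries.coeff m (PowerSeries.X ^ (2 * k + 1) * R) : ℚ) : ℂ) * t ^ m := by
    intro m
    rw [← hR, map_sub, coeff_coe]; push_cast; ring
  have hlow : ∀ m < 2 * k + 1, PowerSeries.coeff m (PowerSeries.X ^ (2 * k + 1) * R) = 0 := by
    intro m hm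
    rw [PowerSeries.coeff_X_pow_mul', if_neg (by omega)]
  have hhigh : ∀ m, |PowerSeries.coeff (m + (2 * k + 1))
      (PowerSeries.X ^ (2 * k + 1) * R)| ≤ 8 ^ k := by
    intro m
    rw [← hR, map_sub, coeff_coe, coeff_eq_zero_of_natDegree_lt
      ((natDegree_num ν k).trans_lt (by omega)), zero_sub, abs_neg]
    exact abs_coeff_binomialSeries_mul_den_le h0 h1 k _
  simp only [hco] at hd
  rw [← hasSum_nat_add_iff' (2 * k + 1), Finset.sum_eq_zero (fun m hm => by
    rw [hlow m (Finset.mem_range.mp hm)]; simp), sub_zero] at hd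
  have hg : HasSum (fun m : ℕ => (8 : ℝ) ^ k * ‖t‖ ^ (2 * k + 1) * (1 / 2) ^ m)
      (8 ^ k * ‖t‖ ^ (2 * k + 1) * 2) := hasSum_geometric_two.mul_left _
  rw [← hd.tsum_eq]
  refine (tsum_of_norm_bounded hg fun m => ?_).trans (le_of_eq (by ring))
  rw [norm_mul, norm_pow, pow_add ‖t‖, mul_assoc, mul_comm (‖t‖ ^ (2 * k + 1))]
  refine mul_le_mul ?_ (mul_le_mul_of_nonneg_right (pow_le_pow_left₀ (norm_nonneg _) ht m)
    (by positivity)) (by positivity) (by positivity)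
  rw [show ‖((PowerSeries.coeff (m + (2 * k + 1)) (PowerSeries.X ^ (2 * k + 1) * R) : ℚ) : ℂ)‖ =
    |((PowerSeries.coeff (m + (2 * k + 1)) (PowerSeries.X ^ (2 * k + 1) * R) : ℚ) : ℝ)| by
      rw [← Complex.ofReal_ratCast, Complex.norm_real, Real.norm_eq_abs]]
  exact_mod_cast hhigh m

end Pade

namespace Pade

theorem num_zero (ν : ℚ) : num ν 0 = 1 := by simp [num]

theorem den_zero (ν : ℚ) : den ν 0 = 1 := by
  ext m
  rcases Nat.eq_zero_or_pos m with rfl | h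
  · rw [coeff_den _ le_rfl]; simp
  · rw [coeff_eq_zero_of_natDegree_lt ((natDegree_den _ _).trans_lt h), coeff_one, if_neg h.ne']

theorem norm_one_sub_cpow_le {ν : ℚ} (h0 : 0 ≤ ν) (h1 : ν ≤ 1) {t : ℂ} (ht : ‖t‖ ≤ 1 / 2) :
    ‖1 - (1 + t) ^ (ν : ℂ)‖ ≤ 2 * ‖t‖ := by
  simpa [num_zero, den_zero] using norm_remainder_le h0 h1 0 ht

/-- The auxiliary linear form attached to two points on `1 + t = b * Y ^ n`. -/
noncomputable def linForm {F : Type*} [Field F] [CharZero F] (ν : ℚ) (k : ℕ) (t Y Y' : F) : F :=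
  Y' * aeval t (num ν k) - Y * aeval t (den ν k)

theorem norm_linForm_le_of_small {ν : ℚ} (h0 : 0 ≤ ν) (h1 : ν ≤ 1) (k : ℕ) {t t' η : ℂ}
    (ht : ‖t‖ ≤ 1 / 2) (ht' : ‖t'‖ ≤ 1 / 2) :
    ‖linForm ν k t (η * (1 + t) ^ (ν : ℂ)) (η * (1 + t') ^ (ν : ℂ))‖ ≤
      4 * ‖η‖ * 16 ^ k * max (‖t‖ ^ (2 * k + 1)) ‖t'‖ := by
  have e : linForm ν k t (η * (1 + t) ^ (ν : ℂ)) (η * (1 + t') ^ (ν : ℂ)) =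
      η * ((aeval t (num ν k) - (1 + t) ^ (ν : ℂ) * aeval t (den ν k)) -
        (1 - (1 + t') ^ (ν : ℂ)) * aeval t (num ν k)) := by
    rw [linForm]; ring
  have b1 := norm_remainder_le h0 h1 k ht
  have b2 := norm_one_sub_cpow_le h0 h1 ht'
  have b3 := norm_aeval_num_le h0 h1 k t
  rw [max_eq_left (ht.trans (by norm_num)), one_pow, mul_one] at b3
  have b4 : (8 : ℝ) ^ k ≤ 16 ^ k := pow_le_pow_left₀ (by norm_num) (by norm_num) _
  rw [e, norm_mul]
  set m := max (‖t‖ ^ (2 * k + 1)) ‖t'‖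
  have m1 : ‖t‖ ^ (2 * k + 1) ≤ m := le_max_left _ _
  have m2 : ‖t'‖ ≤ m := le_max_right _ _
  have m0 : 0 ≤ m := (norm_nonneg _).trans m2
  have c1 : 2 * 8 ^ k * ‖t‖ ^ (2 * k + 1) ≤ 2 * 16 ^ k * m := by gcongr
  have c2 : ‖(1 - (1 + t') ^ (ν : ℂ)) * aeval t (num ν k)‖ ≤ 2 * m * 16 ^ k := by
    rw [norm_mul]; gcongr; exact b2.trans (by linarith)
  calc _ ≤ ‖η‖ * (2 * 16 ^ k * m + 2 * m * 16 ^ k) := by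
        gcongr
        exact (norm_sub_le _ _).trans (add_le_add (b1.trans c1) c2)
    _ = _ := by ring

theorem norm_linForm_le {ν : ℚ} (h0 : 0 ≤ ν) (h1 : ν ≤ 1) (k : ℕ) (t Y Y' : ℂ) :
    ‖linForm ν k t Y Y'‖ ≤ 2 * 16 ^ k * max 1 ‖t‖ ^ k * max ‖Y‖ ‖Y'‖ := by
  have b1 := norm_aeval_num_le h0 h1 k t
  have b2 := norm_aeval_den_le h0 h1 k t
  rw [linForm]
  refine (norm_sub_le _ _).trans ?_
  rw [norm_mul, norm_mul]
  have m1 : ‖Y‖ ≤ max ‖Y‖ ‖Y'‖ := le_max_left _ _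
  have m2 : ‖Y'‖ ≤ max ‖Y‖ ‖Y'‖ := le_max_right _ _
  calc _ ≤ max ‖Y‖ ‖Y'‖ * (16 ^ k * max 1 ‖t‖ ^ k) + max ‖Y‖ ‖Y'‖ * (16 ^ k * max 1 ‖t‖ ^ k) := by
        gcongr
    _ = _ := by ring

theorem linForm_ne_zero {F : Type*} [Field F] [CharZero F] {ν : ℚ} (hν : ∀ z : ℤ, ν ≠ z) (k : ℕ)
    {t Y Y' : F} (ht : t ≠ 0) (hY : Y ≠ 0) :
    linForm ν k t Y Y' ≠ 0 ∨ linForm ν (k + 1) t Y Y' ≠ 0 := by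
  by_contra! h
  obtain ⟨h1, h2⟩ := h
  obtain ⟨κ, hκ, h3⟩ := wronskian ν hν k
  have h4 := congrArg (aeval t) h3
  simp only [map_sub, map_mul, aeval_C, map_pow, aeval_X, eq_ratCast] at h4
  rw [linForm] at h1 h2
  have h5 : Y * ((κ : F) * t ^ (2 * k + 1)) = 0 := by
    rw [← h4]
    linear_combination (aeval t (num ν (k + 1))) * h1 - (aeval t (num ν k)) * h2
  simp [hY, ht, hκ] at h5

theorem linForm_isIntegral {F : Type*} [Field F] [CharZero F] {l : ℕ} (hl : l.Prime) (k : ℕ)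
    {N : ℕ} {t Y Y' : F} (ht : IsIntegral ℤ (N * t)) (hY : IsIntegral ℤ Y) (hY' : IsIntegral ℤ Y') :
    IsIntegral ℤ (((l : F) ^ 2 * N) ^ k * linForm (1 / l) k t Y Y') := by
  have key : ∀ P : ℚ[X], P.natDegree ≤ k → (∀ j, ∃ z : ℤ, (l : ℚ) ^ (2 * j) * P.coeff j = z) →
      IsIntegral ℤ (((l : F) ^ 2 * N) ^ k * aeval t P) := by
    intro P hP hz
    rw [aeval_eq_sum_range' (Nat.lt_succ_of_le hP), Finset.mul_sum]
    refine IsIntegral.sum _ fun j hj => ?_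
    have hjk : j ≤ k := Nat.lt_succ_iff.mp (Finset.mem_range.mp hj)
    obtain ⟨z, hz⟩ := hz j
    have hz' : (l : F) ^ (2 * j) * ((P.coeff j : ℚ) : F) = z := by
      exact_mod_cast congrArg (Rat.cast (K := F)) hz
    have e : ((l : F) ^ 2 * N) ^ k * P.coeff j • t ^ j =
        ((z * (l : ℤ) ^ (2 * (k - j)) * (N : ℤ) ^ (k - j) : ℤ) : F) * (N * t) ^ j := by
      obtain ⟨i, rfl⟩ := Nat.exists_eq_add_of_le hjk
      push_cast
      rw [← hz', Algebra.smul_def, eq_ratCast, Nat.add_sub_cancel_left]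
      ring
    rw [e]
    exact (isIntegral_algebraMap (R := ℤ)
        (x := (z * (l : ℤ) ^ (2 * (k - j)) * (N : ℤ) ^ (k - j)))).mul
      (ht.pow j)
  rw [linForm, mul_sub, mul_left_comm, mul_left_comm _ Y]
  exact (hY'.mul (key _ (natDegree_num _ _) (exists_int_coeff_num hl k))).sub
    (hY.mul (key _ (natDegree_den _ _) (exists_int_coeff_den hl k)))

open Real in
/-- Logarithmic form of the bound for the linear form at a place where both points are close. -/
theorem log_norm_linForm_le_of_small {ν : ℚ} (h0 : 0 ≤ ν) (h1 : ν ≤ 1) {k n : ℕ} {C₀ : ℝ}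
    (hC : 0 ≤ C₀)
    {a t t' η X X' Y Y' : ℂ} (ha : a ≠ 0) (hX : X ≠ 0) (hX' : X' ≠ 0) (hη : η ≠ 0)
    (hta : t = -(a * X ^ n)) (hta' : t' = -(a * X' ^ n)) (hlog : log ‖a‖ ≤ C₀)
        (hlogη : log ‖η‖ ≤ C₀)
    (ht : ‖t‖ ≤ 1 / 2) (ht' : ‖t'‖ ≤ 1 / 2)
    (hY : Y = η * (1 + t) ^ (ν : ℂ)) (hY' : Y' = η * (1 + t') ^ (ν : ℂ))
    (hne : linForm ν k t Y Y' ≠ 0) :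
    log ‖linForm ν k t Y Y'‖ ≤ 3 * (C₀ + 2) * (k + 1) +
      n * max ((2 * k + 1) * log ‖X‖) (log ‖X'‖) := by
  have hb := norm_linForm_le_of_small h0 h1 k (η := η) ht ht'
  rw [← hY, ← hY'] at hb
  have ht0 : t ≠ 0 := by rw [hta]; simp [ha, hX]
  have ht0' : t' ≠ 0 := by rw [hta']; simp [ha, hX']
  have hnt : log ‖t‖ = log ‖a‖ + n * log ‖X‖ := by
    rw [hta, norm_neg, norm_mul, norm_pow, log_mul (by simpa using ha) (by simp [hX]), log_pow]
  have hnt' : log ‖t'‖ = log ‖a‖ + n * log ‖X'‖ := by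
    rw [hta', norm_neg, norm_mul, norm_pow, log_mul (by simpa using ha) (by simp [hX']), log_pow]
  have p1 : 0 < ‖t‖ ^ (2 * k + 1) := by positivity
  have p2 : 0 < ‖t'‖ := by positivity
  have p3 : 0 < ‖η‖ := by positivity
  have l4 : log 4 ≤ 3 := (log_le_sub_one_of_pos (by norm_num)).trans (by norm_num)
  have l16 : log 16 ≤ 6 := by
    rw [show (16 : ℝ) = 4 ^ 2 by norm_num, log_pow]; push_cast; linarith
  have hk : (0 : ℝ) ≤ k := by positivity
  have hlog' := log_le_log (by positivity) hb
  have hmax : log (max (‖t‖ ^ (2 * k + 1)) ‖t'‖) ≤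
      (2 * k + 1) * C₀ + n * max ((2 * k + 1) * log ‖X‖) (log ‖X'‖) := by
    have hn : (0 : ℝ) ≤ n := by positivity
    rcases max_choice (‖t‖ ^ (2 * k + 1)) ‖t'‖ with h | h <;> rw [h]
    · rw [log_pow, hnt]; push_cast
      have := mul_le_mul_of_nonneg_left (le_max_left ((2 * k + 1) * log ‖X‖) (log ‖X'‖)) hn
      nlinarith
    · rw [hnt']
      have := mul_le_mul_of_nonneg_left (le_max_right ((2 * k + 1) * log ‖X‖) (log ‖X'‖)) hn
      nlinarith
  rw [log_mul (by positivity) (lt_max_of_lt_left p1).ne', log_mul (by positivity) (by positivity),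
    log_mul (by positivity) (by positivity), log_pow] at hlog'
  nlinarith

open Real in
theorem log_norm_linForm_le {ν : ℚ} (h0 : 0 ≤ ν) (h1 : ν ≤ 1) {k n : ℕ} (hn : 0 < n) {C₀ : ℝ}
    (hC : 0 ≤ C₀) {a b t X X' Y Y' : ℂ} (ha : a ≠ 0) (hb : b ≠ 0)
    (hY0 : Y ≠ 0) (hY0' : Y' ≠ 0)
    (hta : t = -(a * X ^ n)) (hloga : log (1 + ‖a‖) ≤ C₀) (hlogb : -log ‖b‖ ≤ C₀)
    (hY : a * X ^ n + b * Y ^ n = 1) (hY' : a * X' ^ n + b * Y' ^ n = 1)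
    (hne : linForm ν k t Y Y' ≠ 0) :
    log ‖linForm ν k t Y Y'‖ ≤ 3 * (C₀ + 2) * (k + 1) +
      (n * k * log (max 1 ‖X‖) + max (log (max 1 ‖X‖)) (log (max 1 ‖X'‖))) := by
  have hY1 : ∀ X Y : ℂ, Y ≠ 0 → a * X ^ n + b * Y ^ n = 1 →
      log ‖Y‖ ≤ 2 * C₀ + log (max 1 ‖X‖) := by
    intro X Y hY0 h
    have e : b * Y ^ n = 1 - a * X ^ n := by linear_combination h
    have e2 : ‖b‖ * ‖Y‖ ^ n ≤ (1 + ‖a‖) * max 1 ‖X‖ ^ n := by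
      rw [← norm_pow, ← norm_mul, e]
      refine (norm_sub_le _ _).trans ?_
      rw [norm_one, norm_mul, norm_pow, add_mul, one_mul]
      gcongr
      · exact one_le_pow₀ (le_max_left _ _)
      · exact le_max_right _ _
    have p : 0 < max 1 ‖X‖ := by positivity
    have e3 := log_le_log (by positivity) e2
    rw [log_mul (by positivity) (by positivity), log_mul (by positivity) (by positivity),
      log_pow, log_pow] at e3
    have hn1 : (1 : ℝ) ≤ n := by exact_mod_cast hn
    have : (n : ℝ) * (log ‖Y‖ - log (max 1 ‖X‖)) ≤ 2 * C₀ := by linarith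
    by_contra! hcon
    nlinarith
  have hbd := norm_linForm_le h0 h1 k t Y Y'
  have hlog' := log_le_log (by positivity) hbd
  have p1 : 0 < max 1 ‖t‖ := by positivity
  have p2 : 0 < max ‖Y‖ ‖Y'‖ := lt_max_of_lt_left (by positivity)
  rw [log_mul (by positivity) p2.ne', log_mul (by positivity) (by positivity),
    log_mul (by positivity) (by positivity), log_pow, log_pow] at hlog'
  have htm : log (max 1 ‖t‖) ≤ C₀ + n * log (max 1 ‖X‖) := by
    have : max 1 ‖t‖ ≤ (1 + ‖a‖) * max 1 ‖X‖ ^ n := by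
      have h1 : 1 ≤ max 1 ‖X‖ ^ n := one_le_pow₀ (le_max_left _ _)
      have h2 : ‖X‖ ^ n ≤ max 1 ‖X‖ ^ n := by gcongr; exact le_max_right _ _
      refine max_le ?_ ?_
      · nlinarith [norm_nonneg a]
      · rw [hta, norm_neg, norm_mul, norm_pow]; nlinarith [norm_nonneg a]
    have := log_le_log p1 this
    rw [log_mul (by positivity) (by positivity), log_pow] at this
    linarith
  have hYm : log (max ‖Y‖ ‖Y'‖) ≤ 2 * C₀ + max (log (max 1 ‖X‖)) (log (max 1 ‖X'‖)) := by
    rcases max_choice ‖Y‖ ‖Y'‖ with h | h <;> rw [h]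
    · exact (hY1 X Y hY0 hY).trans (by gcongr; exact le_max_left _ _)
    · exact (hY1 X' Y' hY0' hY').trans (by gcongr; exact le_max_right _ _)
  have l2 : log 2 ≤ 1 := (log_le_sub_one_of_pos (by norm_num)).trans (by norm_num)
  have l16 : log 16 ≤ 4 := by
    rw [show (16 : ℝ) = 2 ^ 4 by norm_num, log_pow]; push_cast; linarith
  have hk : (0 : ℝ) ≤ k := by positivity
  have := mul_le_mul_of_nonneg_left htm hk
  nlinarith

end Pade

namespace UnitEquation

theorem weight_le_of_small {x x' h ρ C e K : ℝ} (hK : 0 ≤ K) (hC : 0 ≤ C) (he : 0 ≤ e)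
    (hh : 0 ≤ h) (hρ : 0 ≤ ρ) (hK1 : ρ - 2 ≤ 2 * K) (hxh' : -h ≤ x)
    (hx' : |x' - ρ * x| ≤ e) (h1 : x ≤ C) (h2 : x' ≤ C) :
    5 * max ((2 * K + 1) * x) x' ≤
      20 * C * (K + 1) + (7 / 2 * (ρ * max 0 x) - 5 * (ρ * max 0 (-x))) + 6 * h + 10 * e := by
  have hCK : 0 ≤ C * K := mul_nonneg hC hK
  obtain ⟨ha, hb⟩ := abs_le.mp hx'
  have hmax : max ((2 * K + 1) * x) x' = (2 * K + 1) * x ∨ max ((2 * K + 1) * x) x' = x' :=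
      max_choice _ _
  rcases le_total x 0 with hx | hx
  · rw [max_eq_left hx, max_eq_right (neg_nonneg.mpr hx)]
    rcases hmax with h | h <;> rw [h] <;> nlinarith
  · rw [max_eq_right hx, max_eq_left (neg_nonpos.mpr hx)]
    have : 0 ≤ ρ * x := mul_nonneg hρ hx
    rcases hmax with h | h <;> rw [h] <;> nlinarith

theorem weight_le {x x' h ρ C e K : ℝ} (hK : 0 ≤ K) (hC : 0 ≤ C) (he : 0 ≤ e)
    (hh : 0 ≤ h) (hρ : 1 ≤ ρ) (hK1 : ρ - 2 ≤ 2 * K) (hK2 : 2 * K ≤ ρ + 2) (hxh : x ≤ h)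
    (hx' : |x' - ρ * x| ≤ e) (h1 : -C ≤ x ∨ -C ≤ x') :
    5 * K * max 0 x + max (max 0 x) (max 0 x') ≤
      20 * C * (K + 1) + (7 / 2 * (ρ * max 0 x) - 5 * (ρ * max 0 (-x))) + 6 * h + 10 * e := by
  have hCK : 0 ≤ C * K := mul_nonneg hC hK
  obtain ⟨ha, hb⟩ := abs_le.mp hx'
  rcases le_total x 0 with hx | hx
  · rw [max_eq_left hx, max_eq_right (neg_nonneg.mpr hx)]
    have h3 : max 0 (max 0 x') ≤ e := by
      refine max_le he (max_le he ?_)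
      nlinarith
    have h4 : ρ * (-x) ≤ 2 * C * (K + 1) + e := by
      rcases h1 with h | h
      · nlinarith
      · nlinarith
    nlinarith
  · rw [max_eq_right hx, max_eq_left (neg_nonpos.mpr hx)]
    have : 0 ≤ ρ * x := mul_nonneg (by linarith) hx
    have h3 : max x (max 0 x') ≤ ρ * x + e := by
      refine max_le (by nlinarith) (max_le (by nlinarith) (by linarith))
    nlinarith

variable {L : Type*} [Field L] [NumberField L]

theorem sum_log_norm_nonneg {z : L} (hz : IsIntegral ℤ z) (h0 : z ≠ 0) :
    0 ≤ ∑ σ : L →+* ℂ, Real.log ‖σ z‖ := by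
  rw [← Real.log_prod (fun σ _ => by simp [h0])]
  refine Real.log_nonneg ?_
  obtain ⟨w, rfl⟩ : ∃ w : 𝓞 L, (w : L) = z := ⟨⟨z, hz⟩, rfl⟩
  have hw : w ≠ 0 := fun h => h0 (by simp [h])
  have h1 : (algebraMap ℚ ℂ) (Algebra.norm ℚ (w : L)) = ∏ σ : L →ₐ[ℚ] ℂ, σ w :=
    Algebra.norm_eq_prod_embeddings ℚ ℂ _
  have h2 : ∏ σ : L →+* ℂ, ‖σ (w : L)‖ = ‖(algebraMap ℚ ℂ) (Algebra.norm ℚ (w : L))‖ := by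
    rw [h1, norm_prod]
    exact Fintype.prod_equiv (RingHom.equivRatAlgHom L ℂ) _ _ fun σ => rfl
  rw [h2, ← Algebra.coe_norm_int]
  simp only [eq_ratCast, Rat.cast_intCast, Complex.norm_intCast]
  exact_mod_cast Int.one_le_abs (Algebra.norm_ne_zero_iff.mpr hw)

/-- The sum of the positive logarithms of the conjugates of a unit. -/
noncomputable def height (u : (𝓞 L)ˣ) : ℝ := ∑ σ : L →+* ℂ, max 0 (Real.log ‖σ u‖)

theorem sum_log_norm_unit (u : (𝓞 L)ˣ) : ∑ σ : L →+* ℂ, Real.log ‖σ u‖ = 0 := by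
  refine le_antisymm ?_ (sum_log_norm_nonneg u.1.2 (by simp))
  have := sum_log_norm_nonneg (u⁻¹).1.2 (by simp : ((u⁻¹ : (𝓞 L)ˣ) : L) ≠ 0)
  have h2 : ∀ σ : L →+* ℂ, Real.log ‖σ ((u⁻¹ : (𝓞 L)ˣ) : L)‖ = -Real.log ‖σ u‖ := by
    intro σ
    rw [← Real.log_inv, ← norm_inv, ← map_inv₀]
    simp
  change 0 ≤ ∑ σ : L →+* ℂ, Real.log ‖σ ((u⁻¹ : (𝓞 L)ˣ) : L)‖ at this
  simp only [h2, Finset.sum_neg_distrib] at this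
  linarith

theorem height_eq_sum_neg (u : (𝓞 L)ˣ) : height u = ∑ σ : L →+* ℂ, max 0 (-Real.log ‖σ u‖) := by
  have h := sum_log_norm_unit u
  rw [height, ← sub_eq_zero, ← Finset.sum_sub_distrib]
  refine Eq.trans (Finset.sum_congr rfl fun σ _ => ?_) h
  rcases le_total 0 (Real.log ‖σ u‖) with h | h
  · rw [max_eq_right h, max_eq_left (by linarith)]; ring
  · rw [max_eq_left h, max_eq_right (by linarith)]; ring

theorem log_norm_le_height (u : (𝓞 L)ˣ) (σ : L →+* ℂ) : Real.log ‖σ u‖ ≤ height u :=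
  (le_max_right 0 _).trans
    (Finset.single_le_sum (f := fun σ : L →+* ℂ => max 0 (Real.log ‖σ u‖))
        (fun _ _ => le_max_left _ _)
      (Finset.mem_univ σ))

theorem neg_height_le_log_norm (u : (𝓞 L)ˣ) (σ : L →+* ℂ) : -height u ≤ Real.log ‖σ u‖ := by
  rw [height_eq_sum_neg, neg_le]
  exact (le_max_right 0 _).trans
    (Finset.single_le_sum (f := fun σ : L →+* ℂ => max 0 (-Real.log ‖σ u‖))
      (fun _ _ => le_max_left _ _) (Finset.mem_univ σ))

theorem height_nonneg (u : (𝓞 L)ˣ) : 0 ≤ height u :=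
  Finset.sum_nonneg fun _ _ => le_max_left _ _

theorem finite_height_le (B : ℝ) : {u : (𝓞 L)ˣ | height u ≤ B}.Finite := by
  refine Set.Finite.of_finite_image (f := fun u : (𝓞 L)ˣ => (u : L))
    ((NumberField.Embeddings.finite_of_norm_le L ℂ (Real.exp B)).subset ?_) ?_
  · rintro _ ⟨u, hu, rfl⟩
    refine ⟨u.1.2, fun σ => ?_⟩
    rw [← Real.exp_log (show 0 < ‖σ (u : L)‖ by simp)]
    exact Real.exp_le_exp.mpr ((log_norm_le_height u σ).trans hu)
  · intro u _ v _ h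
    exact Units.ext (RingOfIntegers.ext h)

/-- The local root of `1 / b` recording the branch of `(1 - a * x ^ 5) ^ (1 / 5)` at a place. -/
noncomputable def branch (a x y : ℂ) : ℂ := y / (1 + -(a * x ^ 5)) ^ (((1 / (5 : ℕ) : ℚ) : ℂ))

theorem branch_spec {a b x y : ℂ} (hb : b ≠ 0) (hy : y ≠ 0) (h : a * x ^ 5 + b * y ^ 5 = 1) :
    branch a x y ≠ 0 ∧ branch a x y ^ 5 = 1 / b ∧
      y = branch a x y * (1 + -(a * x ^ 5)) ^ (((1 / (5 : ℕ) : ℚ) : ℂ)) := by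
  have e : 1 + -(a * x ^ 5) = b * y ^ 5 := by linear_combination -h
  have h1 : 1 + -(a * x ^ 5) ≠ 0 := by rw [e]; simp [hb, hy]
  have h2 : (1 + -(a * x ^ 5)) ^ (((1 / (5 : ℕ) : ℚ) : ℂ)) ≠ 0 := by
    simp [Complex.cpow_eq_zero_iff, h1]
  have h3 : ((1 + -(a * x ^ 5)) ^ (((1 / (5 : ℕ) : ℚ) : ℂ))) ^ 5 = 1 + -(a * x ^ 5) := by
    simp
  refine ⟨div_ne_zero hy h2, ?_, (div_mul_cancel₀ _ h2).symm⟩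
  rw [branch, div_pow, h3, e]
  field_simp

theorem totals_neg {d C h ρ k : ℝ} (hd : 1 ≤ d) (hC : 0 < C) (hh : 0 < h) (hρ : 1 ≤ ρ)
    (hX : 28 * d * (C + 1) ≤ h) (hk : k ≤ ρ / 2 + 2) (hX' : 28 * d * (C + 1) * h ≤ ρ * h) :
    C * d * k - ρ * h + 6 * (d * h) < 0 := by
  have hdC : 0 < d * C := by positivity
  have f1 : d * C * k ≤ d * C * (ρ / 2 + 2) := mul_le_mul_of_nonneg_left hk hdC.le
  have hX1 : 28 * (d * C) ≤ h := by linarith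
  have f2 : 28 * (d * C) * ρ ≤ h * ρ := mul_le_mul_of_nonneg_right hX1 (by linarith)
  have f3 : 0 ≤ d * C * h := by positivity
  have f4 : h ≤ h * ρ := le_mul_of_one_le_right hh.le hρ
  have f5 : 0 < ρ * h := by positivity
  linarith

set_option maxHeartbeats 1000000 in
theorem gap_principle {a b : L} (ha : a ≠ 0) (hb : b ≠ 0) : ∃ C : ℝ, 0 < C ∧
    ∀ X Y X' Y' : (𝓞 L)ˣ, a * (X : L) ^ 5 + b * (Y : L) ^ 5 = 1 →
      a * (X' : L) ^ 5 + b * (Y' : L) ^ 5 = 1 →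
      (∀ σ : L →+* ℂ, branch (σ a) (σ X) (σ Y) = branch (σ a) (σ X') (σ Y')) →
      (∀ σ : L →+* ℂ, |Real.log ‖σ X'‖ / height X' - Real.log ‖σ X‖ / height X| ≤
        1 / (20 * Fintype.card (L →+* ℂ))) →
      C ≤ height X → C * height X ≤ height X' → False := by
  classical
  obtain ⟨N, hN0, hN⟩ : ∃ N : ℕ, 0 < N ∧ IsIntegral ℤ ((N : L) * a) := by
    have : Algebra.IsAlgebraic ℤ L := ⟨fun z => (IsFractionRing.isAlgebraic_iff ℤ ℚ L).mpr
      (Algebra.IsAlgebraic.isAlgebraic (R := ℚ) z)⟩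
    obtain ⟨m, y, hm, hy⟩ := IsAlgebraic.exists_nsmul_eq (𝓞 L)
        (Algebra.IsAlgebraic.isAlgebraic (R := ℤ) a)
    exact ⟨m, Nat.pos_of_ne_zero hm, by rw [← nsmul_eq_mul, hy]; exact y.2⟩
  set d : ℝ := (Fintype.card (L →+* ℂ) : ℝ) with hd
  have hd1 : 1 ≤ d := by
    rw [hd]; exact_mod_cast Fintype.card_pos (α := L →+* ℂ)
  set C₀ : ℝ := ∑ σ : L →+* ℂ,
      (|Real.log ‖σ a‖| + |Real.log ‖σ b‖| + |Real.log (1 + ‖σ a‖)|) with hC₀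
  have hC₀' : ∀ σ : L →+* ℂ, |Real.log ‖σ a‖| + |Real.log ‖σ b‖| + |Real.log (1 + ‖σ a‖)| ≤ C₀ :=
    fun σ => Finset.single_le_sum (f := fun σ : L →+* ℂ => |Real.log ‖σ a‖| + |Real.log ‖σ b‖| +
      |Real.log (1 + ‖σ a‖)|) (fun _ _ => by positivity) (Finset.mem_univ σ)
  have hC₀0 : 0 ≤ C₀ := Finset.sum_nonneg fun _ _ => by positivity
  -- the constant collecting all contributions proportional to `K + 1`
  set C₁ : ℝ := 23 * (C₀ + 2) + Real.log (25 * N) with hC₁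
  have hlN : 0 ≤ Real.log (25 * N) := Real.log_nonneg (by
    have : (1 : ℝ) ≤ N := by exact_mod_cast hN0
    linarith)
  have hC₁0 : 0 < C₁ := by positivity
  refine ⟨28 * d * (C₁ + 1), by positivity, ?_⟩
  intro X Y X' Y' h1 h2 hbr hang hX hXX'
  set h := height X with hh
  set h' := height X' with hh'
  have hC₁d : C₁ ≤ d * (C₁ + 1) := by nlinarith
  have hpos : 0 < h := lt_of_lt_of_le (by positivity) hX
  have hh1 : h ≤ h' := by
    refine le_trans ?_ hXX'
    have : 1 ≤ 28 * d * (C₁ + 1) := by nlinarith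
    nlinarith
  have hpos' : 0 < h' := hpos.trans_le hh1
  set ρ := h' / h with hρ
  have hρh : ρ * h = h' := div_mul_cancel₀ _ hpos.ne'
  have hρ1 : 1 ≤ ρ := (one_le_div hpos).mpr hh1
  set t : L := -(a * (X : L) ^ 5) with ht
  have hX0 : (X : L) ≠ 0 := by simp
  have hY0 : (Y : L) ≠ 0 := by simp
  have hX0' : (X' : L) ≠ 0 := by simp
  have hY0' : (Y' : L) ≠ 0 := by simp
  have ht0 : t ≠ 0 := by simp [ht, ha]
  obtain ⟨K, hK1, hK2, hΛ⟩ : ∃ K : ℕ, ρ - 2 ≤ 2 * K ∧ 2 * (K : ℝ) ≤ ρ + 2 ∧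
      Pade.linForm (1 / (5 : ℕ)) K t (Y : L) (Y' : L) ≠ 0 := by
    have hfl := Nat.floor_le (show 0 ≤ ρ / 2 by positivity)
    have hfl2 := Nat.lt_floor_add_one (ρ / 2)
    rcases Pade.linForm_ne_zero (ν := 1 / (5 : ℕ)) (fun z hz => by
      have : (1 : ℚ) = 5 * z := by rw [← hz]; norm_num
      have : (1 : ℤ) = 5 * z := by exact_mod_cast this
      omega) ⌊ρ / 2⌋₊ ht0 hY0 (Y' := (Y' : L)) with hk | hk
    · exact ⟨_, by linarith, by linarith, hk⟩
    · exact ⟨_, by push_cast; linarith, by push_cast; linarith, hk⟩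
  set Λ := Pade.linForm (1 / (5 : ℕ)) K t (Y : L) (Y' : L) with hΛdef
  have hinteg : IsIntegral ℤ ((((5 : ℕ) : L) ^ 2 * N) ^ K * Λ) := by
    refine Pade.linForm_isIntegral (by norm_num) K ?_ Y.1.2 Y'.1.2
    rw [ht, mul_neg, ← mul_assoc]
    exact (hN.mul ((X.1.2 : IsIntegral ℤ (X : L)).pow 5)).neg
  have hsum := sum_log_norm_nonneg hinteg (by
    refine mul_ne_zero (pow_ne_zero _ ?_) hΛ
    have : (N : L) ≠ 0 := by exact_mod_cast hN0.ne'
    have h5 : ((5 : ℕ) : L) ≠ 0 := by exact_mod_cast (by norm_num : (5 : ℕ) ≠ 0)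
    exact mul_ne_zero (pow_ne_zero _ h5) this)
  have hK0 : (0 : ℝ) ≤ K := by positivity
  -- the bound at each place
  have hplace : ∀ σ : L →+* ℂ, Real.log ‖σ ((((5 : ℕ) : L) ^ 2 * N) ^ K * Λ)‖ ≤
      C₁ * (K + 1) + (7 / 2 * (ρ * max 0 (Real.log ‖σ X‖)) - 5 * (ρ * max 0 (-Real.log ‖σ X‖))) +
        6 * h + 10 * (h' / (20 * d)) := by
    intro σ
    have hσC := hC₀' σ
    have q1 := neg_abs_le (Real.log ‖σ a‖)
    have q2 := neg_abs_le (Real.log ‖σ b‖)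
    have q3 := le_abs_self (Real.log ‖σ a‖)
    have q4 := le_abs_self (Real.log ‖σ b‖)
    have q5 := le_abs_self (Real.log (1 + ‖σ a‖))
    have q6 := abs_nonneg (Real.log ‖σ a‖)
    have q7 := abs_nonneg (Real.log ‖σ b‖)
    have q8 := abs_nonneg (Real.log (1 + ‖σ a‖))
    have e1 : σ a * σ X ^ 5 + σ b * σ Y ^ 5 = 1 := by
      simpa using congrArg σ h1
    have e2 : σ a * σ X' ^ 5 + σ b * σ Y' ^ 5 = 1 := by
      simpa using congrArg σ h2
    have hσ : ∀ {z : L}, z ≠ 0 → σ z ≠ 0 := fun hz => (map_ne_zero σ).mpr hz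
    have hσΛ : σ Λ = Pade.linForm (1 / (5 : ℕ)) K (-(σ a * σ X ^ 5)) (σ Y) (σ Y') := by
      have haev : ∀ P : ℚ[X], σ (aeval t P) = aeval (σ t) P := fun P => by
        have := Polynomial.hom_eval₂ P (algebraMap ℚ L) σ t
        rw [aeval_def, this, aeval_def]
        congr 1
        exact Subsingleton.elim _ _
      rw [hΛdef, Pade.linForm, Pade.linForm, map_sub, map_mul, map_mul, haev, haev, ht, map_neg,
        map_mul, map_pow]
    have hσΛ0 : σ Λ ≠ 0 := hσ hΛ
    have hlogN : Real.log ‖σ ((((5 : ℕ) : L) ^ 2 * N) ^ K * Λ)‖ =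
        K * Real.log (25 * N) + Real.log ‖σ Λ‖ := by
      have hN' : (N : ℝ) ≠ 0 := by exact_mod_cast hN0.ne'
      have hc : ‖σ ((((5 : ℕ) : L) ^ 2 * N) ^ K)‖ = (25 * N : ℝ) ^ K := by
        rw [map_pow, map_mul, map_pow, map_natCast, map_natCast, norm_pow, norm_mul, norm_pow,
          Complex.norm_natCast, Complex.norm_natCast]
        norm_num
      rw [map_mul, norm_mul, Real.log_mul _ (norm_ne_zero_iff.mpr hσΛ0), hc, Real.log_pow]
      rw [hc]
      positivity
    have hangle : |Real.log ‖σ X'‖ - ρ * Real.log ‖σ X‖| ≤ h' / (20 * d) := by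
      have h3 := mul_le_mul_of_nonneg_right (hang σ) hpos'.le
      rw [← abs_of_pos hpos', ← abs_mul, abs_of_pos hpos'] at h3
      have h4 : Real.log ‖σ X'‖ - ρ * Real.log ‖σ X‖ =
          (Real.log ‖σ X'‖ / h' - Real.log ‖σ X‖ / h) * h' := by
        rw [hρ]; field_simp
      rw [h4]
      refine h3.trans_eq ?_
      ring
    have he0 : 0 ≤ h' / (20 * d) := by positivity
    have hlog1 : ∀ z : ℂ, z ≠ 0 → Real.log (max 1 ‖z‖) = max 0 (Real.log ‖z‖) := by
      intro z hz
      have hz' : 0 < ‖z‖ := norm_pos_iff.mpr hz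
      rcases le_total 1 ‖z‖ with h | h
      · rw [max_eq_right h, max_eq_right (Real.log_nonneg h)]
      · rw [max_eq_left h, Real.log_one, max_eq_left (Real.log_nonpos hz'.le h)]
    have hnt : ∀ z : ℂ, z ≠ 0 → Real.log ‖-(σ a * z ^ 5)‖ = Real.log ‖σ a‖ + 5 * Real.log ‖z‖ := by
      intro z hz
      rw [norm_neg, norm_mul, norm_pow, Real.log_mul (by simpa using ha) (by simpa using hz),
        Real.log_pow]
      norm_num
    have l2 : Real.log (1 / 2) ≤ 0 := Real.log_nonpos (by norm_num) (by norm_num)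
    have l2' : -1 ≤ Real.log (1 / 2) := by
      rw [one_div, Real.log_inv]
      have := Real.log_le_sub_one_of_pos (show (0 : ℝ) < 2 by norm_num)
      linarith
    have hfin : Real.log ‖σ Λ‖ ≤ 3 * (C₀ + 2) * (K + 1) + (20 * (C₀ + 1) * (K + 1) +
        (7 / 2 * (ρ * max 0 (Real.log ‖σ X‖)) - 5 * (ρ * max 0 (-Real.log ‖σ X‖))) +
        6 * h + 10 * (h' / (20 * d))) := by
      rw [hσΛ] at hσΛ0 ⊢
      by_cases hs : ‖-(σ a * σ X ^ 5)‖ ≤ 1 / 2 ∧ ‖-(σ a * σ X' ^ 5)‖ ≤ 1 / 2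
      · obtain ⟨b1, b2, b3⟩ := branch_spec (hσ hb) (hσ hY0) e1
        obtain ⟨-, -, b3'⟩ := branch_spec (hσ hb) (hσ hY0') e2
        rw [← hbr σ] at b3'
        have hη : Real.log ‖branch (σ a) (σ X) (σ Y)‖ ≤ C₀ := by
          have := congrArg (fun z => Real.log ‖z‖) b2
          simp only [norm_pow, Real.log_pow, one_div, norm_inv, Real.log_inv] at this
          push_cast at this
          linarith
        refine (Pade.log_norm_linForm_le_of_small (n := 5) (by norm_num) (by norm_num) hC₀0 (hσ ha)
          (hσ hX0) (hσ hX0') b1 rfl rfl (by linarith) hη hs.1 hs.2 b3 b3' hσΛ0).trans ?_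
        refine add_le_add le_rfl ?_
        have hs1 := Real.log_le_log (norm_pos_iff.mpr (neg_ne_zero.mpr (mul_ne_zero (hσ ha)
          (pow_ne_zero 5 (hσ hX0))))) hs.1
        have hs2 := Real.log_le_log (norm_pos_iff.mpr (neg_ne_zero.mpr (mul_ne_zero (hσ ha)
          (pow_ne_zero 5 (hσ hX0'))))) hs.2
        rw [hnt _ (hσ hX0)] at hs1
        rw [hnt _ (hσ hX0')] at hs2
        exact weight_le_of_small hK0 (by linarith) he0 hpos.le (by linarith) hK1
          (neg_height_le_log_norm X σ) hangle (by linarith) (by linarith)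
      · refine (Pade.log_norm_linForm_le (n := 5) (by norm_num) (by norm_num) (by norm_num) hC₀0
          (hσ ha)
          (hσ hb) (hσ hY0) (hσ hY0') rfl (by linarith) (by linarith) e1 e2 hσΛ0).trans ?_
        refine add_le_add le_rfl ?_
        rw [hlog1 _ (hσ hX0), hlog1 _ (hσ hX0')]
        refine weight_le hK0 (by linarith) he0 hpos.le hρ1 hK1 hK2
          (log_norm_le_height X σ) hangle ?_
        rw [not_and_or, not_le, not_le] at hs
        refine hs.imp (fun hs => ?_) (fun hs => ?_)
        · have hs1 := Real.log_le_log (by norm_num) hs.le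
          rw [hnt _ (hσ hX0)] at hs1
          linarith
        · have hs1 := Real.log_le_log (by norm_num) hs.le
          rw [hnt _ (hσ hX0')] at hs1
          linarith
    rw [hlogN, hC₁]
    nlinarith
  have htot := hsum.trans (Finset.sum_le_sum fun σ _ => hplace σ)
  simp only [Finset.sum_add_distrib, Finset.sum_sub_distrib, ← Finset.mul_sum, Finset.sum_const,
    Finset.card_univ, nsmul_eq_mul] at htot
  rw [← height_eq_sum_neg X, ← height, ← hh, hρh, ← hd] at htot
  have hd0 : d * (h' / (20 * d)) = h' / 20 := by field_simp
  rw [hd0] at htot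
  refine absurd htot (not_le.mpr ?_)
  have := totals_neg hd1 hC₁0 hpos hρ1 hX (by linarith : (K + 1 : ℝ) ≤ ρ / 2 + 2)
    (by rw [hρh]; exact hXX')
  rw [hρh] at this
  linarith

end UnitEquation

namespace UnitEquation

variable {L : Type*} [Field L] [NumberField L]

theorem finite_pow_eq (n : ℕ) (hn : 0 < n) {F : Type*} [Field F] (z : F) :
    {y : F | y ^ n = z}.Finite := by
  classical
  refine ((nthRoots n z).toFinset.finite_toSet).subset fun y hy => ?_
  simpa [mem_nthRoots hn] using hy

theorem finite_fifth_power_solutions {a b : L} (ha : a ≠ 0) (hb : b ≠ 0) :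
    {P : (𝓞 L)ˣ × (𝓞 L)ˣ | a * (P.1 : L) ^ 5 + b * (P.2 : L) ^ 5 = 1}.Finite := by
  classical
  obtain ⟨C, hC, hgap⟩ := gap_principle ha hb
  set d : ℝ := (Fintype.card (L →+* ℂ) : ℝ) with hd
  have hd1 : 1 ≤ d := by
    rw [hd]; exact_mod_cast Fintype.card_pos (α := L →+* ℂ)
  let f : (𝓞 L)ˣ × (𝓞 L)ˣ → (L →+* ℂ) → ℤ × ℂ := fun P σ =>
    (⌊20 * d * (Real.log ‖σ P.1‖ / height P.1)⌋, branch (σ a) (σ P.1) (σ P.2))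
  have hY : ∀ X : (𝓞 L)ˣ, {Y : (𝓞 L)ˣ | a * (X : L) ^ 5 + b * (Y : L) ^ 5 = 1}.Finite := by
    intro X
    refine Set.Finite.of_finite_image (f := fun u : (𝓞 L)ˣ => (u : L))
      ((finite_pow_eq 5 (by norm_num) ((1 - a * (X : L) ^ 5) / b)).subset ?_) ?_
    · rintro _ ⟨u, hu, rfl⟩
      have : a * (X : L) ^ 5 + b * (u : L) ^ 5 = 1 := hu
      change (u : L) ^ 5 = _
      rw [eq_div_iff hb]
      linear_combination this
    · intro u _ v _ h
      exact Units.ext (RingOfIntegers.ext h)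
  refine Set.Finite.of_finite_fibers f ?_ ?_
  · refine (Set.Finite.pi' (t := fun σ : L →+* ℂ => (Set.Icc ⌊-(20 * d)⌋ ⌊20 * d⌋) ×ˢ
      {z : ℂ | z ^ 5 = 1 / σ b}) fun σ => (Set.finite_Icc _ _).prod
        (finite_pow_eq 5 (by norm_num) _)).subset ?_
    rintro _ ⟨⟨X, Y⟩, hP, rfl⟩ σ
    have h1 := height_nonneg X
    have h2 : |Real.log ‖σ X‖ / height X| ≤ 1 := by
      rw [abs_div, abs_of_nonneg h1]
      exact div_le_one_of_le₀ (abs_le.mpr ⟨neg_height_le_log_norm X σ, log_norm_le_height X σ⟩) h1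
    obtain ⟨h3, h4⟩ := abs_le.mp h2
    refine ⟨⟨Int.floor_le_floor ?_, Int.floor_le_floor ?_⟩, (branch_spec ((map_ne_zero σ).mpr hb) ?_
      (by simpa using congrArg σ hP)).2.1⟩
    · nlinarith
    · nlinarith
    · simp
  · intro g _
    obtain ⟨B, hB⟩ : ∃ B, ∀ P ∈ {P : (𝓞 L)ˣ × (𝓞 L)ˣ | a * (P.1 : L) ^ 5 + b * (P.2 : L) ^ 5 =
        1} ∩ f ⁻¹' {g}, height P.1 ≤ B := by
      by_contra! hcon
      obtain ⟨⟨X, Y⟩, ⟨h1, h1'⟩, hX⟩ := hcon C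
      obtain ⟨⟨X', Y'⟩, ⟨h2, h2'⟩, hX'⟩ := hcon (C * height X)
      have hff : f (X, Y) = f (X', Y') := h1'.trans h2'.symm
      refine hgap X Y X' Y' h1 h2 (fun σ => congrArg Prod.snd (congrFun hff σ)) (fun σ => ?_)
        hX.le hX'.le
      have h3 := Int.abs_sub_lt_one_of_floor_eq_floor (congrArg Prod.fst (congrFun hff σ)).symm
      rw [← mul_sub, abs_mul, abs_of_pos (by positivity : 0 < 20 * d)] at h3
      rw [le_div_iff₀ (by positivity)]
      linarith
    refine Set.Finite.of_finite_fibers Prod.fst ((finite_height_le B).subset ?_) ?_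
    · rintro _ ⟨P, hP, rfl⟩
      exact hB P hP
    · rintro X _
      refine ((hY X).image (fun Y => (X, Y))).subset ?_
      rintro ⟨X', Y'⟩ ⟨⟨h, -⟩, rfl⟩
      exact ⟨Y', h, rfl⟩

theorem finite_units_quotient_pow (n : ℕ) (hn : 0 < n) :
    Finite ((𝓞 L)ˣ ⧸ (powMonoidHom n : (𝓞 L)ˣ →* (𝓞 L)ˣ).range) := by
  have : Group.FG (𝓞 L)ˣ := Group.fg_iff_monoid_fg.mpr inferInstance
  exact CommGroup.finite_of_fg_isMulTorsion _
      (CommGroup.isMulTorsion_quotient_range_powMonoidHom _ (Nat.ne_of_gt hn))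

/-- The unit equation `a * X + b * Y = 1` has finitely many solutions. -/
theorem finite_solutions {a b : L} (ha : a ≠ 0) (hb : b ≠ 0) :
    {P : (𝓞 L)ˣ × (𝓞 L)ˣ | a * (P.1 : L) + b * (P.2 : L) = 1}.Finite := by
  have hfin := finite_units_quotient_pow (L := L) 5 (by norm_num)
  let R := (powMonoidHom 5 : (𝓞 L)ˣ →* (𝓞 L)ˣ).range
  let f : (𝓞 L)ˣ × (𝓞 L)ˣ → ((𝓞 L)ˣ ⧸ R) × ((𝓞 L)ˣ ⧸ R) := fun P => (P.1, P.2)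
  refine Set.Finite.of_finite_fibers f (Set.toFinite _) ?_
  rintro _ ⟨⟨X, Y⟩, hP, rfl⟩
  refine ((finite_fifth_power_solutions (a := a * X) (b := b * Y) (by simp [ha])
    (by simp [hb])).image (fun P => (X * P.1 ^ 5, Y * P.2 ^ 5))).subset ?_
  rintro ⟨X', Y'⟩ ⟨h1, h2⟩
  have h3 := (QuotientGroup.eq (s := R)).mp (congrArg Prod.fst h2).symm
  have h4 := (QuotientGroup.eq (s := R)).mp (congrArg Prod.snd h2).symm
  obtain ⟨u, hu⟩ := h3
  obtain ⟨v, hv⟩ := h4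
  have hu' : X' = X * u ^ 5 := by
    change u ^ 5 = X⁻¹ * X' at hu
    rw [hu]; group
  have hv' : Y' = Y * v ^ 5 := by
    change v ^ 5 = Y⁻¹ * Y' at hv
    rw [hv]; group
  refine ⟨(u, v), ?_, by rw [hu', hv']⟩
  have h5 : a * (X' : L) + b * (Y' : L) = 1 := h1
  rw [hu', hv'] at h5
  push_cast at h5
  simpa [mul_assoc] using h5

end UnitEquation

namespace UnitEquation

variable {L : Type*} [Field L] [NumberField L]

/-- Ratios of divisors of a fixed `δ` occurring in a three-term relation form a finite set. -/
theorem finite_ratios_of_dvd {δ : 𝓞 L} (hδ : δ ≠ 0) :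
    {κ : L | ∃ u v w : 𝓞 L, u ∣ δ ∧ v ∣ δ ∧ w ∣ δ ∧ u + w = v ∧ κ = u / v}.Finite := by
  classical
  have hT : {I : Ideal (𝓞 L) | I ∣ Ideal.span {δ}}.Finite := by
    have := UniqueFactorizationMonoid.fintypeSubtypeDvd (Ideal.span {δ}) (by simpa using hδ)
    exact Set.finite_coe_iff.mp (Finite.of_fintype {I : Ideal (𝓞 L) // I ∣ Ideal.span {δ}})
  have hT3 := hT.prod (hT.prod hT)
  refine (hT3.biUnion (t := fun t => {κ : L | ∃ u v w : 𝓞 L, u ∣ δ ∧ v ∣ δ ∧ w ∣ δ ∧ u + w = v ∧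
    κ = u / v ∧ (Ideal.span {u}, Ideal.span {v}, Ideal.span {w}) = t}) fun t _ => ?_).subset ?_
  · rcases Set.eq_empty_or_nonempty {κ : L | ∃ u v w : 𝓞 L, u ∣ δ ∧ v ∣ δ ∧ w ∣ δ ∧ u + w = v ∧
      κ = u / v ∧ (Ideal.span {u}, Ideal.span {v}, Ideal.span {w}) = t} with h | ⟨κ₀, u₀, v₀, w₀,
          hu₀, hv₀, hw₀, -, -, rfl⟩
    · rw [h]; exact Set.finite_empty
    have hu0 : (u₀ : L) ≠ 0 := by
      simpa using ne_zero_of_dvd_ne_zero hδ hu₀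
    have hv0 : (v₀ : L) ≠ 0 := by
      simpa using ne_zero_of_dvd_ne_zero hδ hv₀
    have hw0 : (w₀ : L) ≠ 0 := by
      simpa using ne_zero_of_dvd_ne_zero hδ hw₀
    refine ((finite_solutions (div_ne_zero hu0 hv0) (div_ne_zero hw0 hv0)).image
      (fun P => (u₀ : L) / v₀ * P.1)).subset ?_
    rintro _ ⟨u, v, w, hu, hv, hw, h, rfl, h2⟩
    simp only [Prod.mk.injEq, Ideal.span_singleton_eq_span_singleton] at h2
    obtain ⟨⟨X, hX⟩, ⟨Y, hY⟩, ⟨Z, hZ⟩⟩ := h2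
    have hX' : (u : L) * X = u₀ := by rw [← hX]; simp
    have hY' : (v : L) * Y = v₀ := by rw [← hY]; simp
    have hZ' : (w : L) * Z = w₀ := by rw [← hZ]; simp
    have hX0 : (X : L) ≠ 0 := by simp
    have hY0 : (Y : L) ≠ 0 := by simp
    have hZ0 : (Z : L) ≠ 0 := by simp
    have hv0' : (v : L) ≠ 0 := by
      simpa using ne_zero_of_dvd_ne_zero hδ hv
    have h' : (u : L) + w = v := by rw [← h]; simp
    refine ⟨(X⁻¹ * Y, Z⁻¹ * Y), ?_, ?_⟩
    · simp only [Set.mem_ofPred_eq, Units.val_mul, map_mul, ← hX', ← hY', ← hZ', map_units_inv]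
      field_simp
      exact h'
    · simp only [Units.val_mul, map_mul, ← hX', ← hY', map_units_inv]
      field_simp
  · rintro κ ⟨u, v, w, hu, hv, hw, h⟩
    have hd : ∀ {z : 𝓞 L}, z ∣ δ → Ideal.span {z} ∣ Ideal.span {δ} := fun hz =>
      Ideal.dvd_iff_le.mpr ((Ideal.span_singleton_le_span_singleton).mpr hz)
    refine Set.mem_biUnion (x := (Ideal.span {u}, Ideal.span {v}, Ideal.span {w}))
      (Set.mk_mem_prod (hd hu) (Set.mk_mem_prod (hd hv) (hd hw))) ?_
    exact ⟨u, v, w, hu, hv, hw, h.1, h.2, rfl⟩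


open UniqueFactorizationMonoid in
/-- Modulo `p`-th powers of ideals, only the primes dividing `B` matter. -/
theorem exists_eq_prod_mul_pow {B : 𝓞 L} (hB : B ≠ 0) {p : ℕ} (hp : 0 < p)
    [DecidableEq (Ideal (𝓞 L))]
    {x : 𝓞 L} (hx : x ≠ 0)
    (h : ∀ P : Ideal (𝓞 L), P.IsPrime → B ∉ P →
      p ∣ (normalizedFactors (Ideal.span {x})).count P) :
    ∃ (k : (normalizedFactors (Ideal.span {B})).toFinset → Fin p) (I : Ideal (𝓞 L)), I ≠ ⊥ ∧
      Ideal.span {x} = (∏ P : (normalizedFactors (Ideal.span {B})).toFinset, (P : Ideal (𝓞 L)) ^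
          (k P : ℕ)) * I ^ p := by
  set T := (normalizedFactors (Ideal.span {B})).toFinset with hT
  set s := normalizedFactors (Ideal.span {x}) with hs
  have hx' : Ideal.span {x} ≠ ⊥ := by simpa using hx
  have hB' : Ideal.span {B} ≠ ⊥ := by simpa using hB
  have hprod : Ideal.span {x} = ∏ P ∈ s.toFinset, P ^ s.count P := by
    rw [← Finset.prod_multiset_count]
    exact (Ideal.prod_normalizedFactors_eq_self hx').symm
  refine ⟨fun P => ⟨s.count P.1 % p, Nat.mod_lt _ hp⟩, ∏ P ∈ s.toFinset, P ^ (s.count P / p), ?_,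
      ?_⟩
  · rw [Ne, ← Ideal.zero_eq_bot, Finset.prod_eq_zero_iff]
    rintro ⟨P, hP, h0⟩
    rw [Multiset.mem_toFinset] at hP
    exact (prime_of_normalized_factor P hP).ne_zero (eq_zero_of_pow_eq_zero h0)
  · have h1 : ∏ P : T, (P : Ideal (𝓞 L)) ^ (s.count P.1 % p) = ∏ P ∈ s.toFinset, P ^
      (s.count P % p) := by
      rw [Finset.prod_coe_sort T (fun P => P ^ (s.count P % p))]
      trans ∏ P ∈ T ∪ s.toFinset, P ^ (s.count P % p)
      · refine Finset.prod_subset Finset.subset_union_left fun P hP hPT => ?_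
        have hPs : P ∈ s := by
          rcases Finset.mem_union.mp hP with h | h
          · exact absurd h hPT
          · exact Multiset.mem_toFinset.mp h
        have hPp := prime_of_normalized_factor P hPs
        rw [Nat.mod_eq_zero_of_dvd (h P (Ideal.isPrime_of_prime hPp) fun hBP => hPT ?_), pow_zero]
        rw [hT, Multiset.mem_toFinset, Ideal.mem_normalizedFactors_iff hB']
        exact ⟨Ideal.isPrime_of_prime hPp, (Ideal.span_singleton_le_iff_mem _).mpr hBP⟩
      · refine (Finset.prod_subset Finset.subset_union_right fun P _ hPs => ?_).symm
        rw [Multiset.mem_toFinset] at hPs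
        rw [Multiset.count_eq_zero_of_notMem hPs]
        simp
    simp only
    rw [h1, ← Finset.prod_pow, ← Finset.prod_mul_distrib, hprod]
    refine Finset.prod_congr rfl fun P _ => ?_
    rw [← pow_mul, ← pow_add, mul_comm _ p, Nat.mod_add_div]

open UniqueFactorizationMonoid in
/-- Integers whose valuations outside the primes dividing `B` are divisible by `p` lie in finitely
many classes modulo `p`-th powers. -/
theorem exists_finite_representatives {B : 𝓞 L} (hB : B ≠ 0) {p : ℕ} (hp : 0 < p)
    [DecidableEq (Ideal (𝓞 L))] :
    ∃ 𝒟 : Set L, 𝒟.Finite ∧ 0 ∉ 𝒟 ∧ ∀ x : 𝓞 L, x ≠ 0 →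
      (∀ P : Ideal (𝓞 L), P.IsPrime → B ∉ P →
        p ∣ (normalizedFactors (Ideal.span {x})).count P) →
      ∃ d ∈ 𝒟, ∃ y : L, (x : L) = d * y ^ p := by
  set S : Set (𝓞 L) := {x | x ≠ 0 ∧ ∀ P : Ideal (𝓞 L), P.IsPrime → B ∉ P →
        p ∣ (normalizedFactors (Ideal.span {x})).count P} with hS
  have hdec : ∀ x : S, ∃ (k : (normalizedFactors (Ideal.span {B})).toFinset → Fin p)
      (I : (nonZeroDivisors (Ideal (𝓞 L)))),
      Ideal.span {x.1} = (∏ P : (normalizedFactors (Ideal.span {B})).toFinset, (P : Ideal (𝓞 L)) ^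
          (k P : ℕ)) * (I : Ideal (𝓞 L)) ^ p := by
    intro x
    obtain ⟨k, I, hI, h⟩ := exists_eq_prod_mul_pow hB hp x.2.1 x.2.2
    exact ⟨k, ⟨I, mem_nonZeroDivisors_of_ne_zero hI⟩, h⟩
  choose k I hkI using hdec
  let F : S → ((normalizedFactors (Ideal.span {B})).toFinset → Fin p) × ClassGroup (𝓞 L) :=
    fun x => (k x, ClassGroup.mk0 (I x))
  obtain ⟨S₀, -, hS₀⟩ := Set.exists_subset_bijOn Set.univ F
  have hS₀fin : S₀.Finite := Set.Finite.of_finite_image (Set.toFinite _) hS₀.injOn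
  have hU := finite_units_quotient_pow (L := L) p hp
  let R := (powMonoidHom p : (𝓞 L)ˣ →* (𝓞 L)ˣ).range
  refine ⟨Set.image2 (fun (x : S) (u : (𝓞 L)ˣ ⧸ R) => (x.1 : L) * (u.out : L)) S₀ Set.univ,
    hS₀fin.image2 _ (Set.toFinite _), ?_, ?_⟩
  · rintro ⟨x, -, u, -, h⟩
    have : (x.1 : L) ≠ 0 := by simpa using x.2.1
    simp [this] at h
  · intro x hx hxP
    obtain ⟨x₀, hx₀, hF⟩ := hS₀.surjOn ⟨⟨x, hx, hxP⟩, Set.mem_univ _, rfl⟩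
    have hk : k x₀ = k ⟨x, hx, hxP⟩ := congrArg Prod.fst hF
    obtain ⟨a, b, ha, hb, hab⟩ := ClassGroup.mk0_eq_mk0_iff.mp (congrArg Prod.snd hF)
    have h1 : Ideal.span {x₀.1 * a ^ p} = Ideal.span {x * b ^ p} := by
      rw [← Ideal.span_singleton_mul_span_singleton, ← Ideal.span_singleton_mul_span_singleton,
        ← Ideal.span_singleton_pow, ← Ideal.span_singleton_pow, hkI x₀, hkI ⟨x, hx, hxP⟩, hk,
        mul_assoc, mul_assoc, ← mul_pow, ← mul_pow, mul_comm _ (Ideal.span {a}), hab, mul_comm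
            (Ideal.span {b})]
    obtain ⟨u, hu⟩ := Ideal.span_singleton_eq_span_singleton.mp h1
    obtain ⟨v, hv⟩ := (QuotientGroup.eq (s := R)).mp (Quotient.out_eq' (u : (𝓞 L)ˣ ⧸ R))
    change v ^ p = (Quotient.out (u : (𝓞 L)ˣ ⧸ R))⁻¹ * u at hv
    have hu' : u = Quotient.out (u : (𝓞 L)ˣ ⧸ R) * v ^ p := by rw [hv]; group
    refine ⟨_, ⟨x₀, hx₀, (u : (𝓞 L)ˣ ⧸ R), Set.mem_univ _, rfl⟩, (v : L) * a / b, ?_⟩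
    have hb0 : (b : L) ≠ 0 := by simpa using hb
    have h2 : (x₀.1 : L) * a ^ p * u = x * b ^ p := by
      exact_mod_cast congrArg (algebraMap (𝓞 L) L) hu
    rw [hu'] at h2
    simp only [Units.val_mul, map_mul, Units.val_pow_eq_pow_val, map_pow] at h2
    rw [div_pow, mul_pow, ← mul_div_assoc, eq_div_iff (pow_ne_zero _ hb0), ← h2]
    ring

end UnitEquation

namespace UnitEquation

variable {L : Type*} [Field L] [NumberField L]

theorem exists_numberField_forall_root.{u} {L : Type u} [Field L] [NumberField L] (p : ℕ)
    (hp : 0 < p) {𝒟 : Set L} (h𝒟 : 𝒟.Finite) :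
    ∃ (M : Type u) (_ : Field M) (_ : NumberField M) (_ : Algebra L M),
      ∀ d ∈ 𝒟, ∃ e : M, e ^ p = algebraMap L M d := by
  let g : L[X] := ∏ d ∈ h𝒟.toFinset, (X ^ p - C d)
  have hg : g ≠ 0 := Finset.prod_ne_zero_iff.mpr fun d _ => X_pow_sub_C_ne_zero hp d
  refine ⟨g.SplittingField, inferInstance, NumberField.of_module_finite L _, inferInstance,
    fun d hd => ?_⟩
  have hdvd : X ^ p - C d ∣ g := Finset.dvd_prod_of_mem _ (h𝒟.mem_toFinset.mpr hd)
  have hs := ((SplittingField.splits g).of_dvd (Polynomial.map_ne_zero hg)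
      (Polynomial.map_dvd (algebraMap L g.SplittingField) hdvd))
  obtain ⟨e, he⟩ := hs.exists_eval_eq_zero (by
    rw [degree_map, degree_X_pow_sub_C hp]
    exact_mod_cast hp.ne')
  refine ⟨e, ?_⟩
  simpa [sub_eq_zero] using he

theorem finite_of_exists_roots {M : Type*} [Field M] [NumberField M] {p : ℕ} (hp : 0 < p) {ω : M}
    (hω : ω ^ p = 1) (hω1 : ω ≠ 1) {β₁ β₂ β₃ : 𝓞 M} (h12 : β₁ ≠ β₂) (h13 : β₁ ≠ β₃)
        (h23 : β₂ ≠ β₃) :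
    {x : 𝓞 M | ∃ z₁ z₂ z₃ : M, z₁ ^ p = x - β₁ ∧ z₂ ^ p = x - β₂ ∧ z₃ ^ p = x - β₃}.Finite := by
  set δ : 𝓞 M := (β₁ - β₂) * (β₁ - β₃) * (β₂ - β₃) with hδdef
  have hδ : δ ≠ 0 := mul_ne_zero (mul_ne_zero (sub_ne_zero.mpr h12) (sub_ne_zero.mpr h13))
    (sub_ne_zero.mpr h23)
  have hF := finite_ratios_of_dvd hδ
  set F := {κ : M | ∃ u v w : 𝓞 M, u ∣ δ ∧ v ∣ δ ∧ w ∣ δ ∧ u + w = v ∧ κ = u / v} with hFdef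
  refine Set.Finite.of_finite_image (f := fun x : 𝓞 M => (x : M)) ((hF.image2 (fun κ κ' =>
    (β₂ : M) + ((κ - κ') / (ω - 1)) ^ p *
      ((β₂ - β₁) / ((κ + (κ - κ') / (ω - 1)) ^ p - ((κ - κ') / (ω - 1)) ^ p))) hF).subset ?_)
    (fun u _ v _ h => RingOfIntegers.ext h)
  rintro _ ⟨x, ⟨z₁, z₂, z₃, h1, h2, h3⟩, rfl⟩
  have hinteg : ∀ z : M, IsIntegral ℤ (z ^ p) → ∃ y : 𝓞 M, (y : M) = z := fun z hz =>
    ⟨⟨z, IsIntegral.of_pow hp hz⟩, rfl⟩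
  obtain ⟨o, rfl⟩ := hinteg ω (by rw [hω]; exact isIntegral_one)
  obtain ⟨y₁, rfl⟩ := hinteg z₁ (by rw [h1]; exact (x - β₁).2)
  obtain ⟨y₂, rfl⟩ := hinteg z₂ (by rw [h2]; exact (x - β₂).2)
  obtain ⟨y₃, rfl⟩ := hinteg z₃ (by rw [h3]; exact (x - β₃).2)
  have ho : o ^ p = 1 := RingOfIntegers.ext (by simpa using hω)
  have g1 : y₁ ^ p = x - β₁ := RingOfIntegers.ext (by simpa using h1)
  have g2 : y₂ ^ p = x - β₂ := RingOfIntegers.ext (by simpa using h2)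
  have g3 : y₃ ^ p = x - β₃ := RingOfIntegers.ext (by simpa using h3)
  have g2' : (o * y₂) ^ p = x - β₂ := by rw [mul_pow, ho, one_mul, g2]
  have d12 : β₁ - β₂ ∣ δ := ⟨(β₁ - β₃) * (β₂ - β₃), by rw [hδdef]; ring⟩
  have d13 : β₁ - β₃ ∣ δ := ⟨(β₁ - β₂) * (β₂ - β₃), by rw [hδdef]; ring⟩
  have d23 : β₂ - β₃ ∣ δ := ⟨(β₁ - β₂) * (β₁ - β₃), by rw [hδdef]; ring⟩
  have hdvd : ∀ {y y' b b' : 𝓞 M}, y ^ p = x - b → y' ^ p = x - b' → b - b' ∣ δ → y - y' ∣ δ := by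
    intro y y' b b' hy hy' hb
    refine (sub_dvd_pow_sub_pow y y' p).trans ?_
    rw [hy, hy', show x - b - (x - b') = -(b - b') by ring]
    exact (neg_dvd).mpr hb
  have hκ : ((y₁ - y₂ : 𝓞 M) : M) / ((y₁ - y₃ : 𝓞 M) : M) ∈ F :=
    ⟨y₁ - y₂, y₁ - y₃, y₂ - y₃, hdvd g1 g2 d12, hdvd g1 g3 d13, hdvd g2 g3 d23, by ring, rfl⟩
  have hκ' : ((y₁ - o * y₂ : 𝓞 M) : M) / ((y₁ - y₃ : 𝓞 M) : M) ∈ F :=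
    ⟨y₁ - o * y₂, y₁ - y₃, o * y₂ - y₃, hdvd g1 g2' d12, hdvd g1 g3 d13, hdvd g2' g3 d23, by ring,
        rfl⟩
  refine ⟨_, hκ, _, hκ', ?_⟩
  have ht : (y₁ : M) - y₃ ≠ 0 := by
    have := ne_zero_of_dvd_ne_zero hδ (hdvd g1 g3 d13)
    rw [← map_sub]
    exact (map_ne_zero_iff _ RingOfIntegers.coe_injective).mpr this
  have ho1 : (o : M) - 1 ≠ 0 := sub_ne_zero.mpr hω1
  have e1 : (((y₁ - y₂ : 𝓞 M) : M) / ((y₁ - y₃ : 𝓞 M) : M) -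
      ((y₁ - o * y₂ : 𝓞 M) : M) / ((y₁ - y₃ : 𝓞 M) : M)) / ((o : M) - 1) = y₂ / (y₁ - y₃) := by
    push_cast [map_sub, map_mul]
    field_simp
    ring
  have e2 : ((y₁ - y₂ : 𝓞 M) : M) / ((y₁ - y₃ : 𝓞 M) : M) + (y₂ : M) / (y₁ - y₃) = y₁ /
      (y₁ - y₃) := by
    push_cast [map_sub]
    field_simp
    ring
  have hβ : (β₂ : M) - β₁ ≠ 0 := by
    rw [← map_sub]
    simpa [sub_eq_zero] using h12.symm
  have e3 : (y₁ : M) ^ p - (y₂ : M) ^ p = β₂ - β₁ := by rw [h1, h2]; ring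
  simp only
  rw [e1, e2, div_pow, div_pow, ← sub_div, e3, h2]
  field_simp
  ring

open UniqueFactorizationMonoid in
/-- Finiteness of the integral points `x` such that three translates `x - βᵢ` have valuations
divisible by `p` away from `B`. -/
theorem finite_of_dvd_count {B : 𝓞 L} (hB : B ≠ 0) {p : ℕ} (hp : 1 < p) {ω : L}
    (hω : IsPrimitiveRoot ω p) [DecidableEq (Ideal (𝓞 L))] {β : Fin 3 → 𝓞 L}
    (hβ : Function.Injective β) :
    {x : 𝓞 L | ∀ i, ∀ P : Ideal (𝓞 L), P.IsPrime → B ∉ P →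
      p ∣ (normalizedFactors (Ideal.span {x - β i})).count P}.Finite := by
  have hp0 : 0 < p := by omega
  obtain ⟨𝒟, h𝒟, -, hrep⟩ := exists_finite_representatives hB hp0
  obtain ⟨M, _, _, _, hM⟩ := exists_numberField_forall_root p hp0 h𝒟
  have hinj : Function.Injective (algebraMap (𝓞 L) (𝓞 M)) := RingOfIntegers.algebraMap.injective L M
  have hroot : ∀ x : 𝓞 L, (∀ P : Ideal (𝓞 L), P.IsPrime → B ∉ P →
      p ∣ (normalizedFactors (Ideal.span {x})).count P) → ∃ z : M, z ^ p = algebraMap L M x := by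
    intro x hx
    by_cases h0 : x = 0
    · exact ⟨0, by simp [h0, hp0.ne']⟩
    obtain ⟨d, hd, y, hy⟩ := hrep x h0 hx
    obtain ⟨e, he⟩ := hM d hd
    exact ⟨e * algebraMap L M y, by rw [hy, mul_pow, he, map_mul, map_pow]⟩
  refine Set.Finite.of_finite_image (f := algebraMap (𝓞 L) (𝓞 M)) ((finite_of_exists_roots hp0
    (ω := algebraMap L M ω) (by rw [← map_pow, hω.pow_eq_one, map_one]) (fun h => hω.ne_one hp
      ((algebraMap L M).injective (by rw [h, map_one])))
    (hinj.ne (hβ.ne (by decide : (0 : Fin 3) ≠ 1))) (hinj.ne (hβ.ne (by decide : (0 : Fin 3) ≠ 2)))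
    (hinj.ne (hβ.ne (by decide : (1 : Fin 3) ≠ 2)))).subset ?_) hinj.injOn
  rintro _ ⟨x, hx, rfl⟩
  have key : ∀ i, ∃ z : M, z ^ p = ((algebraMap (𝓞 L) (𝓞 M) x : 𝓞 M) : M) -
      (algebraMap (𝓞 L) (𝓞 M) (β i) : 𝓞 M) := by
    intro i
    obtain ⟨z, hz⟩ := hroot _ (hx i)
    refine ⟨z, ?_⟩
    rw [hz, ← map_sub, ← map_sub]
    rfl
  obtain ⟨z₁, h1⟩ := key 0
  obtain ⟨z₂, h2⟩ := key 1
  obtain ⟨z₃, h3⟩ := key 2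
  exact ⟨z₁, z₂, z₃, h1, h2, h3⟩

end UnitEquation

namespace KummerBound

theorem eq_top_of_forall_exists_add_smul {M : Type*} [AddCommGroup M] (I : AddSubgroup M) {p r : ℕ}
    (hM : ∀ m : M, p ^ r • m = 0) (h : ∀ g : M, ∃ i ∈ I, ∃ m, g = i + p • m) : I = ⊤ := by
  have key : ∀ k : ℕ, ∀ g : M, ∃ i ∈ I, ∃ m, g = i + p ^ k • m := by
    intro k
    induction k with
    | zero => exact fun g => ⟨0, I.zero_mem, g, by simp⟩
    | succ k ih =>
      intro g
      obtain ⟨i, hi, m, rfl⟩ := ih g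
      obtain ⟨j, hj, n, rfl⟩ := h m
      exact ⟨i + p ^ k • j, I.add_mem hi (I.nsmul_mem hj _), n, by
        rw [smul_add, pow_succ, mul_smul, add_assoc]⟩
  refine eq_top_iff.mpr fun g _ => ?_
  obtain ⟨i, hi, m, rfl⟩ := key r g
  rw [hM, add_zero]
  exact hi

/-- A proper subgroup of `(ℤ/p^r)^ι` is annihilated modulo `p` by a nonzero linear form. -/
theorem exists_annihilator {ι : Type*} [Fintype ι] {p r : ℕ} [Fact p.Prime] (hr : 0 < r)
    (I : AddSubgroup (ι → ZMod (p ^ r))) (hI : I ≠ ⊤) :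
    ∃ e : ι → ZMod p, e ≠ 0 ∧ ∀ g ∈ I, ∑ i, e i * ((g i).val : ZMod p) = 0 := by
  classical
  have hdvd : p ∣ p ^ r := dvd_pow_self p hr.ne'
  let red : (ι → ZMod (p ^ r)) →+ (ι → ZMod p) :=
    { toFun := fun g i => ZMod.castHom hdvd (ZMod p) (g i)
      map_zero' := by ext; simp
      map_add' := fun g g' => funext fun i => map_add (ZMod.castHom hdvd (ZMod p)) (g i) (g' i) }
  have hne : NeZero (p ^ r) := ⟨pow_ne_zero _ (Fact.out : p.Prime).ne_zero⟩
  have hred : ∀ g i, red g i = ((g i).val : ZMod p) := by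
    intro g i
    change ZMod.castHom hdvd (ZMod p) (g i) = _
    conv_lhs => rw [← ZMod.natCast_zmod_val (g i)]
    rw [map_natCast]
  let N : Submodule (ZMod p) (ι → ZMod p) := AddSubgroup.toZModSubmodule p (I.map red)
  have hN : N ≠ ⊤ := by
    intro hN
    refine hI (eq_top_of_forall_exists_add_smul I (p := p) (r := r) (fun m => ?_) fun g => ?_)
    · ext i
      rw [Pi.smul_apply, nsmul_eq_mul, ZMod.natCast_self, zero_mul, Pi.zero_apply]
    · have : red g ∈ N := hN ▸ Submodule.mem_top
      obtain ⟨i, hi, hig⟩ := this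
      refine ⟨i, hi, fun j => (((g j - i j).val / p : ℕ) : ZMod (p ^ r)), ?_⟩
      ext j
      have h0 : ((g - i) j).val % p = 0 := by
        have : red (g - i) j = 0 := by rw [map_sub, hig, sub_self, Pi.zero_apply]
        rw [hred, ZMod.natCast_eq_zero_iff] at this
        exact Nat.mod_eq_zero_of_dvd this
      have h1 := Nat.div_add_mod ((g - i) j).val p
      rw [h0, add_zero] at h1
      have h2 := ZMod.natCast_zmod_val ((g - i) j)
      rw [← h1] at h2
      rw [Pi.add_apply, Pi.smul_apply, nsmul_eq_mul]
      push_cast at h2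
      rw [Pi.sub_apply] at h2
      rw [h2]
      ring
  obtain ⟨f, hf, hNf⟩ := Submodule.exists_le_ker_of_lt_top N (lt_top_iff_ne_top.mpr hN)
  have hsum : ∀ g, f g = ∑ i, f (Pi.single i 1) * g i := by
    intro g
    conv_lhs => rw [← Finset.univ_sum_single g]
    rw [map_sum]
    refine Finset.sum_congr rfl fun i _ => ?_
    rw [mul_comm, ← smul_eq_mul, ← map_smul, ← Pi.single_smul, smul_eq_mul, mul_one]
  refine ⟨fun i => f (Pi.single i 1), fun h => hf ?_, fun g hg => ?_⟩
  · refine LinearMap.ext fun g => ?_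
    rw [hsum]
    simp only [fun i => congrFun h i]
    simp
  · have := hNf (show red g ∈ N from ⟨g, hg, rfl⟩)
    rw [LinearMap.mem_ker, hsum] at this
    simpa only [hred] using this

variable {E Ω : Type*} [Field E] [Field Ω] [Algebra E Ω] [IsAlgClosed Ω] [IsGalois E Ω]

theorem pow_card_le_finrank {ι : Type*} [Fintype ι] {p r : ℕ} (hp : p.Prime) (hr : 0 < r)
    {ζ : E} (hζ : IsPrimitiveRoot ζ (p ^ r)) (a : ι → E) (ha : ∀ i, a i ≠ 0) (x : ι → Ω)
    (hx : ∀ i, x i ^ (p ^ r) = algebraMap E Ω (a i))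
    (h : ∀ e : ι → ZMod p, (∃ w : E, w ^ p = ∏ i, a i ^ (e i).val) → e = 0) :
    (p ^ r) ^ Fintype.card ι ≤ Module.finrank E (IntermediateField.adjoin E (Set.range x)) := by
  classical
  have : Fact p.Prime := ⟨hp⟩
  have hne : NeZero (p ^ r) := ⟨pow_ne_zero _ hp.ne_zero⟩
  set ξ : Ω := algebraMap E Ω ζ with hξdef
  have hξ : IsPrimitiveRoot ξ (p ^ r) := hζ.map_of_injective (algebraMap E Ω).injective
  have hx0 : ∀ i, x i ≠ 0 := by
    intro i h0
    have := hx i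
    rw [h0, zero_pow hne.out] at this
    exact ha i ((map_eq_zero _).mp this.symm)
  have hpow : ∀ u v : ZMod (p ^ r), ξ ^ (u + v).val = ξ ^ u.val * ξ ^ v.val := by
    intro u v
    rw [← pow_add, ← pow_mod_orderOf, ← hξ.eq_orderOf, ZMod.val_add, Nat.mod_mod]
    conv_rhs => rw [← pow_mod_orderOf, ← hξ.eq_orderOf]
  let I : AddSubgroup (ι → ZMod (p ^ r)) :=
    { carrier := {g | ∃ σ : Ω ≃ₐ[E] Ω, ∀ i, σ (x i) = ξ ^ (g i).val * x i}
      zero_mem' := ⟨1, fun i => by simp⟩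
      add_mem' := by
        rintro g g' ⟨σ, hσ⟩ ⟨τ, hτ⟩
        refine ⟨σ * τ, fun i => ?_⟩
        rw [AlgEquiv.mul_apply, hτ, map_mul, map_pow, hξdef, AlgEquiv.commutes, ← hξdef, hσ,
          Pi.add_apply, hpow]
        ring
      neg_mem' := by
        rintro g ⟨σ, hσ⟩
        refine ⟨σ⁻¹, fun i => ?_⟩
        apply σ.injective
        rw [← AlgEquiv.mul_apply, mul_inv_cancel, AlgEquiv.one_apply, map_mul, map_pow, hξdef,
          AlgEquiv.commutes, ← hξdef, hσ, ← mul_assoc, Pi.neg_apply, ← hpow, neg_add_cancel]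
        simp }
  have hItop : I = ⊤ := by
    by_contra hI
    obtain ⟨e, he, hann⟩ := exists_annihilator hr I hI
    refine he (h e ?_)
    let w : Ω := ∏ i, x i ^ (p ^ (r - 1) * (e i).val)
    have hr1 : p ^ (r - 1) * p = p ^ r := by rw [← pow_succ, Nat.sub_add_cancel hr]
    have hwp : w ^ p = algebraMap E Ω (∏ i, a i ^ (e i).val) := by
      rw [map_prod, ← Finset.prod_pow]
      refine Finset.prod_congr rfl fun i _ => ?_
      rw [map_pow, ← hx, ← pow_mul, ← pow_mul, mul_right_comm, hr1]
    have hfix : ∀ σ : Ω ≃ₐ[E] Ω, σ w = w := by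
      intro σ
      have hex : ∀ i, ∃ k : ZMod (p ^ r), σ (x i) = ξ ^ k.val * x i := by
        intro i
        have : (σ (x i) / x i) ^ (p ^ r) = 1 := by
          rw [div_pow, ← map_pow, hx, AlgEquiv.commutes, div_self]
          exact (_root_.map_ne_zero _).mpr (ha i)
        obtain ⟨k, hk, hkk⟩ := hξ.eq_pow_of_pow_eq_one this
        refine ⟨(k : ZMod (p ^ r)), ?_⟩
        rw [ZMod.val_natCast_of_lt hk, hkk, div_mul_cancel₀ _ (hx0 i)]
      choose g hg using hex
      have hgI : g ∈ I := ⟨σ, hg⟩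
      have hz := hann g hgI
      have hz' : p ∣ ∑ i, (e i).val * (g i).val := by
        rw [← ZMod.natCast_eq_zero_iff]
        push_cast
        simpa only [ZMod.natCast_zmod_val] using hz
      obtain ⟨m, hm⟩ := hz'
      calc σ w = ∏ i, (ξ ^ (p ^ (r - 1) * ((e i).val * (g i).val)) * x i ^
          (p ^ (r - 1) * (e i).val)) := by
            rw [map_prod]
            refine Finset.prod_congr rfl fun i _ => ?_
            rw [map_pow, hg, mul_pow, ← pow_mul]
            congr 2
            ring
        _ = ξ ^ (p ^ (r - 1) * ∑ i, (e i).val * (g i).val) * w := by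
            rw [Finset.prod_mul_distrib, Finset.prod_pow_eq_pow_sum, Finset.mul_sum]
        _ = w := by
            rw [hm, ← mul_assoc, hr1, pow_mul, hξ.pow_eq_one, one_pow, one_mul]
    obtain ⟨w', hw'⟩ := (InfiniteGalois.mem_range_algebraMap_iff_fixed (k := E) w).mpr hfix
    refine ⟨w', (algebraMap E Ω).injective ?_⟩
    rw [map_pow, hw', hwp]
  set F := IntermediateField.adjoin E (Set.range x) with hF
  have hfin : FiniteDimensional E F := IntermediateField.finiteDimensional_adjoin
    (fun y _ => Algebra.IsIntegral.isIntegral y)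
  have hmem : ∀ g : ι → ZMod (p ^ r), ∃ σ : Ω ≃ₐ[E] Ω, ∀ i, σ (x i) = ξ ^ (g i).val * x i :=
    fun g => (hItop ▸ AddSubgroup.mem_top g : g ∈ I)
  choose τ hτ using hmem
  have hinj : Function.Injective (fun g => (τ g).toAlgHom.comp F.val) := by
    intro g g' hgg
    ext i
    have h1 := DFunLike.congr_fun hgg ⟨x i, IntermediateField.subset_adjoin E _ ⟨i, rfl⟩⟩
    change τ g (x i) = τ g' (x i) at h1
    rw [hτ, hτ] at h1
    have h2 := hξ.pow_inj (ZMod.val_lt _) (ZMod.val_lt _) (mul_right_cancel₀ (hx0 i) h1)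
    exact ZMod.val_injective _ h2
  have hcard := Fintype.card_le_of_injective _ hinj
  rw [AlgHom.card E F Ω] at hcard
  simpa [ZMod.card] using hcard

end KummerBound

namespace Multitree

variable {K Ω : Type*} [Field K] [Field Ω] [Algebra K Ω]

/-- The map `x ↦ x ^ q + c`. -/
def powAdd (Ω : Type*) [Field Ω] [Algebra K Ω] (q : ℕ) (c : K) (x : Ω) : Ω :=
    x ^ q + algebraMap K Ω c

/-- The union of the `n`-th preimages of the base points. -/
def level (Ω : Type*) [Field Ω] [Algebra K Ω] (q : ℕ) (c : K) {s : ℕ} (α : Fin s → K)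
    (n : ℕ) : Set Ω :=
  {x | ∃ j, (powAdd Ω q c)^[n] x = algebraMap K Ω (α j)}

/-- The field generated by the preimages of order at most `n`. -/
def tower (Ω : Type*) [Field Ω] [Algebra K Ω] (q : ℕ) (c : K) {s : ℕ} (α : Fin s → K) (n : ℕ) :
    IntermediateField K Ω :=
  IntermediateField.adjoin K {x | ∃ i ≤ n, x ∈ level Ω q c α i}

variable {q : ℕ} {c : K} {s : ℕ} {α : Fin s → K}

theorem map_powAdd (σ : Ω ≃ₐ[K] Ω) (x : Ω) : σ (powAdd Ω q c x) = powAdd Ω q c (σ x) := by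
  simp [powAdd]

theorem map_iterate_powAdd (σ : Ω ≃ₐ[K] Ω) (n : ℕ) (x : Ω) :
    σ ((powAdd Ω q c)^[n] x) = (powAdd Ω q c)^[n] (σ x) :=
  (Function.Semiconj.iterate_right (f := σ) (map_powAdd σ) n).eq x

theorem mem_level_succ {n : ℕ} {x : Ω} : x ∈ level Ω q c α (n + 1) ↔
    powAdd Ω q c x ∈ level Ω q c α n := by
  simp [level]

theorem mem_level_add {m n : ℕ} {x : Ω} :
    x ∈ level Ω q c α (m + n) ↔ (powAdd Ω q c)^[n] x ∈ level Ω q c α m := by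
  simp [level, Function.iterate_add_apply]

theorem map_mem_level (σ : Ω ≃ₐ[K] Ω) {n : ℕ} {x : Ω} (hx : x ∈ level Ω q c α n) :
    σ x ∈ level Ω q c α n := by
  obtain ⟨j, hj⟩ := hx
  exact ⟨j, by rw [← map_iterate_powAdd, hj, AlgEquiv.commutes]⟩

theorem finite_powAdd_eq (hq : 0 < q) (z : Ω) : {x : Ω | powAdd Ω q c x = z}.Finite := by
  classical
  refine ((nthRoots q (z - algebraMap K Ω c)).toFinset.finite_toSet).subset fun x hx => ?_
  have hx' : x ^ q + algebraMap K Ω c = z := hx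
  simp [mem_nthRoots hq, ← hx']

theorem finite_level (hq : 0 < q) (n : ℕ) : (level Ω q c α n).Finite := by
  induction n with
  | zero =>
    refine (Set.finite_range fun j => algebraMap K Ω (α j)).subset ?_
    rintro x ⟨j, hj⟩
    exact ⟨j, hj.symm⟩
  | succ n ih =>
    refine Set.Finite.of_finite_fibers (powAdd Ω q c) (ih.subset ?_) fun z _ =>
      (finite_powAdd_eq hq z).subset fun x hx => hx.2
    rintro _ ⟨x, hx, rfl⟩
    exact mem_level_succ.mp hx

theorem level_subset_tower {n m : ℕ} (h : n ≤ m) {x : Ω} (hx : x ∈ level Ω q c α n) :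
    x ∈ tower Ω q c α m :=
  IntermediateField.subset_adjoin K _ ⟨n, h, hx⟩

theorem map_mem_tower (σ : Ω ≃ₐ[K] Ω) {n : ℕ} {x : Ω} (hx : x ∈ tower Ω q c α n) :
    σ x ∈ tower Ω q c α n := by
  have : tower Ω q c α n ≤ (tower Ω q c α n).comap σ.toAlgHom := by
    refine IntermediateField.adjoin_le_iff.mpr ?_
    rintro y ⟨i, hi, hy⟩
    exact level_subset_tower hi (map_mem_level σ hy)
  exact this hx

theorem pow_fix_level {ζ : K} (hζ : IsPrimitiveRoot ζ q) (hq : 0 < q) (σ : Ω ≃ₐ[K] Ω) (n : ℕ) :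
    ∀ x ∈ level Ω q c α n, (σ ^ (q ^ n)) x = x := by
  induction n with
  | zero =>
    rintro x ⟨j, hj⟩
    have hx : x = algebraMap K Ω (α j) := hj
    simp [hx]
  | succ n ih =>
    intro x hx
    set τ := σ ^ (q ^ n) with hτ
    have h1 := ih _ (mem_level_succ.mp hx)
    rw [map_powAdd] at h1
    have h2 : τ x ^ q = x ^ q := add_right_cancel h1
    rcases eq_or_ne x 0 with rfl | hx0
    · simp
    have hζ' : IsPrimitiveRoot (algebraMap K Ω ζ) q := hζ.map_of_injective
        (algebraMap K Ω).injective
    have hne : NeZero q := ⟨hq.ne'⟩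
    obtain ⟨k, -, hk⟩ := hζ'.eq_pow_of_pow_eq_one (ξ := τ x / x) (by
      rw [div_pow, h2, div_self (pow_ne_zero _ hx0)])
    have h3 : τ x = algebraMap K Ω (ζ ^ k) * x := by rw [map_pow, hk, div_mul_cancel₀ _ hx0]
    have h4 : ∀ m : ℕ, (τ ^ m) x = algebraMap K Ω (ζ ^ k) ^ m * x := by
      intro m
      induction m with
      | zero => simp
      | succ m ihm =>
        rw [pow_succ', AlgEquiv.mul_apply, ihm, map_mul, map_pow, AlgEquiv.commutes, h3]
        ring
    rw [pow_succ, pow_mul, ← hτ, h4, ← map_pow, ← pow_mul, mul_comm k, pow_mul, hζ.pow_eq_one]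
    simp

/-- Exponent vectors `e` modulo `p` on a level for which `∏ (v - c) ^ e v` becomes a `p`-th power
in the tower field. -/
def relations (Ω : Type*) [Field Ω] [Algebra K Ω] (q : ℕ) (c : K) {s : ℕ} (α : Fin s → K) (n p : ℕ)
    [Fintype (level Ω q c α n)] : Set (level Ω q c α n → ZMod p) :=
  {e | ∃ m : level Ω q c α n → ℕ, (∀ v, (m v : ZMod p) = e v) ∧
    ∃ w ∈ tower Ω q c α n, w ^ p = ∏ v : level Ω q c α n, ((v : Ω) - algebraMap K Ω c) ^ m v}

theorem relations_exists_pow {n p : ℕ} (hp : 0 < p) [Fintype (level Ω q c α n)]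
    (hne : ∀ v ∈ level Ω q c α n, v ≠ algebraMap K Ω c) {e : level Ω q c α n → ZMod p}
    (he : e ∈ relations Ω q c α n p) :
    ∃ w ∈ tower Ω q c α n, w ^ p = ∏ v : level Ω q c α n, ((v : Ω) - algebraMap K Ω c) ^
        (e v).val := by
  obtain ⟨m, hm, w, hw, h⟩ := he
  have : NeZero p := ⟨hp.ne'⟩
  have hval : ∀ v, m v = (e v).val + p * (m v / p) := by
    intro v
    rw [← hm, ZMod.val_natCast, Nat.mod_add_div]
  have h0 : ∀ v : level Ω q c α n, (v : Ω) - algebraMap K Ω c ≠ 0 :=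
    fun v => sub_ne_zero.mpr (hne v v.2)
  refine ⟨w / ∏ v : level Ω q c α n, ((v : Ω) - algebraMap K Ω c) ^ (m v / p), div_mem hw
      (prod_mem fun v _ =>
    pow_mem (sub_mem (level_subset_tower le_rfl v.2) (IntermediateField.algebraMap_mem _ _)) _), ?_⟩
  rw [div_pow, h, ← Finset.prod_pow, div_eq_iff (Finset.prod_ne_zero_iff.mpr fun v _ =>
    pow_ne_zero _ (pow_ne_zero _ (h0 v))), ← Finset.prod_mul_distrib]
  refine Finset.prod_congr rfl fun v _ => ?_
  rw [← pow_mul, ← pow_add]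
  congr 1
  rw [mul_comm _ p]
  exact hval v

/-- The Galois action on a level, as a homomorphism to permutations. -/
def levelPerm (Ω : Type*) [Field Ω] [Algebra K Ω] (q : ℕ) (c : K) {s : ℕ} (α : Fin s → K) (n : ℕ) :
    (Ω ≃ₐ[K] Ω) →* Equiv.Perm (level Ω q c α n) where
  toFun σ :=
    { toFun := fun v => ⟨σ v, map_mem_level σ v.2⟩
      invFun := fun v => ⟨σ⁻¹ v, map_mem_level σ⁻¹ v.2⟩
      left_inv := fun v => Subtype.ext (AlgEquiv.symm_apply_apply σ v)
      right_inv := fun v => Subtype.ext (AlgEquiv.apply_symm_apply σ v) }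
  map_one' := rfl
  map_mul' _ _ := rfl

theorem isPGroup_range_levelPerm {ζ : K} {p r : ℕ} (hp : 0 < p) (hζ : IsPrimitiveRoot ζ (p ^ r))
    (n : ℕ) : IsPGroup p (levelPerm Ω (p ^ r) c α n).range := by
  rintro ⟨_, σ, rfl⟩
  refine ⟨r * n, Subtype.ext ?_⟩
  rw [Subgroup.coe_pow, ← map_pow, pow_mul]
  refine Equiv.ext fun v => Subtype.ext ?_
  exact pow_fix_level hζ (pow_pos hp r) σ n v v.2

/-- A nonzero relation can be replaced by a nonzero Galois-invariant one. -/
theorem exists_invariant_relation {ζ : K} {p r : ℕ} (hp : p.Prime) (hζ : IsPrimitiveRoot ζ (p ^ r))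
    (n : ℕ) [Fintype (level Ω (p ^ r) c α n)]
    (h : ∃ e ∈ relations Ω (p ^ r) c α n p, e ≠ 0) :
    ∃ e ∈ relations Ω (p ^ r) c α n p, e ≠ 0 ∧
      ∀ (σ : Ω ≃ₐ[K] Ω) v, e (levelPerm Ω (p ^ r) c α n σ v) = e v := by
  classical
  have : Fact p.Prime := ⟨hp⟩
  let Δ : AddSubmonoid (level Ω (p ^ r) c α n → ZMod p) :=
    { carrier := relations Ω (p ^ r) c α n p
      zero_mem' := ⟨0, fun _ => by simp, 1, one_mem _, by simp⟩
      add_mem' := by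
        rintro e e' ⟨m, hm, w, hw, h⟩ ⟨m', hm', w', hw', h'⟩
        refine ⟨m + m', fun v => by simp [hm, hm'], w * w', mul_mem hw hw', ?_⟩
        simp [mul_pow, h, h', pow_add, Finset.prod_mul_distrib] }
  have hstab : ∀ (g : Equiv.Perm (level Ω (p ^ r) c α n)), g ∈ (levelPerm Ω (p ^ r) c α n).range →
      ∀ e ∈ Δ, (fun v => e (g⁻¹ v)) ∈ Δ := by
    rintro _ ⟨σ, rfl⟩ e ⟨m, hm, w, hw, h⟩
    refine ⟨fun v => m ((levelPerm Ω (p ^ r) c α n σ)⁻¹ v), fun v => hm _, σ w, map_mem_tower σ hw,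
        ?_⟩
    rw [← map_pow, h, map_prod]
    refine Fintype.prod_equiv (levelPerm Ω (p ^ r) c α n σ) _ _ fun v => ?_
    beta_reduce
    rw [map_pow, map_sub, AlgEquiv.commutes, ← Equiv.Perm.mul_apply, inv_mul_cancel,
      Equiv.Perm.one_apply]
    rfl
  let Q := (levelPerm Ω (p ^ r) c α n).range
  let act : MulAction Q Δ :=
    { smul := fun g e => ⟨fun v => e.1 (g.1⁻¹ v), hstab g.1 g.2 e.1 e.2⟩
      one_smul := fun e => rfl
      mul_smul := fun g g' e => Subtype.ext (funext fun v => by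
        change e.1 ((g.1 * g'.1)⁻¹ v) = e.1 (g'.1⁻¹ (g.1⁻¹ v))
        rw [mul_inv_rev]; rfl) }
  have hcard : p ∣ Nat.card Δ := by
    obtain ⟨e, he, he0⟩ := h
    let I : AddSubgroup (level Ω (p ^ r) c α n → ZMod p) :=
      { Δ with
        neg_mem' := fun {e} he => by
          have : -e = (p - 1) • e := by
            ext v
            rw [Pi.neg_apply, Pi.smul_apply, nsmul_eq_mul, Nat.cast_sub hp.one_lt.le]
            simp
          rw [this]
          exact Δ.nsmul_mem he _ }
    have h1 : addOrderOf (⟨e, he⟩ : I) = p := by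
      refine addOrderOf_eq_prime (Subtype.ext ?_) (fun h => he0 (congrArg Subtype.val h))
      ext v
      simp
    have h2 : addOrderOf (⟨e, he⟩ : I) ∣ Nat.card I := addOrderOf_dvd_natCard _
    rwa [h1] at h2
  obtain ⟨e, he, he0⟩ :=
      (isPGroup_range_levelPerm (Ω := Ω) (c := c)
          (α := α) hp.pos hζ n).exists_fixed_point_of_prime_dvd_card_of_fixed_point
    Δ hcard (a := (0 : Δ)) (fun g => rfl)
  refine ⟨e.1, e.2, fun h => he0 (Subtype.ext h.symm), fun σ v => ?_⟩
  have h1 := congrFun (congrArg Subtype.val (he ⟨levelPerm Ω (p ^ r) c α n σ, σ, rfl⟩))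
    (levelPerm Ω (p ^ r) c α n σ v)
  have h2 : e.1 ((levelPerm Ω (p ^ r) c α n σ)⁻¹ (levelPerm Ω (p ^ r) c α n σ v)) =
      e.1 (levelPerm Ω (p ^ r) c α n σ v) := h1
  rw [← h2, ← Equiv.Perm.mul_apply, inv_mul_cancel, Equiv.Perm.one_apply]

end Multitree

namespace Multitree

variable {K Ω : Type*} [Field K] [Field Ω] [Algebra K Ω]
variable {q : ℕ} {c : K} {s : ℕ} {α : Fin s → K}

theorem exists_powAdd_eq [IsAlgClosed Ω] (hq : 0 < q) (z : Ω) : ∃ x : Ω, powAdd Ω q c x = z := by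
  obtain ⟨x, hx⟩ := IsAlgClosed.exists_pow_nat_eq (z - algebraMap K Ω c) hq
  exact ⟨x, by rw [powAdd, hx, sub_add_cancel]⟩

theorem finiteDimensional_tower [Algebra.IsAlgebraic K Ω] (hq : 0 < q) (n : ℕ) :
    FiniteDimensional K (tower Ω q c α n) := by
  have hfin : {x : Ω | ∃ i ≤ n, x ∈ level Ω q c α i}.Finite := by
    refine ((Set.finite_Iic n).biUnion fun i _ => finite_level (α := α) (c := c) hq i).subset ?_
    rintro x ⟨i, hi, hx⟩
    exact Set.mem_biUnion hi hx
  have := hfin.to_subtype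
  exact IntermediateField.finiteDimensional_adjoin fun x _ => Algebra.IsIntegral.isIntegral x

/-- Maximal degree growth at a level without nontrivial relations. -/
theorem pow_card_mul_finrank_le [IsAlgClosed Ω] [IsGalois K Ω] {p r : ℕ} (hp : p.Prime) (hr : 0 < r)
    {ζ : K} (hζ : IsPrimitiveRoot ζ (p ^ r)) (n : ℕ)
    (hne : ∀ v ∈ level Ω (p ^ r) c α n, v ≠ algebraMap K Ω c)
    [Fintype (level Ω (p ^ r) c α n)]
    (h : ∀ e ∈ relations Ω (p ^ r) c α n p, e = 0) :
    (p ^ r) ^ Fintype.card (level Ω (p ^ r) c α n) * Module.finrank K (tower Ω (p ^ r) c α n) ≤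
      Module.finrank K (tower Ω (p ^ r) c α (n + 1)) := by
  classical
  have hq : 0 < p ^ r := pow_pos hp.pos r
  choose x hx using fun v : level Ω (p ^ r) c α n => exists_powAdd_eq (c := c) hq (v : Ω)
  have hxmem : ∀ v, x v ∈ level Ω (p ^ r) c α (n + 1) := fun v => by
    rw [mem_level_succ, hx]; exact v.2
  set E := tower Ω (p ^ r) c α n with hE
  have : NeZero p := ⟨hp.ne_zero⟩
  let a : level Ω (p ^ r) c α n → E := fun v =>
    ⟨v, level_subset_tower le_rfl v.2⟩ - algebraMap K E c
  have ha : ∀ v, algebraMap E Ω (a v) = (v : Ω) - algebraMap K Ω c := fun v => rfl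
  have key := KummerBound.pow_card_le_finrank (E := E) (Ω := Ω) hp hr
    (hζ.map_of_injective (algebraMap K E).injective) a
    (fun v h0 => hne v v.2 (sub_eq_zero.mp (by rw [← ha, h0, map_zero]))) x
    (fun v => by rw [ha, ← hx v, powAdd, add_sub_cancel_right])
    (by
      rintro e ⟨w, hw⟩
      refine h e ⟨fun v => (e v).val, fun v => by simp, w, w.2, ?_⟩
      have := congrArg (algebraMap E Ω) hw
      rw [map_pow, map_prod] at this
      refine this.trans (Finset.prod_congr rfl fun v _ => ?_)
      rw [map_pow, ha])
  have hfd := finiteDimensional_tower (Ω := Ω) (c := c) (α := α) hq (n + 1)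
  have hle : (IntermediateField.adjoin E (Set.range x)).restrictScalars K ≤
      tower Ω (p ^ r) c α (n + 1) := by
    rw [hE, tower, IntermediateField.adjoin_adjoin_left]
    refine IntermediateField.adjoin_le_iff.mpr ?_
    rintro y (⟨i, hi, hy⟩ | ⟨v, rfl⟩)
    · exact level_subset_tower (hi.trans n.le_succ) hy
    · exact level_subset_tower le_rfl (hxmem v)
  calc _ ≤ Module.finrank E (IntermediateField.adjoin E (Set.range x)) * Module.finrank K E :=
        Nat.mul_le_mul_right _ key
    _ = Module.finrank K (IntermediateField.adjoin E (Set.range x)) := by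
        rw [mul_comm]
        exact Module.finrank_mul_finrank K E (IntermediateField.adjoin E (Set.range x))
    _ = Module.finrank K ((IntermediateField.adjoin E (Set.range x)).restrictScalars K) := rfl
    _ ≤ _ := IntermediateField.finrank_le_of_le_right hle

/-- A level has at least `q` times as many points as the preceding one. -/
theorem card_level_mul_le [IsAlgClosed Ω] {ζ : K} (hq : 0 < q) (hζ : IsPrimitiveRoot ζ q) (n : ℕ)
    (hne : ∀ v ∈ level Ω q c α n, v ≠ algebraMap K Ω c) :
    Nat.card (level Ω q c α n) * q ≤ Nat.card (level Ω q c α (n + 1)) := by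
  choose x hx using fun v : level Ω q c α n => exists_powAdd_eq (c := c) hq (v : Ω)
  have hζ' : IsPrimitiveRoot (algebraMap K Ω ζ) q := hζ.map_of_injective (algebraMap K Ω).injective
  have hval : ∀ (v : level Ω q c α n) (k : ℕ), powAdd Ω q c (algebraMap K Ω ζ ^ k * x v) = v :=
    fun v k => by
      rw [powAdd, mul_pow, ← pow_mul, mul_comm k, pow_mul, hζ'.pow_eq_one, one_pow, one_mul, ← hx v]
      rfl
  have hfin := (finite_level (Ω := Ω) (c := c) (α := α) hq (n + 1)).to_subtype
  have hinj : Function.Injective fun z : level Ω q c α n × Fin q =>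
      (⟨algebraMap K Ω ζ ^ (z.2 : ℕ) * x z.1, by
        rw [mem_level_succ, hval]; exact z.1.2⟩ : level Ω q c α (n + 1)) := by
    rintro ⟨v, k⟩ ⟨v', k'⟩ h
    have h1 : algebraMap K Ω ζ ^ (k : ℕ) * x v = algebraMap K Ω ζ ^ (k' : ℕ) * x v' :=
      congrArg Subtype.val h
    have h2 : v = v' := Subtype.ext (by rw [← hval v k, h1, hval])
    subst h2
    have h3 : x v ≠ 0 := fun h0 => hne v v.2 (by
      rw [← hx v, h0, powAdd, zero_pow hq.ne', zero_add])
    have h4 := hζ'.pow_inj k.2 k'.2 (mul_right_cancel₀ h3 h1)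
    exact Prod.ext rfl (Fin.ext h4)
  have := Nat.card_le_card_of_injective _ hinj
  simpa using this

theorem le_card_level [IsAlgClosed Ω] {ζ : K} (hq : 0 < q) (hζ : IsPrimitiveRoot ζ q)
    (hα : Function.Injective α)
    (hne : ∀ n, ∀ v ∈ level Ω q c α n, v ≠ algebraMap K Ω c) (n : ℕ) :
    s * q ^ n ≤ Nat.card (level Ω q c α n) := by
  induction n with
  | zero =>
    have hfin := (finite_level (Ω := Ω) (c := c) (α := α) hq 0).to_subtype
    have hinj : Function.Injective fun j => (⟨algebraMap K Ω (α j), j, rfl⟩ : level Ω q c α 0) :=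
      fun i j h => hα ((algebraMap K Ω).injective (congrArg Subtype.val h))
    simpa using Nat.card_le_card_of_injective _ hinj
  | succ n ih =>
    calc s * q ^ (n + 1) = s * q ^ n * q := by ring
      _ ≤ Nat.card (level Ω q c α n) * q := Nat.mul_le_mul_right _ ih
      _ ≤ _ := card_level_mul_le hq hζ n (hne n)

/-- Eventual absence of relations forces the full degree up to a bounded factor. -/
theorem exists_finrank_bound [IsAlgClosed Ω] [IsGalois K Ω] {p r : ℕ} (hp : p.Prime) (hr : 0 < r)
    {ζ : K} (hζ : IsPrimitiveRoot ζ (p ^ r)) (hα : Function.Injective α)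
    (hne : ∀ n, ∀ v ∈ level Ω (p ^ r) c α n, v ≠ algebraMap K Ω c) (N : ℕ)
    (h : ∀ n, N ≤ n → ∀ [Fintype (level Ω (p ^ r) c α n)],
      ∀ e ∈ relations Ω (p ^ r) c α n p, e = 0) :
    ∃ C : ℕ, ∀ n, (p ^ r) ^ (s * (((p ^ r) ^ n - 1) / (p ^ r - 1))) ≤
      C * Module.finrank K (tower Ω (p ^ r) c α n) := by
  have hq : 0 < p ^ r := pow_pos hp.pos r
  have hq2 : 2 ≤ p ^ r := hp.two_le.trans (Nat.le_self_pow hr.ne' p)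
  have hpos : ∀ n, 1 ≤ Module.finrank K (tower Ω (p ^ r) c α n) := fun n => by
    have := finiteDimensional_tower (Ω := Ω) (c := c) (α := α) hq n
    exact Module.finrank_pos
  set F : ℕ → ℕ := fun n => (p ^ r) ^ (s * (((p ^ r) ^ n - 1) / (p ^ r - 1))) with hF
  have hFs : ∀ n, F (n + 1) = (p ^ r) ^ (s * (p ^ r) ^ n) * F n := by
    intro n
    simp only [hF]
    rw [← Nat.geomSum_eq hq2, ← Nat.geomSum_eq hq2, Finset.sum_range_succ, mul_add, pow_add,
        mul_comm]
  have hFm : Monotone F := monotone_nat_of_le_succ fun n => by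
    rw [hFs]; exact Nat.le_mul_of_pos_left _ (pow_pos hq _)
  refine ⟨F N, fun n => ?_⟩
  change F n ≤ _
  rcases le_total n N with hn | hn
  · exact (hFm hn).trans (Nat.le_mul_of_pos_right _ (hpos n))
  · induction n, hn using Nat.le_induction with
    | base => exact Nat.le_mul_of_pos_right _ (hpos N)
    | succ n hn ih =>
      have hfin := (finite_level (Ω := Ω) (c := c) (α := α) hq n).fintype
      have h1 := pow_card_mul_finrank_le (Ω := Ω) (α := α) hp hr hζ n (hne n) (h n hn)
      have h2 := le_card_level (Ω := Ω) hq hζ hα hne n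
      rw [Nat.card_eq_fintype_card] at h2
      calc F (n + 1) = (p ^ r) ^ (s * (p ^ r) ^ n) * F n := hFs n
        _ ≤ (p ^ r) ^ (s * (p ^ r) ^ n) * (F N * Module.finrank K (tower Ω (p ^ r) c α n)) :=
            Nat.mul_le_mul_left _ ih
        _ = F N * ((p ^ r) ^ (s * (p ^ r) ^ n) * Module.finrank K (tower Ω (p ^ r) c α n)) :=
            by ring
        _ ≤ F N * ((p ^ r) ^ Fintype.card (level Ω (p ^ r) c α n) *
              Module.finrank K (tower Ω (p ^ r) c α n)) :=
            Nat.mul_le_mul_left _ (Nat.mul_le_mul_right _ (Nat.pow_le_pow_right hq h2))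
        _ ≤ _ := Nat.mul_le_mul_left _ h1

end Multitree

namespace Multitree

/-- The map `x ↦ x ^ q + c` on a commutative ring. -/
def powC {R : Type*} [CommRing R] (q : ℕ) (c : R) (x : R) : R := x ^ q + c

theorem map_iterate_powC {R S : Type*} [CommRing R] [CommRing S] (f : R →+* S) (q : ℕ) (c x : R)
    (n : ℕ) : f ((powC q c)^[n] x) = (powC q (f c))^[n] (f x) :=
  (Function.Semiconj.iterate_right (f := f) (ga := powC q c) (gb := powC q (f c))
    (fun x => by simp [powC]) n).eq x

theorem charP_of_cast_eq_zero {R : Type*} [CommRing R] [Nontrivial R] {p : ℕ} (hp : p.Prime)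
    (h : (p : R) = 0) : CharP R p := by
  obtain ⟨n, hn⟩ := CharP.exists R
  rcases (Nat.dvd_prime hp).mp ((CharP.cast_eq_zero_iff R n p).mp h) with rfl | rfl
  · exact absurd rfl (CharP.char_ne_one R 1)
  · exact hn

theorem iterate_powC_sub {R : Type*} [CommRing R] {p : ℕ} (hp : p.Prime) [CharP R p] (r : ℕ)
    (c x y : R) (n : ℕ) :
    (powC (p ^ r) c)^[n] x - (powC (p ^ r) c)^[n] y = (x - y) ^ (p ^ r) ^ n := by
  have : Fact p.Prime := ⟨hp⟩
  induction n with
  | zero => simp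
  | succ n ih =>
    rw [Function.iterate_succ_apply', Function.iterate_succ_apply', pow_succ, pow_mul, ← ih,
      sub_pow_char_pow]
    simp [powC]

theorem exists_iterate_powC_eq_id {k : Type*} [CommRing k] [IsDomain k] [Finite k] {p : ℕ}
    (hp : p.Prime) [CharP k p] (r : ℕ) (c : k) :
    ∃ m, 0 < m ∧ ∀ x, (powC (p ^ r) c)^[m] x = x := by
  have hinj : Function.Injective (powC (p ^ r) c) := fun x y h => by
    have := iterate_powC_sub hp r c x y 1
    rw [Function.iterate_one, h, sub_self] at this
    exact sub_eq_zero.mp (pow_eq_zero_iff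
        (pow_ne_zero _ (pow_ne_zero _ hp.ne_zero)) |>.mp this.symm)
  let e : Equiv.Perm k := Equiv.ofBijective _ (Finite.injective_iff_bijective.mp hinj)
  refine ⟨orderOf e, orderOf_pos e, fun x => ?_⟩
  have h1 : ∀ m : ℕ, (powC (p ^ r) c)^[m] x = (e ^ m) x := fun m => by
    rw [← Equiv.Perm.iterate_eq_pow]; rfl
  rw [h1, pow_orderOf_eq_one, Equiv.Perm.one_apply]

theorem monic_iterate_powC {R : Type*} [CommRing R] [Nontrivial R] {q : ℕ} (hq : 0 < q) (c : R)
    (n : ℕ) :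
    ((powC q (C c))^[n] X).Monic ∧ ((powC q (C c))^[n] (X : R[X])).natDegree = q ^ n := by
  induction n with
  | zero => simp [monic_X]
  | succ n ih =>
    rw [Function.iterate_succ_apply']
    have h1 := ih.1.pow q
    have h2 : (((powC q (C c))^[n] (X : R[X])) ^ q).natDegree = q ^ (n + 1) := by
      rw [ih.1.natDegree_pow, ih.2, pow_succ']
    have h3 : (C c).degree < (((powC q (C c))^[n] (X : R[X])) ^ q).degree := by
      refine degree_C_le.trans_lt ?_
      rw [degree_eq_natDegree h1.ne_zero, h2]
      exact_mod_cast pow_pos hq _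
    exact ⟨h1.add_of_left h3, by rw [powC, natDegree_add_C, h2]⟩

theorem monic_iterate_powC_sub {R : Type*} [CommRing R] [Nontrivial R] {q : ℕ} (hq : 0 < q)
    (c a : R) (n : ℕ) : ((powC q (C c))^[n] X - C a).Monic := by
  have h := monic_iterate_powC hq c n
  refine h.1.sub_of_left (degree_C_le.trans_lt ?_)
  rw [degree_eq_natDegree h.1.ne_zero, h.2]
  exact_mod_cast pow_pos hq _

/-- Nonconstant factors of `φ^n(X) - a` take values in `𝔭` at `a`,
    when `φ^n(a) ≡ a` modulo `𝔭 ∣ p`. -/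
theorem eval_mem_of_dvd {R : Type*} [CommRing R] {p r : ℕ} (hp : p.Prime) (P : Ideal R)
    [P.IsPrime] (hpP : (p : R) ∈ P) (c a : R) (n : ℕ) (hn : (powC (p ^ r) c)^[n] a - a ∈ P)
    {g : R[X]} (hg : g.Monic) (hdeg : 0 < g.natDegree)
    (hdvd : g ∣ (powC (p ^ r) (C c))^[n] X - C a) : g.eval a ∈ P := by
  have hchar : CharP (R ⧸ P) p := charP_of_cast_eq_zero hp (by
    rw [← map_natCast (Ideal.Quotient.mk P), Ideal.Quotient.eq_zero_iff_mem]; exact hpP)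
  set π := Ideal.Quotient.mk P
  have h1 : ((powC (p ^ r) (C c))^[n] X - C a).map π = (X - C (π a)) ^ (p ^ r) ^ n := by
    rw [← iterate_powC_sub hp r (C (π c)), Polynomial.map_sub, ← coe_mapRingHom,
      map_iterate_powC, coe_mapRingHom, map_X, map_C, map_C]
    congr 1
    rw [← map_iterate_powC C, ← map_iterate_powC π]
    congr 1
    exact (Ideal.Quotient.eq.mpr hn).symm
  have h2 : g.map π ∣ (X - C (π a)) ^ (p ^ r) ^ n := h1 ▸ Polynomial.map_dvd π hdvd
  obtain ⟨i, -, hi⟩ := (dvd_prime_pow (prime_X_sub_C (π a)) _).mp h2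
  have hi0 : i ≠ 0 := by
    rintro rfl
    have := hi
    rw [pow_zero, associated_one_iff_isUnit] at this
    have h3 := natDegree_eq_zero_of_isUnit this
    rw [hg.natDegree_map] at h3
    omega
  have h4 : X - C (π a) ∣ g.map π := (dvd_pow_self _ hi0).trans hi.symm.dvd
  rw [dvd_iff_isRoot, IsRoot, eval_map_apply] at h4
  exact Ideal.Quotient.eq_zero_iff_mem.mp h4

theorem finite_range_iterate {A : Type*} {f : A → A} {x : A} {m n : ℕ} (hn : 0 < n)
    (h : f^[n] (f^[m] x) = f^[m] x) : (Set.range fun k => f^[k] x).Finite := by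
  refine ((Set.finite_Iio (m + n)).image fun k => f^[k] x).subset ?_
  rintro _ ⟨k, rfl⟩
  induction k using Nat.strong_induction_on with
  | _ k ih =>
    rcases lt_or_ge k (m + n) with hk | hk
    · exact ⟨k, hk, rfl⟩
    · have h1 : f^[k] x = f^[k - n] x := by
        obtain ⟨d, rfl⟩ := Nat.exists_eq_add_of_le hk
        rw [show m + n + d = d + (n + m) by ring, show d + (n + m) - n = d + m by omega,
          Function.iterate_add_apply, Function.iterate_add_apply f n m, h,
              Function.iterate_add_apply]
      change f^[k] x ∈ _
      rw [h1]
      exact ih (k - n) (by omega)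

theorem exists_pow_mem_bound {R : Type*} [CommRing R] [IsDomain R] [IsNoetherianRing R]
    (P : Ideal R)
    (hP : P ≠ ⊤) {Y : Set R} (hY : Y.Finite) (h0 : (0 : R) ∉ Y) :
    ∃ B, ∀ y ∈ Y, ∀ e, y ∈ P ^ e → e ≤ B := by
  have h1 : ∀ y ∈ Y, ∃ B, ∀ e, y ∈ P ^ e → e ≤ B := by
    intro y hy
    by_contra! hcon
    have : y ∈ ⨅ i, P ^ i := by
      rw [Ideal.mem_iInf]
      intro i
      obtain ⟨e, he, hie⟩ := hcon i
      exact Ideal.pow_le_pow_right hie.le he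
    rw [Ideal.iInf_pow_eq_bot_of_isDomain P hP, Ideal.mem_bot] at this
    exact h0 (this ▸ hy)
  choose! B hB using h1
  obtain ⟨M, hM⟩ := (hY.image B).bddAbove
  exact ⟨M, fun y hy e he => (hB y hy e he).trans (hM ⟨y, hy, rfl⟩)⟩

end Multitree

namespace Multitree

variable {K Ω : Type*} [Field K] [Field Ω] [Algebra K Ω]

theorem iterate_powAdd_coe (q : ℕ) (c x : 𝓞 K) (n : ℕ) :
    (powAdd Ω q (c : K))^[n] (algebraMap (𝓞 K) Ω x) = algebraMap (𝓞 K) Ω ((powC q c)^[n] x) := by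
  rw [map_iterate_powC]
  congr 1

theorem aeval_iterate_powC (q : ℕ) (c a : 𝓞 K) (n : ℕ) (x : Ω) :
    aeval x ((powC q (C c))^[n] X - C a) =
      (powAdd Ω q (c : K))^[n] x - algebraMap K Ω (a : K) := by
  rw [map_sub, aeval_C]
  congr 1
  have h := map_iterate_powC ((aeval x : (𝓞 K)[X] →ₐ[𝓞 K] Ω) : (𝓞 K)[X] →+* Ω) q (C c) X n
  simp only [RingHom.coe_coe, aeval_X, aeval_C] at h
  exact h

theorem isIntegral_of_iterate {q : ℕ} (hq : 0 < q) {c a : 𝓞 K} {n : ℕ} {x : Ω}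
    (hx : (powAdd Ω q (c : K))^[n] x = algebraMap K Ω (a : K)) : IsIntegral (𝓞 K) x :=
  ⟨_, monic_iterate_powC_sub hq c a n, by
    rw [← aeval_def, aeval_iterate_powC, hx, sub_self]⟩

theorem exists_conjugates_bound [NumberField K] {p r : ℕ} (hp : p.Prime) (c a : 𝓞 K)
    (hfin : (Set.range fun n => (powC (p ^ r) c)^[n] a).Finite)
    (hper : ∀ n, 0 < n → (powC (p ^ r) c)^[n] a ≠ a) :
    ∃ m, 0 < m ∧ ∃ B, ∀ n, 0 < n → m ∣ n →
      (minpoly K '' {x : Ω | (powAdd Ω (p ^ r) (c : K))^[n] x = algebraMap K Ω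
          (a : K)}).ncard ≤ B := by
  classical
  have hq : 0 < p ^ r := pow_pos hp.pos r
  obtain ⟨P, hP, hpP⟩ := Ideal.exists_le_maximal (Ideal.span {(p : 𝓞 K)}) (by
    rw [Ne, Ideal.span_singleton_eq_top]
    intro hu
    have h1 := hu.map (Algebra.norm ℤ)
    rw [show (p : 𝓞 K) = algebraMap ℤ (𝓞 K) p by simp, Algebra.norm_algebraMap,
      isUnit_pow_iff Module.finrank_pos.ne', Int.isUnit_iff_natAbs_eq, Int.natAbs_natCast] at h1
    exact hp.one_lt.ne' h1)
  have hpP' : (p : 𝓞 K) ∈ P := hpP (Ideal.mem_span_singleton_self _)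
  have hchar : CharP (𝓞 K ⧸ P) p := charP_of_cast_eq_zero hp (by
    rw [← map_natCast (Ideal.Quotient.mk P), Ideal.Quotient.eq_zero_iff_mem]; exact hpP')
  obtain ⟨m, hm, hmid⟩ := exists_iterate_powC_eq_id (k := 𝓞 K ⧸ P) hp r (Ideal.Quotient.mk P c)
  obtain ⟨B, hB⟩ := exists_pow_mem_bound P hP.ne_top
    (Y := {y | ∃ n, 0 < n ∧ (powC (p ^ r) c)^[n] a - a = y})
    ((hfin.image fun z => z - a).subset (by
      rintro _ ⟨n, -, rfl⟩
      exact ⟨_, ⟨n, rfl⟩, rfl⟩))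
    (by
      rintro ⟨n, hn, h⟩
      exact hper n hn (sub_eq_zero.mp h))
  refine ⟨m, hm, B, fun n hn hmn => ?_⟩
  have hna : (powC (p ^ r) c)^[n] a - a ∈ P := by
    obtain ⟨d, rfl⟩ := hmn
    rw [← Ideal.Quotient.eq, map_iterate_powC, Function.iterate_mul]
    have : (powC (p ^ r) (Ideal.Quotient.mk P c))^[m] = id := funext hmid
    rw [this, Function.iterate_id, id]
  have hSfin : (minpoly K '' {x : Ω | (powAdd Ω (p ^ r) (c : K))^[n] x = algebraMap K Ω
      (a : K)}).Finite := by
    refine Set.Finite.image _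
        ((finite_level (Ω := Ω) (c := (c : K)) (α := fun _ : Fin 1 => (a : K)) hq n).subset ?_)
    exact fun x hx => ⟨0, hx⟩
  obtain ⟨T, hT⟩ := hSfin.exists_finset_coe
  rw [← hT, Set.ncard_coe_finset]
  have hlift : ∀ g ∈ T, ∃ β : Ω, (powAdd Ω (p ^ r) (c : K))^[n] β = algebraMap K Ω (a : K) ∧
      minpoly K β = g := fun g hg => by
    have : g ∈ (T : Set K[X]) := hg
    rwa [hT] at this
  choose! β hβ hβg using hlift
  have hinteg : ∀ g ∈ T, IsIntegral (𝓞 K) (β g) := fun g hg => isIntegral_of_iterate hq (hβ g hg)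
  set F : (𝓞 K)[X] := (powC (p ^ r) (C c))^[n] X - C a with hF
  have hmap : ∀ g ∈ T, (minpoly (𝓞 K) (β g)).map (algebraMap (𝓞 K) K) = g := fun g hg => by
    rw [← minpoly.isIntegrallyClosed_eq_field_fractions' K (hinteg g hg), hβg g hg]
  have hdvd1 : ∀ g ∈ T, minpoly (𝓞 K) (β g) ∣ F := fun g hg =>
    minpoly.isIntegrallyClosed_dvd (hinteg g hg) (by
      rw [hF, aeval_iterate_powC, hβ g hg, sub_self])
  have hdvd : ∏ g ∈ T, minpoly (𝓞 K) (β g) ∣ F := by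
    rw [← Monic.dvd_iff_fraction_map_dvd_fraction_map (K := K) (monic_iterate_powC_sub hq c a n)
      (monic_prod_of_monic _ _ fun g hg => minpoly.monic (hinteg g hg)), Polynomial.map_prod,
      Finset.prod_congr rfl hmap]
    refine Finset.prod_dvd_of_coprime ?_ fun g hg => ?_
    · intro g hg g' hg' hne
      have hi : ∀ g ∈ T, Irreducible g ∧ g.Monic := fun g hg => by
        have hK : IsIntegral K (β g) := (hinteg g hg).tower_top
        rw [← hβg g hg]
        exact ⟨minpoly.irreducible hK, minpoly.monic hK⟩
      refine ((hi g hg).1.coprime_iff_not_dvd).mpr fun h => hne ?_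
      exact eq_of_monic_of_associated (hi g hg).2 (hi g' hg').2
        ((hi g hg).1.associated_of_dvd (hi g' hg').1 h)
    · rw [← hmap g hg]
      exact Polynomial.map_dvd _ (hdvd1 g hg)
  refine hB _ ⟨n, hn, rfl⟩ _ ?_
  have heval : F.eval a = (powC (p ^ r) c)^[n] a - a := by
    have h := map_iterate_powC (evalRingHom a) (p ^ r) (C c) X n
    simp only [coe_evalRingHom, eval_X, eval_C] at h
    rw [hF, eval_sub, h, eval_C]
  obtain ⟨H, hH⟩ := hdvd
  rw [← heval, hH, eval_mul, eval_prod]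
  refine Ideal.mul_mem_right _ _ ?_
  rw [← Finset.prod_const]
  exact Ideal.prod_mem_prod fun g hg => eval_mem_of_dvd hp P hpP' c a n hna
    (minpoly.monic (hinteg g hg)) (minpoly.natDegree_pos (hinteg g hg)) (hdvd1 g hg)

theorem finite_conjugates {q : ℕ} (hq : 0 < q) {c : K} {s : ℕ} {α : Fin s → K} (n : ℕ) :
    (minpoly K '' level Ω q c α n).Finite :=
  (finite_level hq n).image _

/-- Beyond some level, two points of the same subtree are conjugate. -/
theorem exists_orbit_stable [NumberField K] [IsAlgClosed Ω] [IsGalois K Ω] {p r : ℕ} (hp : p.Prime)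
    (c : 𝓞 K)
    {s : ℕ} (a : Fin s → 𝓞 K) (hfin : ∀ j, (Set.range fun n => (powC (p ^ r) c)^[n] (a j)).Finite)
    (hper : ∀ j n, 0 < n → (powC (p ^ r) c)^[n] (a j) ≠ a j) :
    ∃ N₀, ∀ N d, N₀ ≤ N → ∀ β ∈ level Ω (p ^ r) (c : K) (fun j => (a j : K)) (N + d),
      ∀ β' ∈ level Ω (p ^ r) (c : K) (fun j => (a j : K)) (N + d),
      (powAdd Ω (p ^ r) (c : K))^[d] β = (powAdd Ω (p ^ r) (c : K))^[d] β' →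
      ∃ σ : Ω ≃ₐ[K] Ω, σ β = β' := by
  classical
  have hq : 0 < p ^ r := pow_pos hp.pos r
  set V : ℕ → Set Ω := level Ω (p ^ r) (c : K) (fun j => (a j : K)) with hV
  set φ := powAdd Ω (p ^ r) (c : K) with hφ
  have hmem : ∀ {x y : Ω}, minpoly K x = minpoly K y ↔ ∃ σ : Ω ≃ₐ[K] Ω, σ y = x :=
    fun {x y} => Normal.minpoly_eq_iff_mem_orbit Ω
  have hf : ∀ d, ∃ f : K[X] → K[X], ∀ β, f (minpoly K β) = minpoly K (φ^[d] β) := fun d => by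
    choose! ρ hρ using fun (g : K[X]) (h : ∃ β : Ω, minpoly K β = g) => h
    refine ⟨fun g => minpoly K (φ^[d] (ρ g)), fun β => ?_⟩
    obtain ⟨σ, hσ⟩ := hmem.mp (hρ (minpoly K β) ⟨β, rfl⟩)
    exact hmem.mpr ⟨σ, by rw [map_iterate_powAdd, hσ]⟩
  choose f hf using hf
  have hsurj : ∀ (d : ℕ) (z : Ω), ∃ x, φ^[d] x = z := fun d =>
    Function.Surjective.iterate (exists_powAdd_eq hq) d
  have himage : ∀ N d, f d '' (minpoly K '' V (N + d)) = minpoly K '' V N := fun N d => by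
    ext g
    constructor
    · rintro ⟨_, ⟨β, hβ, rfl⟩, rfl⟩
      exact ⟨φ^[d] β, mem_level_add.mp hβ, (hf d β).symm⟩
    · rintro ⟨z, hz, rfl⟩
      obtain ⟨x, rfl⟩ := hsurj d z
      exact ⟨_, ⟨x, mem_level_add.mpr hz, rfl⟩, hf d x⟩
  set o : ℕ → ℕ := fun n => (minpoly K '' V n).ncard with ho
  have hmono : ∀ N d, o N ≤ o (N + d) := fun N d => by
    simp only [ho]
    rw [← himage N d]
    exact Set.ncard_image_le (finite_conjugates hq _)
  choose m hm B hB using fun j => exists_conjugates_bound (Ω := Ω) hp c (a j) (hfin j) (hper j)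
  have hbound : ∀ n, o n ≤ ∑ j, B j := fun n => by
    have hM : 0 < ∏ j, m j := Finset.prod_pos fun j _ => hm j
    obtain ⟨d, hd⟩ := Nat.exists_eq_add_of_le
      (show n ≤ (n + 1) * ∏ j, m j from n.le_succ.trans (Nat.le_mul_of_pos_right _ hM))
    refine (hmono n d).trans ?_
    rw [← hd]
    have hsub : minpoly K '' V ((n + 1) * ∏ j, m j) = ⋃ j ∈ (Finset.univ : Finset (Fin s)),
        minpoly K '' {x : Ω | φ^[(n + 1) * ∏ j, m j] x = algebraMap K Ω (a j : K)} := by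
      ext g
      simp only [hV, level, Set.mem_image, Set.mem_iUnion, Finset.mem_univ, exists_prop, true_and]
      constructor
      · rintro ⟨x, ⟨j, hj⟩, rfl⟩
        exact ⟨j, x, hj, rfl⟩
      · rintro ⟨j, x, hj, rfl⟩
        exact ⟨x, ⟨j, hj⟩, rfl⟩
    simp only [ho]
    rw [hsub]
    refine (Finset.set_ncard_biUnion_le _ _).trans (Finset.sum_le_sum fun j _ => ?_)
    exact hB j _ (Nat.mul_pos n.succ_pos hM)
        (Dvd.dvd.mul_left (Finset.dvd_prod_of_mem m (Finset.mem_univ j)) _)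
  have hne : (Set.range o).Nonempty := ⟨_, 0, rfl⟩
  have hbdd : BddAbove (Set.range o) := ⟨_, by rintro _ ⟨n, rfl⟩; exact hbound n⟩
  obtain ⟨N₀, hN₀⟩ := Nat.sSup_mem hne hbdd
  have hconst : ∀ N, N₀ ≤ N → o N = o N₀ := fun N hN => by
    obtain ⟨d, rfl⟩ := Nat.exists_eq_add_of_le hN
    exact le_antisymm (hN₀ ▸ le_csSup hbdd ⟨_, rfl⟩) (hmono N₀ d)
  refine ⟨N₀, fun N d hN β hβ β' hβ' h => ?_⟩
  have hinj : Set.InjOn (f d) (minpoly K '' V (N + d)) := by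
    refine Set.injOn_of_ncard_image_eq ?_ (finite_conjugates hq _)
    rw [himage]
    exact (hconst N hN).trans (hconst (N + d) (hN.trans (N.le_add_right d))).symm
  have := hinj ⟨β', hβ', rfl⟩ ⟨β, hβ, rfl⟩ (by rw [hf, hf, h])
  exact hmem.mp this

end Multitree

namespace Multitree

/-- If the generators of a Galois extension of number fields are pairwise incongruent above a prime,
then that prime is unramified. -/
theorem ramificationIdx_eq_one {L M : Type*} [Field L] [NumberField L] [Field M] [NumberField M]
    [Algebra L M] [IsGalois L M] {S : Set M} (hS : IntermediateField.adjoin L S = ⊤)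
    (hinteg : ∀ x ∈ S, IsIntegral ℤ x) (hstab : ∀ σ : M ≃ₐ[L] M, ∀ x ∈ S, σ x ∈ S)
    (Q : Ideal (𝓞 L)) [Q.IsMaximal] (P : Ideal (𝓞 M)) [P.IsPrime] [P.LiesOver Q]
    (h : ∀ x y : 𝓞 M, (x : M) ∈ S → (y : M) ∈ S → x - y ∈ P → x = y) :
    P.ramificationIdx (𝓞 L) = 1 := by
  rw [← Ideal.ramificationIdxIn_eq_ramificationIdx Q P (M ≃ₐ[L] M),
    ← Ideal.card_inertia_eq_ramificationIdxIn (G := M ≃ₐ[L] M) Q P, Nat.card_eq_one_iff_unique]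
  refine ⟨⟨fun a b => ?_⟩, ⟨1⟩⟩
  have key : ∀ σ ∈ P.toAddSubgroup.inertia (M ≃ₐ[L] M), σ = 1 := by
    intro σ hσ
    have hle : IntermediateField.adjoin L S ≤
        IntermediateField.fixedField (Subgroup.zpowers σ) := by
      refine IntermediateField.adjoin_le_iff.mpr fun x hx => ?_
      have hx1 : σ x = x := by
        let X : 𝓞 M := ⟨x, hinteg x hx⟩
        have := h (σ • X) X (hstab σ x hx) hx (hσ X)
        exact congrArg (fun z : 𝓞 M => (z : M)) this
      rw [SetLike.mem_coe, IntermediateField.mem_fixedField_iff]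
      intro τ hτ
      exact (Subgroup.zpowers_le (H := MulAction.stabilizer (M ≃ₐ[L] M) x)).mpr hx1 hτ
    rw [hS] at hle
    refine AlgEquiv.ext fun x => ?_
    exact (IntermediateField.mem_fixedField_iff _ _).mp (hle (IntermediateField.mem_top (x := x))) σ
      (Subgroup.mem_zpowers σ)
  exact Subtype.ext ((key a a.2).trans (key b b.2).symm)

open UniqueFactorizationMonoid in
theorem dvd_count_of_pow_eq {L M : Type*} [Field L] [NumberField L] [Field M] [NumberField M]
    [Algebra L M] [DecidableEq (Ideal (𝓞 L))] (Q : Ideal (𝓞 L)) [Q.IsMaximal] (hQ : Q ≠ ⊥)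
    (P : Ideal (𝓞 M)) [P.IsPrime] [P.LiesOver Q] (he : P.ramificationIdx (𝓞 L) = 1)
    {D : 𝓞 L} (hD : D ≠ 0) {w : M} {p : ℕ} (hp : 0 < p) (hw : w ^ p = algebraMap L M D) :
    p ∣ (normalizedFactors (Ideal.span {D})).count Q := by
  classical
  have hP : P ≠ ⊥ := Ideal.ne_bot_of_liesOver_of_ne_bot hQ P
  have hQi : Irreducible Q := (Ideal.prime_of_isPrime hQ inferInstance).irreducible
  have hPp := Ideal.prime_of_isPrime hP inferInstance
  have hwint : IsIntegral ℤ w := by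
    refine IsIntegral.of_pow hp ?_
    rw [hw]
    exact D.2.map (algebraMap L M).toIntAlgHom
  let W : 𝓞 M := ⟨w, hwint⟩
  have hW : algebraMap (𝓞 L) (𝓞 M) D = W ^ p := by
    refine RingOfIntegers.coe_injective ?_
    rw [map_pow]
    exact hw.symm
  have hW0 : W ≠ 0 := by
    intro h0
    rw [h0, zero_pow hp.ne'] at hW
    exact hD (FaithfulSMul.algebraMap_injective (𝓞 L) (𝓞 M) (hW.trans (map_zero _).symm))
  have hspan : Ideal.span {D} ≠ (⊥ : Ideal (𝓞 L)) := by simpa using hD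
  have h1 := Ideal.IsDedekindDomain.emultiplicity_map_eq_ramificationIdx'_mul (S := 𝓞 M) hspan hQi
    hPp.irreducible hP
  rw [Ideal.ramificationIdx'_eq_ramificationIdx' Q P (Ideal.map_ne_bot_of_ne_bot hQ), he,
    Nat.cast_one, one_mul, Ideal.map_span, Set.image_singleton, hW, ← Ideal.span_singleton_pow,
    emultiplicity_pow hPp, emultiplicity_eq_count_normalizedFactors hQi hspan,
    emultiplicity_eq_count_normalizedFactors hPp.irreducible (by simpa using hW0), normalize_eq,
    normalize_eq] at h1
  exact ⟨_, by exact_mod_cast h1.symm⟩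

end Multitree

namespace Multitree

theorem sub_dvd_iterate_powC_sub {R : Type*} [CommRing R] (q : ℕ) (c x y : R) (n : ℕ) :
    x - y ∣ (powC q c)^[n] x - (powC q c)^[n] y := by
  induction n with
  | zero => simp
  | succ n ih =>
    rw [Function.iterate_succ_apply', Function.iterate_succ_apply']
    refine ih.trans ?_
    simpa [powC] using sub_dvd_pow_sub_pow ((powC q c)^[n] x) ((powC q c)^[n] y) q

theorem iterate_powC_sub_mem {R : Type*} [CommRing R] {P : Ideal R} {q : ℕ} {c x y : R}
    (h : x - y ∈ P) (n : ℕ) : (powC q c)^[n] x - (powC q c)^[n] y ∈ P :=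
  P.mem_of_dvd (sub_dvd_iterate_powC_sub q c x y n) h

/-- Away from the bad primes, points of level at most `n` are pairwise incongruent. -/
theorem eq_of_sub_mem {R : Type*} [CommRing R] [IsDomain R] {P : Ideal R} [P.IsPrime] {p r : ℕ}
    (hp : 0 < p) (hpP : (p : R) ∉ P) {ζ : R} (hζ : IsPrimitiveRoot ζ (p ^ r)) {c : R} {s : ℕ}
    {a : Fin s → R}
    (hbase : ∀ j j' l, (l = 0 ∧ j = j') ∨ (powC (p ^ r) c)^[l] (a j) - a j' ∉ P) {n : ℕ}
    (hcrit : ∀ j l, 0 < l → l ≤ n → (powC (p ^ r) c)^[l] 0 - a j ∉ P)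
    {x y : R} {i i' : ℕ} {j j' : Fin s} (hi : i ≤ n) (hi' : i' ≤ n)
    (hx : (powC (p ^ r) c)^[i] x = a j) (hy : (powC (p ^ r) c)^[i'] y = a j')
    (h : x - y ∈ P) : x = y := by
  have hq : 0 < p ^ r := pow_pos hp r
  have hne : NeZero (p ^ r) := ⟨hq.ne'⟩
  have same : ∀ i ≤ n, ∀ x y : R, (powC (p ^ r) c)^[i] x = a j → (powC (p ^ r) c)^[i] y = a j →
      x - y ∈ P → x = y := by
    intro i
    induction i with
    | zero => exact fun _ x y hx hy _ => hx.trans hy.symm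
    | succ i ih =>
      intro hin x y hx hy h
      have h1 := ih (by omega) (powC (p ^ r) c x) (powC (p ^ r) c y) hx hy
        (iterate_powC_sub_mem h 1)
      have h2 : x ^ p ^ r = y ^ p ^ r := add_right_cancel h1
      obtain ⟨z, hz, hzx⟩ : ∃ z, z ^ p ^ r = 1 ∧ x = z * y := by
        have hprod := hζ.pow_sub_pow_eq_prod_sub_mul x y hq
        rw [h2, sub_self, eq_comm, Finset.prod_eq_zero_iff] at hprod
        obtain ⟨z, hz, hz'⟩ := hprod
        exact ⟨z, (mem_nthRootsFinset hq 1).mp hz, sub_eq_zero.mp hz'⟩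
      obtain ⟨k, hk, rfl⟩ := hζ.eq_pow_of_pow_eq_one hz
      rcases Nat.eq_zero_or_pos k with rfl | hk0
      · simpa using hzx
      have h3 : (ζ ^ k - 1) * y ∈ P := by rwa [sub_mul, one_mul, ← hzx]
      rcases Ideal.IsPrime.mem_or_mem inferInstance h3 with h4 | h4
      · exfalso
        have h5 : (ζ ^ k - 1) ∣ ((p ^ r : ℕ) : R) := by
          obtain ⟨m, hm⟩ : ∃ m, p ^ r = m + 1 := ⟨p ^ r - 1, by omega⟩
          rw [hm] at hζ hk ⊢
          have h6 := hζ.prod_one_sub_pow_eq_order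
          rw [Nat.cast_add, Nat.cast_one, ← h6, ← neg_sub, neg_dvd]
          have : k = (k - 1) + 1 := by omega
          rw [this]
          exact Finset.dvd_prod_of_mem (fun k => 1 - ζ ^ (k + 1)) (Finset.mem_range.mpr (by omega))
        have h6 : ((p : R)) ^ r ∈ P := by
          have := P.mem_of_dvd h5 h4
          rwa [Nat.cast_pow] at this
        exact hpP (Ideal.IsPrime.mem_of_pow_mem inferInstance r h6)
      · exfalso
        refine hcrit j (i + 1) i.succ_pos hin ?_
        have h5 := iterate_powC_sub_mem (q := p ^ r) (c := c) (x := 0) (y := y) (P := P)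
          (by simpa using h4) (i + 1)
        rwa [hy] at h5
  have aux : ∀ {x y : R} {i d : ℕ} {j j' : Fin s}, (powC (p ^ r) c)^[i] x = a j →
      (powC (p ^ r) c)^[i + d] y = a j' → x - y ∈ P → d = 0 ∧ j = j' := by
    intro x y i d j j' hx hy h
    have h1 := iterate_powC_sub_mem (q := p ^ r) (c := c) h (d + i)
    rw [Function.iterate_add_apply, hx, add_comm d, hy] at h1
    exact (hbase j j' d).resolve_right (not_not.mpr h1)
  rcases le_total i i' with hle | hle
  · obtain ⟨d, rfl⟩ := Nat.exists_eq_add_of_le hle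
    obtain ⟨rfl, rfl⟩ := aux hx hy h
    exact same i hi x y hx hy h
  · obtain ⟨d, rfl⟩ := Nat.exists_eq_add_of_le hle
    obtain ⟨rfl, rfl⟩ := aux hy hx (by rw [← neg_sub]; exact P.neg_mem h)
    exact same i' hi' x y hx hy h

/-- The polynomial identity `φ^d(x) - γ = ∏ (x - v)` over the `d`-th preimages `v` of `γ`. -/
theorem prod_sub_preimages {K Ω : Type*} [Field K] [Field Ω] [Algebra K Ω] [IsAlgClosed Ω] {q : ℕ}
    (hq : 0 < q) {ζ : K} (hζ : IsPrimitiveRoot ζ q) {c : K} (x : Ω) (d : ℕ) :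
    ∀ {γ : Ω}, (∀ k v, (powAdd Ω q c)^[k] v = γ → v ≠ algebraMap K Ω c) →
    ∀ F : Finset Ω, (∀ v, v ∈ F ↔ (powAdd Ω q c)^[d] v = γ) →
      ∏ v ∈ F, (x - v) = (powAdd Ω q c)^[d] x - γ := by
  classical
  induction d with
  | zero =>
    intro γ _ F hF
    have : F = {γ} := by ext v; simpa using hF v
    simp [this]
  | succ d ih =>
    intro γ hγ F hF
    obtain ⟨t, ht⟩ := exists_powAdd_eq (c := c) hq γ
    have ht0 : t ≠ 0 := by
      rintro rfl
      refine hγ 0 γ rfl ?_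
      rw [← ht, powAdd, zero_pow hq.ne', zero_add]
    have hζ' : IsPrimitiveRoot (algebraMap K Ω ζ) q := hζ.map_of_injective
        (algebraMap K Ω).injective
    set T : Finset Ω := (nthRootsFinset q (1 : Ω)).image (· * t) with hT
    have hTmem : ∀ u, u ∈ T ↔ powAdd Ω q c u = γ := by
      intro u
      rw [hT, Finset.mem_image]
      constructor
      · rintro ⟨z, hz, rfl⟩
        rw [powAdd, mul_pow, (mem_nthRootsFinset hq 1).mp hz, one_mul, ← ht]
        rfl
      · intro hu
        refine ⟨u / t, (mem_nthRootsFinset hq 1).mpr ?_, div_mul_cancel₀ u ht0⟩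
        rw [div_pow, div_eq_one_iff_eq (pow_ne_zero _ ht0)]
        exact add_right_cancel (hu.trans ht.symm)
    have h1 : ∀ y : Ω, ∏ u ∈ T, (y - u) = powAdd Ω q c y - γ := by
      intro y
      rw [hT, Finset.prod_image fun a _ b _ h => mul_right_cancel₀ ht0 h,
        ← hζ'.pow_sub_pow_eq_prod_sub_mul y t hq, ← ht, powAdd, powAdd]
      ring
    rw [Function.iterate_succ_apply', ← h1,
      ← Finset.prod_fiberwise_of_maps_to (t := T) (g := (powAdd Ω q c)^[d]) (fun v hv => by
        rw [hTmem]
        exact (Function.iterate_succ_apply' _ _ _).symm.trans ((hF v).mp hv))]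
    refine Finset.prod_congr rfl fun u hu => ih (γ := u) ?_ _ fun v => ?_
    · intro k v hv
      refine hγ (k + 1) v ?_
      rw [Function.iterate_succ_apply', hv]
      exact (hTmem u).mp hu
    · rw [Finset.mem_filter, hF, Function.iterate_succ_apply', and_iff_right_iff_imp]
      intro hv
      rw [hv]
      exact (hTmem u).mp hu

end Multitree

namespace Multitree

open UniqueFactorizationMonoid in
/-- Away from the bad primes, `p`-th powers in a tower field have valuation divisible by `p`. -/
theorem dvd_count_of_mem_tower {L Ω : Type*} [Field L] [NumberField L] [Field Ω] [Algebra L Ω]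
    [IsGalois L Ω] [DecidableEq (Ideal (𝓞 L))] {Q : Ideal (𝓞 L)} [Q.IsMaximal]
    (hQ : Q ≠ ⊥) {p r : ℕ} (hp : 0 < p) (hpQ : (p : 𝓞 L) ∉ Q) {ζ : 𝓞 L}
    (hζ : IsPrimitiveRoot ζ (p ^ r)) {c : 𝓞 L} {s : ℕ} {a : Fin s → 𝓞 L}
    (hbase : ∀ j j' l, (l = 0 ∧ j = j') ∨ (powC (p ^ r) c)^[l] (a j) - a j' ∉ Q) {n : ℕ}
    (hcrit : ∀ j l, 0 < l → l ≤ n → (powC (p ^ r) c)^[l] 0 - a j ∉ Q)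
    {D : 𝓞 L} (hD : D ≠ 0) {w : Ω}
    (hw : w ∈ tower Ω (p ^ r) (c : L) (fun j => (a j : L)) n)
    (hwD : w ^ p = algebraMap L Ω (D : L)) :
    p ∣ (normalizedFactors (Ideal.span {D})).count Q := by
  have hq : 0 < p ^ r := pow_pos hp r
  set M := tower Ω (p ^ r) (c : L) (fun j => (a j : L)) n with hM
  have : FiniteDimensional L M := finiteDimensional_tower hq n
  have : NumberField M := NumberField.of_module_finite L M
  have : Normal L M := IntermediateField.normal_iff_forall_map_le.mpr fun σ => by
    rintro _ ⟨x, hx, rfl⟩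
    obtain ⟨τ, hτ⟩ : ∃ τ : Ω ≃ₐ[L] Ω, ∀ y, τ y = σ y :=
      ⟨AlgEquiv.ofBijective σ (Algebra.IsAlgebraic.algHom_bijective σ), fun y => rfl⟩
    exact hτ x ▸ map_mem_tower τ hx
  have : IsGalois L M := ⟨⟩
  obtain ⟨P, hPmax, hPQ⟩ := Ideal.exists_maximal_ideal_liesOver_of_isIntegral (S := 𝓞 M) Q
  let ι : 𝓞 L →+* 𝓞 M := algebraMap (𝓞 L) (𝓞 M)
  have hι : Function.Injective ι := FaithfulSMul.algebraMap_injective (𝓞 L) (𝓞 M)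
  have hmem : ∀ z, ι z ∈ P ↔ z ∈ Q := fun z => (Ideal.mem_of_liesOver P Q z).symm
  let S : Set Ω := {x | ∃ i ≤ n, x ∈ level Ω (p ^ r) (c : L) (fun j => (a j : L)) i}
  let SM : Set M := {x | (x : Ω) ∈ S}
  have hiter : ∀ (i : ℕ) (x : 𝓞 M), (((powC (p ^ r) (ι c))^[i] x : 𝓞 M) : Ω) =
      (powAdd Ω (p ^ r) (c : L))^[i] ((x : M) : Ω) := fun i x =>
    map_iterate_powC ((algebraMap M Ω).comp (algebraMap (𝓞 M) M)) (p ^ r) (ι c) x i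
  have hSint : ∀ x ∈ S, IsIntegral ℤ x := by
    rintro x ⟨i, -, j, hx⟩
    exact isIntegral_trans (A := 𝓞 L) x (isIntegral_of_iterate hq hx)
  have he : P.ramificationIdx (𝓞 L) = 1 := by
    refine ramificationIdx_eq_one (S := SM) ?_ ?_ ?_ Q P ?_
    · refine IntermediateField.lift_injective M ?_
      rw [IntermediateField.lift_adjoin, IntermediateField.lift_top]
      change _ = IntermediateField.adjoin L S
      congr 1
      ext x
      constructor
      · rintro ⟨y, hy, rfl⟩
        exact hy
      · intro hx
        exact ⟨⟨x, IntermediateField.subset_adjoin L S hx⟩, hx, rfl⟩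
    · intro x hx
      exact (isIntegral_algebraMap_iff (algebraMap M Ω).injective).mp (hSint x hx)
    · rintro σ x ⟨i, hi, hx⟩
      have h1 : ((σ x : M) : Ω) = σ.liftNormal Ω (x : Ω) := (σ.liftNormal_commutes Ω x).symm
      change ∃ i ≤ n, ((σ x : M) : Ω) ∈ _
      rw [h1]
      exact ⟨i, hi, map_mem_level _ hx⟩
    · rintro x y ⟨i, hi, j, hx⟩ ⟨i', hi', j', hy⟩ hxy
      have hinj : Function.Injective fun z : 𝓞 M => ((z : M) : Ω) :=
        Subtype.val_injective.comp RingOfIntegers.coe_injective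
      refine eq_of_sub_mem (ζ := ι ζ) (c := ι c) (a := fun j => ι (a j)) (n := n) hp ?_
        (hζ.map_of_injective hι) ?_ ?_ hi hi' (hinj ((hiter i x).trans hx))
        (hinj ((hiter i' y).trans hy)) hxy
      · rwa [← map_natCast ι, hmem]
      · intro j j' l
        refine (hbase j j' l).imp_right fun h => ?_
        rwa [← map_iterate_powC, ← map_sub, hmem]
      · intro j l hl hln
        rw [← map_zero ι, ← map_iterate_powC, ← map_sub, hmem]
        exact hcrit j l hl hln
  exact dvd_count_of_pow_eq Q hQ P he hD (w := (⟨w, hw⟩ : M)) hp (Subtype.ext hwD)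

end Multitree

namespace Multitree

open UniqueFactorizationMonoid in
theorem count_span_eq_zero {R : Type*} [CommRing R] [IsDedekindDomain R] [DecidableEq (Ideal R)]
    {Q : Ideal R} {x : R} (hx : x ∉ Q) : (normalizedFactors (Ideal.span {x})).count Q = 0 := by
  refine Multiset.count_eq_zero.mpr fun h => hx ?_
  have := Ideal.le_of_dvd (dvd_of_mem_normalizedFactors h)
  exact this (Ideal.mem_span_singleton_self x)

open UniqueFactorizationMonoid in
theorem count_span_pow_mul {R : Type*} [CommRing R] [IsDedekindDomain R] [DecidableEq (Ideal R)]
    {Q : Ideal R} {x y : R} (hx : x ≠ 0) (hy : y ≠ 0) (k : ℕ) :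
    (normalizedFactors (Ideal.span {x ^ k * y})).count Q =
      k * (normalizedFactors (Ideal.span {x})).count Q +
        (normalizedFactors (Ideal.span {y})).count Q := by
  have hx' : Ideal.span {x} ≠ (0 : Ideal R) := by simpa using hx
  have hy' : Ideal.span {y} ≠ (0 : Ideal R) := by simpa using hy
  rw [← Ideal.span_singleton_mul_span_singleton, ← Ideal.span_singleton_pow,
    normalizedFactors_mul (pow_ne_zero _ hx') hy', normalizedFactors_pow, Multiset.count_add,
    Multiset.count_nsmul]

theorem exists_coe_eq {K Ω : Type*} [Field K] [Field Ω] [Algebra K Ω] {q : ℕ} (hq : 0 < q)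
    {c : 𝓞 K} {s : ℕ} {a : Fin s → 𝓞 K} {N : ℕ} {L : IntermediateField K Ω}
    (hL : L = tower Ω q (c : K) (fun j => (a j : K)) N) {g : Ω}
    (hg : g ∈ level Ω q (c : K) (fun j => (a j : K)) N) : ∃ z : 𝓞 L, (z : Ω) = g := by
  have hgi : IsIntegral ℤ g := by
    obtain ⟨j, hj⟩ := hg
    exact isIntegral_trans (A := 𝓞 K) _ (isIntegral_of_iterate hq hj)
  let z : L := ⟨g, hL ▸ level_subset_tower le_rfl hg⟩
  have hz : IsIntegral ℤ z := (isIntegral_algebraMap_iff (algebraMap L Ω).injective).mp hgi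
  exact ⟨⟨z, hz⟩, rfl⟩

open UniqueFactorizationMonoid in
/-- A relation that is constant on the subtrees above level `N` forces the valuations of the
critical orbit relative to points of level `N` to be divisible by `p`, outside the bad primes. -/
theorem dvd_count_critical {K Ω : Type*} [Field K] [NumberField K] [Field Ω] [Algebra K Ω]
    [IsAlgClosed Ω] [IsGalois K Ω] {p r : ℕ} (hp : p.Prime)
    {ζ : 𝓞 K} (hζ : IsPrimitiveRoot ζ (p ^ r)) {c : 𝓞 K} {s : ℕ} {a : Fin s → 𝓞 K} {N : ℕ}
    {L : IntermediateField K Ω} (hL : L = tower Ω (p ^ r) (c : K) (fun j => (a j : K)) N)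
        [NumberField L] [DecidableEq (Ideal (𝓞 L))]
    (hne : ∀ n, ∀ v ∈ level Ω (p ^ r) (c : K) (fun j => (a j : K)) n, v ≠ algebraMap K Ω c)
    {ι : 𝓞 K →+* 𝓞 L} (hι : ι = algebraMap _ _)
    {Q : Ideal (𝓞 L)} [Q.IsMaximal] (hQ : Q ≠ ⊥)
    (hpQ : (p : 𝓞 L) ∉ Q)
    (hbase : ∀ j j' l, (l = 0 ∧ j = j') ∨ ι ((powC (p ^ r) c)^[l] (a j) - a j') ∉ Q)
    (hsep : ∀ x y : 𝓞 L,
      (x : Ω) ∈ level Ω (p ^ r) (c : K) (fun j => (a j : K)) N →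
      (y : Ω) ∈ level Ω (p ^ r) (c : K) (fun j => (a j : K)) N → x - y ∈ Q → x = y)
    (d : ℕ) [Fintype (level Ω (p ^ r) (c : K) (fun j => (a j : K)) (N + d))]
    {e : level Ω (p ^ r) (c : K) (fun j => (a j : K)) (N + d) → ZMod p}
    (he : e ∈ relations Ω (p ^ r) (c : K) (fun j => (a j : K)) (N + d) p)
    (hconst : ∀ v v' : level Ω (p ^ r) (c : K) (fun j => (a j : K)) (N + d),
      (powAdd Ω (p ^ r) (c : K))^[d] v = (powAdd Ω (p ^ r) (c : K))^[d] v' → e v = e v')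
    (γ : 𝓞 L)
    (v : level Ω (p ^ r) (c : K) (fun j => (a j : K)) (N + d))
    (hv : (powAdd Ω (p ^ r) (c : K))^[d] v = (γ : Ω)) (hev : e v ≠ 0) :
    p ∣ (normalizedFactors (Ideal.span {ι ((powC (p ^ r) c)^[d] c) - γ})).count Q := by
  classical
  have hq : 0 < p ^ r := pow_pos hp.pos r
  have : NeZero p := ⟨hp.ne_zero⟩
  by_cases hmem : ι ((powC (p ^ r) c)^[d] c) - γ ∈ Q
  swap
  · rw [count_span_eq_zero hmem]
    exact dvd_zero p
  have hιc : ∀ z : 𝓞 K, ((ι z : 𝓞 L) : Ω) = algebraMap K Ω (z : K) := fun z => by rw [hι]; rfl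
  have hιinj : Function.Injective ι := by
    rw [hι]; exact FaithfulSMul.algebraMap_injective _ _
  have hinj : Function.Injective fun z : 𝓞 L => ((z : L) : Ω) :=
    Subtype.val_injective.comp RingOfIntegers.coe_injective
  have hiter : ∀ (i : ℕ) (x : 𝓞 L), (((powC (p ^ r) (ι c))^[i] x : 𝓞 L) : Ω) =
      (powAdd Ω (p ^ r) (c : K))^[i] ((x : L) : Ω) := fun i x => by
    have h := map_iterate_powC ((algebraMap L Ω).comp (algebraMap (𝓞 L) L)) (p ^ r) (ι c) x i
    exact h.trans (by
      change (powC (p ^ r) (algebraMap L Ω (algebraMap (𝓞 L) L (ι c))))^[i] _ = _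
      have h1 : algebraMap L Ω (algebraMap (𝓞 L) L (ι c)) = algebraMap K Ω c := hιc c
      rw [h1]
      rfl)
  have hγ : (γ : Ω) ∈ level Ω (p ^ r) (c : K) (fun j => (a j : K)) N :=
      by rw [← hv]; exact mem_level_add.mp v.2
  have hcrit : ∀ j l, 0 < l → l ≤ N + d → (powC (p ^ r) (ι c))^[l] 0 - ι (a j) ∉ Q := by
    intro j l hl hln hcon
    obtain ⟨j', hj'⟩ := hγ
    have h1 : (powC (p ^ r) (ι c))^[N] γ = ι (a j') := hinj (by
      change (((powC (p ^ r) (ι c))^[N] γ : 𝓞 L) : Ω) = ((ι (a j') : 𝓞 L) : Ω)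
      rw [hiter, hιc]; exact hj')
    obtain ⟨k, hk⟩ := Nat.exists_eq_add_of_le hln
    have h2 := iterate_powC_sub_mem (q := p ^ r) (c := ι c) hcon (k + 1)
    have h3 := iterate_powC_sub_mem (q := p ^ r) (c := ι c) hmem N
    rw [map_iterate_powC, ← Function.iterate_add_apply, h1] at h3
    have h4 : ι c = powC (p ^ r) (ι c) 0 := by rw [powC, zero_pow hq.ne', zero_add]
    have h5 : (powC (p ^ r) (ι c))^[N + d] (ι c) = (powC (p ^ r) (ι c))^[k + 1 + l] 0 := by
      rw [show k + 1 + l = (N + d) + 1 by omega, Function.iterate_succ_apply, ← h4]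
    rw [h5, Function.iterate_add_apply] at h3
    have h6 := Q.sub_mem h3 h2
    rw [sub_sub_sub_cancel_left, ← map_iterate_powC, ← map_sub] at h6
    exact ((hbase j j' (k + 1)).resolve_left (fun h => by omega)) h6
  obtain ⟨w, hw, hwp⟩ := relations_exists_pow hp.pos (hne (N + d)) he
  obtain ⟨ε, hε⟩ : ∃ ε : Ω → ℕ, ∀ v : level Ω (p ^ r) (c : K) (fun j => (a j : K)) (N + d),
      (e v).val = ε ((powAdd Ω (p ^ r) (c : K))^[d] v) := by
    refine ⟨Function.extend (fun v : level Ω (p ^ r) (c : K) (fun j => (a j : K)) (N + d) =>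
        (powAdd Ω (p ^ r) (c : K))^[d] (v : Ω)) (fun v => (e v).val) 0, fun v => ?_⟩
    exact ((Function.FactorsThrough.extend_apply
        (f := fun v : level Ω (p ^ r) (c : K) (fun j => (a j : K)) (N + d) =>
            (powAdd Ω (p ^ r) (c : K))^[d] (v : Ω))
      (g := fun v => (e v).val) (fun x y h => congrArg ZMod.val (hconst x y h)) 0 v)).symm
  have hfinN : Fintype (level Ω (p ^ r) (c : K) (fun j => (a j : K)) N) :=
      (finite_level hq N).fintype
  have hlift : ∀ g : level Ω (p ^ r) (c : K) (fun j => (a j : K)) N, ∃ z : 𝓞 L, (z : Ω) = g :=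
    fun g => exists_coe_eq hq hL g.2
  choose lift hlift using hlift
  set Vn : Finset Ω := (finite_level (Ω := Ω) (c := (c : K)) (α := fun j => (a j : K)) hq
      (N + d)).toFinset
    with hVn
  have hVn' : ∀ x, x ∈ Vn ↔ x ∈ level Ω (p ^ r) (c : K) (fun j => (a j : K)) (N + d) :=
      fun x => Set.Finite.mem_toFinset _
  let fib : level Ω (p ^ r) (c : K) (fun j => (a j : K)) N → Finset Ω := fun g => Vn.filter fun v =>
      (powAdd Ω (p ^ r) (c : K))^[d] v = g
  let fac : level Ω (p ^ r) (c : K) (fun j => (a j : K)) N → 𝓞 L := fun g => (-1) ^ (fib g).card *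
      (ι ((powC (p ^ r) c)^[d] c) - lift g)
  have hfib : ∀ g : level Ω (p ^ r) (c : K) (fun j => (a j : K)) N, ∏ v ∈ fib g,
      (v - algebraMap K Ω c) = ((fac g : 𝓞 L) : Ω) := by
    intro g
    have h1 := prod_sub_preimages (K := K) (Ω := Ω) hq (hζ.map_of_injective
      (RingOfIntegers.coe_injective : Function.Injective (algebraMap (𝓞 K) K))) (c := (c : K))
      (algebraMap K Ω c) d (γ := g) (fun k v hv => hne (N + k) v (mem_level_add.mpr (hv ▸ g.2)))
      (fib g) (fun v => by
        rw [Finset.mem_filter, hVn', and_iff_right_iff_imp]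
        intro hv
        exact mem_level_add.mpr (hv ▸ g.2))
    have h2 : ((ι ((powC (p ^ r) c)^[d] c) : 𝓞 L) : Ω) = (powAdd Ω (p ^ r) (c : K))^[d]
        (algebraMap K Ω c) := by
      rw [map_iterate_powC, hiter, hιc]
    have h3 : ((fac g : 𝓞 L) : Ω) =
        (-1) ^ (fib g).card * (((ι ((powC (p ^ r) c)^[d] c) : 𝓞 L) : Ω) - (lift g : Ω)) := by
      simp [fac]
    rw [h3, h2, hlift, ← h1, ← Finset.prod_const, ← Finset.prod_mul_distrib]
    exact Finset.prod_congr rfl fun v _ => by ring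
  have hfac0 : ∀ g, fac g ≠ 0 := fun g h0 => by
    have h1 := hfib g
    rw [h0] at h1
    obtain ⟨v, hv, hv0⟩ := Finset.prod_eq_zero_iff.mp (h1.trans (by simp))
    exact hne (N + d) v ((hVn' v).mp (Finset.mem_filter.mp hv).1) (sub_eq_zero.mp hv0)
  set D : 𝓞 L := ∏ g : level Ω (p ^ r) (c : K) (fun j => (a j : K)) N, fac g ^ ε g with hD
  have hwD : w ^ p = algebraMap L Ω (D : L) := by
    have h1 : ∏ v : level Ω (p ^ r) (c : K) (fun j => (a j : K)) (N + d),
        ((v : Ω) - algebraMap K Ω c) ^ (e v).val =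
        ∏ v ∈ Vn, (v - algebraMap K Ω c) ^ ε ((powAdd Ω (p ^ r) (c : K))^[d] v) := by
      rw [Finset.prod_subtype Vn hVn']
      exact Finset.prod_congr rfl fun v _ => by rw [hε]
    have h2 : ((D : 𝓞 L) : Ω) = ∏ g : level Ω (p ^ r) (c : K) (fun j => (a j : K)) N,
        ((fac g : 𝓞 L) : Ω) ^ ε g := by
      simp [hD]
    change w ^ p = ((D : 𝓞 L) : Ω)
    rw [hwp, h1, h2]
    set VN : Finset Ω :=
        (finite_level (Ω := Ω) (c := (c : K)) (α := fun j => (a j : K)) hq N).toFinset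
    rw [← Finset.prod_fiberwise_of_maps_to (t := VN) (g := (powAdd Ω (p ^ r) (c : K))^[d])
        (fun v hv => by
        rw [Set.Finite.mem_toFinset]
        exact mem_level_add.mp ((hVn' v).mp hv)),
      Finset.prod_subtype VN (fun x => Set.Finite.mem_toFinset _)]
    refine Finset.prod_congr rfl fun g _ => ?_
    rw [← hfib g, ← Finset.prod_pow]
    refine Finset.prod_congr rfl fun v hv => ?_
    rw [(Finset.mem_filter.mp hv).2]
  let g₀ : level Ω (p ^ r) (c : K) (fun j => (a j : K)) N := ⟨γ, hγ⟩
  have hg₀ : lift g₀ = γ := hinj (hlift g₀)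
  have hDsplit : D = fac g₀ ^ ε g₀ * ∏ g ∈ Finset.univ.erase g₀, fac g ^ ε g :=
    (Finset.mul_prod_erase _ _ (Finset.mem_univ g₀)).symm
  have hrest : ∏ g ∈ Finset.univ.erase g₀, fac g ^ ε g ∉ Q := by
    intro hcon
    obtain ⟨g, hg, hgQ⟩ := (Ideal.IsPrime.prod_mem_iff (hp := inferInstance)).mp hcon
    have h1 : fac g ∈ Q := Ideal.IsPrime.mem_of_pow_mem inferInstance _ hgQ
    have h2 : ι ((powC (p ^ r) c)^[d] c) - lift g ∈ Q := by
      refine (Ideal.IsPrime.mem_or_mem inferInstance h1).resolve_left fun h3 => ?_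
      have h4 := Ideal.IsPrime.mem_of_pow_mem (I := Q) inferInstance _ h3
      exact (Ideal.ne_top_iff_one Q).mp (Ideal.IsMaximal.ne_top inferInstance)
          (by simpa using Q.neg_mem h4)
    have h3 := Q.sub_mem h2 hmem
    rw [sub_sub_sub_cancel_left] at h3
    have h4 := hsep γ (lift g) hγ (by rw [hlift]; exact g.2) h3
    refine (Finset.mem_erase.mp hg).1 (Subtype.ext ?_)
    rw [← hlift g, ← h4]
  have hcount := dvd_count_of_mem_tower (Ω := Ω) (L := L) hQ hp.pos hpQ (ζ := ι ζ)
    (hζ.map_of_injective hιinj) (c := ι c) (a := fun j => ι (a j)) (n := N + d)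
    (fun j j' l => (hbase j j' l).imp_right fun h => by rwa [← map_iterate_powC, ← map_sub])
    hcrit (D := D) (Finset.prod_ne_zero_iff.mpr fun g _ => pow_ne_zero _ (hfac0 g)) (w := w) (by
      have hle : tower Ω (p ^ r) (c : K) (fun j => (a j : K)) (N + d) ≤
          (tower Ω (p ^ r) (ι c : L) (fun j => (ι (a j) : L)) (N + d)).restrictScalars K := by
        refine IntermediateField.adjoin_le_iff.mpr ?_
        rintro x ⟨i, hi, j, hx⟩
        refine level_subset_tower (K := L) hi ⟨j, ?_⟩
        rw [hι]
        exact hx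
      exact hle hw) hwD
  rw [hDsplit, count_span_pow_mul (hfac0 g₀) (fun h0 => hrest (by rw [h0]; exact Q.zero_mem)),
    count_span_eq_zero hrest, add_zero] at hcount
  have hspan : Ideal.span {fac g₀} = Ideal.span {ι ((powC (p ^ r) c)^[d] c) - γ} := by
    simp only [fac, hg₀]
    exact Ideal.span_singleton_mul_left_unit (isUnit_one.neg.pow _) _
  rw [hspan] at hcount
  refine (Nat.Coprime.dvd_of_dvd_mul_left ?_ hcount)
  have h1 : ε g₀ = (e v).val := by rw [hε, hv]
  rw [h1]
  exact Nat.coprime_of_lt_prime (by rwa [Ne, ZMod.val_eq_zero]) (ZMod.val_lt _) hp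

end Multitree

namespace Multitree

theorem exists_three_preimages {K Ω : Type*} [Field K] [Field Ω] [Algebra K Ω] [IsAlgClosed Ω]
    {q : ℕ} (hq : 1 < q) {ζ : Ω} (hζ : IsPrimitiveRoot ζ q) {c : K} {g : Ω}
    (hg : g ≠ algebraMap K Ω c) (ht : ∀ t : Ω, powAdd Ω q c t = g → t ≠ algebraMap K Ω c) :
    ∃ β : Fin 3 → Ω, Function.Injective β ∧ ∀ i, powAdd Ω q c (powAdd Ω q c (β i)) = g := by
  have hq0 : 0 < q := zero_lt_one.trans hq
  have hmul : ∀ x : Ω, powAdd Ω q c (ζ * x) = powAdd Ω q c x := fun x => by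
    rw [powAdd, powAdd, mul_pow, hζ.pow_eq_one, one_mul]
  have hζ1 : ζ ≠ 1 := hζ.ne_one hq
  have hne : ∀ x y : Ω, powAdd Ω q c x = y → y ≠ algebraMap K Ω c → ζ * x ≠ x := by
    rintro x y h hy h1
    have hx : x ≠ 0 := by
      rintro rfl
      exact hy (by rw [← h, powAdd, zero_pow hq0.ne', zero_add])
    exact hζ1 (mul_right_cancel₀ hx (h1.trans (one_mul x).symm))
  obtain ⟨t, rfl⟩ := exists_powAdd_eq (c := c) hq0 g
  obtain ⟨u, rfl⟩ := exists_powAdd_eq (c := c) hq0 t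
  obtain ⟨w, hw⟩ := exists_powAdd_eq (c := c) hq0 (ζ * powAdd Ω q c u)
  have h1 := hne _ _ rfl (ht _ rfl)
  have h2 := hne _ _ rfl hg
  have h3 : w ≠ u := fun h => h2 (by rw [← hw, h])
  have h4 : w ≠ ζ * u := fun h => h2 (by rw [← hw, h, hmul])
  refine ⟨![u, ζ * u, w], ?_, ?_⟩
  · intro i j hij
    fin_cases i <;> fin_cases j <;>
      first
      | rfl
      | exact absurd hij h1
      | exact absurd hij.symm h1
      | exact absurd hij h3
      | exact absurd hij.symm h3
      | exact absurd hij h4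
      | exact absurd hij.symm h4
  · intro i
    fin_cases i
    · rfl
    · exact congrArg _ (hmul u)
    · exact (congrArg _ hw).trans (hmul _)

/-- Away from a fixed nonzero element, the hypotheses on the prime in `dvd_count_critical` hold. -/
theorem exists_ne_zero_forall_not_mem {K Ω : Type*} [Field K] [NumberField K] [Field Ω]
    [Algebra K Ω]
    {q : ℕ} (hq : 0 < q) {p : ℕ} (hp : 0 < p) {c : 𝓞 K} {s : ℕ} {a : Fin s → 𝓞 K} {N : ℕ}
    {L : IntermediateField K Ω} [NumberField L]
    (hfin : ∀ j, (Set.range fun n => (powC q c)^[n] (a j)).Finite)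
    (hbase : ∀ j j' l, (powC q c)^[l] (a j) = a j' → l = 0 ∧ j = j') :
    ∃ B : 𝓞 L, B ≠ 0 ∧ ∀ Q : Ideal (𝓞 L), B ∉ Q → (p : 𝓞 L) ∉ Q ∧
      (∀ j j' l, (l = 0 ∧ j = j') ∨
        algebraMap (𝓞 K) (𝓞 L) ((powC q c)^[l] (a j) - a j') ∉ Q) ∧
      ∀ x y : 𝓞 L, (x : Ω) ∈ level Ω q (c : K) (fun j => (a j : K)) N →
        (y : Ω) ∈ level Ω q (c : K) (fun j => (a j : K)) N → x - y ∈ Q → x = y := by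
  let ι := algebraMap (𝓞 K) (𝓞 L)
  have hι : Function.Injective ι := FaithfulSMul.algebraMap_injective _ _
  have hinj : Function.Injective fun z : 𝓞 L => ((z : L) : Ω) :=
    Subtype.val_injective.comp RingOfIntegers.coe_injective
  let T : Set (𝓞 L) := {x | (x : Ω) ∈ level Ω q (c : K) (fun j => (a j : K)) N}
  have hT : T.Finite := (finite_level hq N).preimage hinj.injOn
  let S₁ : Set (𝓞 L) := ⋃ j, ⋃ j', (fun y => ι (y - a j')) '' Set.range fun n => (powC q c)^[n]
      (a j)
  have hS₁ : S₁.Finite := Set.finite_iUnion fun j => Set.finite_iUnion fun j' => (hfin j).image _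
  have hS : (insert (p : 𝓞 L) (S₁ ∪ Set.image2 (fun x y => x - y) T T) \ {0}).Finite :=
    ((hS₁.union (hT.image2 _ hT)).insert _).sdiff
  have key : ∀ Q : Ideal (𝓞 L), ∏ z ∈ hS.toFinset, z ∉ Q →
      ∀ z ∈ insert (p : 𝓞 L) (S₁ ∪ Set.image2 (fun x y => x - y) T T), z ≠ 0 → z ∉ Q :=
    fun Q hQ z hz hz0 hzQ =>
      hQ (Q.mem_of_dvd (Finset.dvd_prod_of_mem _ (hS.mem_toFinset.mpr ⟨hz, hz0⟩)) hzQ)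
  refine ⟨∏ z ∈ hS.toFinset, z, Finset.prod_ne_zero_iff.mpr fun z hz =>
    (hS.mem_toFinset.mp hz).2, fun Q hQ => ⟨?_, ?_, ?_⟩⟩
  · exact key Q hQ _ (Set.mem_insert _ _) (by exact_mod_cast hp.ne')
  · intro j j' l
    by_cases h : (powC q c)^[l] (a j) = a j'
    · exact Or.inl (hbase j j' l h)
    · refine Or.inr (key Q hQ _ (Or.inr (Or.inl ?_)) ?_)
      · exact Set.mem_iUnion.mpr ⟨j, Set.mem_iUnion.mpr ⟨j', _, ⟨l, rfl⟩, rfl⟩⟩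
      · rw [Ne, map_eq_zero_iff ι hι, sub_eq_zero]
        exact h
  · intro x y hx hy hxy
    by_contra h
    exact key Q hQ _ (Or.inr (Or.inr ⟨x, hx, y, hy, rfl⟩)) (sub_ne_zero.mpr h) hxy

/-- Relations that are constant on the subtrees above level `N` and nonzero above three given
points of level `N` exist at finitely many levels only. -/
theorem finite_setOf_relation {K Ω : Type*} [Field K] [NumberField K] [Field Ω] [Algebra K Ω]
    [IsAlgClosed Ω] [IsGalois K Ω] {p r : ℕ} (hp : p.Prime) (hr : 0 < r)
    {ζ : 𝓞 K} (hζ : IsPrimitiveRoot ζ (p ^ r)) {c : 𝓞 K} {s : ℕ} {a : Fin s → 𝓞 K} {N : ℕ}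
    (hne : ∀ n, ∀ v ∈ level Ω (p ^ r) (c : K) (fun j => (a j : K)) n, v ≠ algebraMap K Ω c)
    (hcrit : Function.Injective fun n => (powC (p ^ r) c)^[n] c)
    (hfin : ∀ j, (Set.range fun n => (powC (p ^ r) c)^[n] (a j)).Finite)
    (hbase : ∀ j j' l, (powC (p ^ r) c)^[l] (a j) = a j' → l = 0 ∧ j = j')
    {β : Fin 3 → Ω} (hβ : Function.Injective β)
    (hβN : ∀ i, β i ∈ level Ω (p ^ r) (c : K) (fun j => (a j : K)) N) :
    {d : ℕ | ∃ _ : Fintype (level Ω (p ^ r) (c : K) (fun j => (a j : K)) (N + d)),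
      ∃ e ∈ relations Ω (p ^ r) (c : K) (fun j => (a j : K)) (N + d) p,
        (∀ v v' : level Ω (p ^ r) (c : K) (fun j => (a j : K)) (N + d),
          (powAdd Ω (p ^ r) (c : K))^[d] v = (powAdd Ω (p ^ r) (c : K))^[d] v' → e v = e v') ∧
        ∀ i, ∃ v : level Ω (p ^ r) (c : K) (fun j => (a j : K)) (N + d),
          (powAdd Ω (p ^ r) (c : K))^[d] v = β i ∧ e v ≠ 0}.Finite := by
  classical
  have hq : 0 < p ^ r := pow_pos hp.pos r
  obtain ⟨L, hL⟩ : ∃ L, L = tower Ω (p ^ r) (c : K) (fun j => (a j : K)) N := ⟨_, rfl⟩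
  have hfd : FiniteDimensional K L := hL ▸ finiteDimensional_tower hq N
  have : NumberField L := NumberField.of_module_finite K L
  let ι := algebraMap (𝓞 K) (𝓞 L)
  have hι : Function.Injective ι := FaithfulSMul.algebraMap_injective _ _
  choose b hb using fun i => exists_coe_eq hq hL (hβN i)
  have hbinj : Function.Injective b := fun i j h => hβ (by rw [← hb, ← hb, h])
  obtain ⟨B, hB, hBQ⟩ := exists_ne_zero_forall_not_mem (Ω := Ω) (L := L)
      (N := N) hq hp.pos hfin hbase
  have hω : IsPrimitiveRoot (algebraMap (𝓞 L) L (ι (ζ ^ p ^ (r - 1)))) p :=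
    ((hζ.pow hq (by rw [← pow_succ, Nat.sub_add_cancel hr])).map_of_injective hι).map_of_injective
      RingOfIntegers.coe_injective
  have hfinite := UnitEquation.finite_of_dvd_count hB hp.one_lt hω hbinj
  refine (hfinite.preimage (f := fun d => ι ((powC (p ^ r) c)^[d] c))
    (fun d _ d' _ h => hcrit (hι h))).subset ?_
  rintro d ⟨_, e, he, hconst, hv⟩ i Q hQ hBQ'
  obtain ⟨hpQ, hbQ, hsQ⟩ := hBQ Q hBQ'
  rcases eq_or_ne Q ⊥ with rfl | hQ0
  · have h : ∀ x : 𝓞 L,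
        (UniqueFactorizationMonoid.normalizedFactors (Ideal.span {x})).count ⊥ = 0 := fun x =>
      Multiset.count_eq_zero.mpr (UniqueFactorizationMonoid.zero_notMem_normalizedFactors _)
    exact (h _).symm ▸ dvd_zero p
  have := hQ.isMaximal hQ0
  obtain ⟨v, hvb, hev⟩ := hv i
  exact dvd_count_critical hp hζ hL hne rfl hQ0 hpQ hbQ hsQ d he hconst (b i) v
    (hvb.trans (hb i).symm) hev

/-- There are no relations at large levels. -/
theorem exists_forall_relations_eq_zero {K Ω : Type*} [Field K] [NumberField K] [Field Ω]
    [Algebra K Ω]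
    [IsAlgClosed Ω] [IsGalois K Ω] {p r : ℕ} (hp : p.Prime) (hr : 0 < r)
    {ζ : 𝓞 K} (hζ : IsPrimitiveRoot ζ (p ^ r)) {c : 𝓞 K} {s : ℕ} {a : Fin s → 𝓞 K}
    (hne : ∀ n, ∀ v ∈ level Ω (p ^ r) (c : K) (fun j => (a j : K)) n, v ≠ algebraMap K Ω c)
    (hcrit : Function.Injective fun n => (powC (p ^ r) c)^[n] c)
    (hfin : ∀ j, (Set.range fun n => (powC (p ^ r) c)^[n] (a j)).Finite)
    (hbase : ∀ j j' l, (powC (p ^ r) c)^[l] (a j) = a j' → l = 0 ∧ j = j') :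
    ∃ N, ∀ n, N ≤ n → ∀ [Fintype (level Ω (p ^ r) (c : K) (fun j => (a j : K)) n)],
      ∀ e ∈ relations Ω (p ^ r) (c : K) (fun j => (a j : K)) n p, e = 0 := by
  have hq : 0 < p ^ r := pow_pos hp.pos r
  have hζK : IsPrimitiveRoot (ζ : K) (p ^ r) := hζ.map_of_injective RingOfIntegers.coe_injective
  obtain ⟨N₀, hN₀⟩ := exists_orbit_stable (Ω := Ω) hp c a hfin
    fun j n hn h => hn.ne' (hbase j j n h).1
  have hthree : ∀ g : level Ω (p ^ r) (c : K) (fun j => (a j : K)) N₀,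
      ∃ β : Fin 3 → Ω, Function.Injective β ∧ ∀ i, (powAdd Ω (p ^ r) (c : K))^[2] (β i) = g :=
    fun g => exists_three_preimages (Nat.one_lt_pow hr.ne' hp.one_lt)
      (hζK.map_of_injective (algebraMap K Ω).injective) (hne N₀ g g.2)
      fun t ht => hne (N₀ + 1) t (mem_level_succ.mpr (ht ▸ g.2))
  choose β hβ hβg using hthree
  have hlev : Finite (level Ω (p ^ r) (c : K) (fun j => (a j : K)) N₀) :=
      (finite_level hq N₀).to_subtype
  have hbad := Set.finite_iUnion fun g => finite_setOf_relation
      (N := N₀ + 2) hp hr hζ hne hcrit hfin hbase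
    (hβ g) fun i => mem_level_add.mpr (by rw [hβg]; exact g.2)
  obtain ⟨D, hD⟩ := hbad.bddAbove
  refine ⟨N₀ + 2 + (D + 1), fun n hn _ => ?_⟩
  by_contra! hcon
  obtain ⟨d, rfl⟩ := Nat.exists_eq_add_of_le ((Nat.le_add_right _ _).trans hn)
  obtain ⟨e, he, he0, hinv⟩ := exists_invariant_relation hp hζK (N₀ + 2 + d) hcon
  have hconj : ∀ m k, N₀ ≤ m → m + k = N₀ + 2 + d →
      ∀ v v' : level Ω (p ^ r) (c : K) (fun j => (a j : K)) (N₀ + 2 + d),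
      (powAdd Ω (p ^ r) (c : K))^[k] v = (powAdd Ω (p ^ r) (c : K))^[k] v' → e v = e v' := by
    intro m k hm hmk v v' h
    obtain ⟨σ, hσ⟩ := hN₀ m k hm v (by rw [hmk]; exact v.2) v' (by rw [hmk]; exact v'.2) h
    rw [← hinv σ v]
    exact congrArg e (Subtype.ext hσ)
  obtain ⟨v, hv⟩ := Function.ne_iff.mp he0
  let g : level Ω (p ^ r) (c : K) (fun j => (a j : K)) N₀ :=
    ⟨(powAdd Ω (p ^ r) (c : K))^[2 + d] v, mem_level_add.mp (by rw [← add_assoc]; exact v.2)⟩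
  have hd : d ≤ D := by
    refine hD (Set.mem_iUnion.mpr ⟨g, ‹_›, e, he, hconj (N₀ + 2) d (by omega) rfl, fun i => ?_⟩)
    have hsurj : Function.Surjective (powAdd Ω (p ^ r) (c : K)) := fun z => exists_powAdd_eq hq z
    obtain ⟨x, hx⟩ := hsurj.iterate d (β g i)
    have hx2 : (powAdd Ω (p ^ r) (c : K))^[2 + d] x = g := by
      rw [Function.iterate_add_apply, hx, hβg]
    refine ⟨⟨x, ?_⟩, hx, ?_⟩
    · rw [add_assoc]
      exact mem_level_add.mpr (hx2 ▸ g.2)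
    · rw [hconj N₀ (2 + d) le_rfl (by omega) _ v hx2]
      exact hv
  omega

end Multitree

namespace Multitree

/-- Preperiodic points of `x ↦ x ^ q + c` are integral. -/
theorem isIntegral_of_isPreperiodicPoint {K Ω : Type*} [Field K] [Field Ω] [Algebra K Ω] {q : ℕ}
    (hq : 1 < q) {c : 𝓞 K} {x : Ω} (h : IsPreperiodicPoint (powAdd Ω q (c : K)) x) :
    IsIntegral (𝓞 K) x := by
  obtain ⟨m, n, hn, h⟩ := h
  have hq0 : 0 < q := zero_lt_one.trans hq
  have haeval : ∀ k, aeval x ((powC q (C c))^[k] X) = (powAdd Ω q (c : K))^[k] x := fun k => by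
    simpa using aeval_iterate_powC (Ω := Ω) q c 0 k x
  refine ⟨(powC q (C c))^[n + m] X - (powC q (C c))^[m] X, ?_, ?_⟩
  · obtain ⟨h1, h1'⟩ := monic_iterate_powC hq0 c (n + m)
    obtain ⟨h2, h2'⟩ := monic_iterate_powC hq0 c m
    refine h1.sub_of_left (degree_lt_degree ?_)
    rw [h1', h2']
    exact Nat.pow_lt_pow_right hq (Nat.lt_add_of_pos_left hn)
  · rw [← aeval_def, map_sub, haeval, haeval, Function.iterate_add_apply, h, sub_self]

end Multitree

/-- **Theorem 6.1 (multitree).** Let `K` be a number field containing a primitive `q`-th root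
of unity, `q = p^r` a prime power, `c ∈ K` an algebraic integer, and `f(x) = x^q + c` with `0`
not preperiodic for `f`. Let `α_1, …, α_s ∈ K` be strictly preperiodic for `f`, with no
`i ≠ j` such that `f^ℓ(α_i) = α_j` for some `ℓ ≥ 0`. With
`M_n(𝛂) = ⋃_{i ≤ n} ⋃_j f^{-i}(α_j)` and `G_n(𝛂) = Gal(K(M_n(𝛂))/K)`, the index of `G_n(𝛂)`
in `([C_q]^n)^s` (a group of order `q^(s(q^n - 1)/(q - 1))`) is bounded independently of `n`:
there is a constant `C` with `q^(s(q^n - 1)/(q - 1)) ≤ C * [K(M_n(𝛂)) : K]` for all `n ≥ 1`,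
so `G_∞(𝛂)` has finite index in `([C_q]^∞)^s`. -/
theorem multitree_finite_index (K : Type*) [Field K] [NumberField K]
    (p r q : ℕ) (hp : p.Prime) (hr : 0 < r) (hq : q = p ^ r)
    (ζ : K) (hζ : IsPrimitiveRoot ζ q)
    (c : K) (hc : IsIntegral ℤ c) (f : K[X]) (hf : f = X ^ q + C c)
    (φ : AlgebraicClosure K → AlgebraicClosure K)
    (hφ : φ = fun x => x ^ q + algebraMap K (AlgebraicClosure K) c)
    (h0 : ¬ IsPreperiodicPoint φ 0)
    (s : ℕ) (α : Fin s → K)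
    (hα : ∀ i, IsPreperiodicPoint φ (algebraMap K (AlgebraicClosure K) (α i)) ∧
      ¬ IsPeriodicPoint φ (algebraMap K (AlgebraicClosure K) (α i)))
    (hdist : ∀ i j, i ≠ j → ∀ l : ℕ,
      φ^[l] (algebraMap K (AlgebraicClosure K) (α i)) ≠ algebraMap K (AlgebraicClosure K) (α j)) :
    ∃ C : ℕ, ∀ n : ℕ, 1 ≤ n →
      q ^ (s * ((q ^ n - 1) / (q - 1))) ≤
        C * Module.finrank K ↥(IntermediateField.adjoin K
          {x : AlgebraicClosure K | ∃ i ≤ n, ∃ j,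
            φ^[i] x = algebraMap K (AlgebraicClosure K) (α j)}) := by
  subst hq
  obtain rfl : φ = Multitree.powAdd (AlgebraicClosure K) (p ^ r) c := hφ
  obtain ⟨c, rfl⟩ : ∃ z : 𝓞 K, (z : K) = c := ⟨⟨c, hc⟩, rfl⟩
  have hq : 0 < p ^ r := pow_pos hp.pos r
  have hq1 : 1 < p ^ r := Nat.one_lt_pow hr.ne' hp.one_lt
  have hαint : ∀ j, ∃ z : 𝓞 K, (z : K) = α j := fun j => by
    have h1 : IsIntegral ℤ (algebraMap K (AlgebraicClosure K) (α j)) :=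
      isIntegral_trans (A := 𝓞 K) _ (Multitree.isIntegral_of_isPreperiodicPoint hq1 (hα j).1)
    exact ⟨⟨α j, (isIntegral_algebraMap_iff (algebraMap K (AlgebraicClosure K)).injective).mp h1⟩, rfl⟩
  choose a ha using hαint
  obtain rfl : (fun j => (a j : K)) = α := funext ha
  obtain ⟨ζ, rfl⟩ : ∃ z : 𝓞 K, (z : K) = ζ := ⟨⟨ζ, hζ.isIntegral hq⟩, rfl⟩
  replace hζ : IsPrimitiveRoot ζ (p ^ r) := hζ.of_map_of_injective RingOfIntegers.coe_injective
  have hinj : Function.Injective (algebraMap (𝓞 K) (AlgebraicClosure K)) :=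
    (algebraMap K (AlgebraicClosure K)).injective.comp RingOfIntegers.coe_injective
  have hiter := Multitree.iterate_powAdd_coe (K := K) (Ω := AlgebraicClosure K) (p ^ r) c
  have hzero : Multitree.powAdd (AlgebraicClosure K) (p ^ r) (c : K) 0 = algebraMap K _ (c : K) := by
    rw [Multitree.powAdd, zero_pow hq.ne', zero_add]
  have hne : ∀ n, ∀ v ∈ Multitree.level (AlgebraicClosure K) (p ^ r) (c : K) (fun j => (a j : K)) n,
      v ≠ algebraMap K _ (c : K) := by
    rintro n _ ⟨j, hj⟩ rfl
    obtain ⟨m, hm⟩ := (hα j).1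
    refine h0 ⟨m + (n + 1), ?_⟩
    rw [Function.iterate_add_apply, Function.iterate_succ_apply, hzero, hj]
    exact hm
  have hcrit : Function.Injective fun n => (Multitree.powC (p ^ r) c)^[n] c := by
    have key : ∀ n k, 0 < k →
        (Multitree.powC (p ^ r) c)^[k + n] c ≠ (Multitree.powC (p ^ r) c)^[n] c := by
      refine fun n k hk h => h0 ⟨n + 1, k, hk, ?_⟩
      rw [Function.iterate_succ_apply, hzero, ← Function.iterate_add_apply]
      exact (hiter c (k + n)).trans ((congrArg _ h).trans (hiter c n).symm)
    intro n n' h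
    rcases lt_trichotomy n n' with hlt | heq | hlt
    · refine absurd h.symm ?_
      simpa [Nat.sub_add_cancel hlt.le] using key n (n' - n) (Nat.sub_pos_of_lt hlt)
    · exact heq
    · refine absurd h ?_
      simpa [Nat.sub_add_cancel hlt.le] using key n' (n - n') (Nat.sub_pos_of_lt hlt)
  have hfin : ∀ j, (Set.range fun n => (Multitree.powC (p ^ r) c)^[n] (a j)).Finite := fun j => by
    obtain ⟨m, n, hn, h⟩ := (hα j).1
    refine Multitree.finite_range_iterate (m := m) hn (hinj ?_)
    rw [← Function.iterate_add_apply] at h ⊢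
    exact (hiter (a j) (n + m)).symm.trans (h.trans (hiter (a j) m))
  have hbase : ∀ j j' l, (Multitree.powC (p ^ r) c)^[l] (a j) = a j' → l = 0 ∧ j = j' := by
    intro j j' l h
    have h1 := (hiter (a j) l).trans (congrArg _ h)
    by_cases hj : j = j'
    · subst hj
      refine ⟨?_, rfl⟩
      by_contra hl
      exact (hα j).2 ⟨l, Nat.pos_of_ne_zero hl, h1⟩
    · exact absurd h1 (hdist j j' hj l)
  have hainj : Function.Injective fun j => (a j : K) := fun i j h =>
    (hbase i j 0 (RingOfIntegers.coe_injective h)).2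
  have : IsGalois K (AlgebraicClosure K) := inferInstance
  obtain ⟨N, hN⟩ := Multitree.exists_forall_relations_eq_zero (Ω := AlgebraicClosure K) hp hr hζ hne
    hcrit hfin hbase
  obtain ⟨C, hC⟩ := Multitree.exists_finrank_bound (Ω := AlgebraicClosure K) hp hr
    (hζ.map_of_injective RingOfIntegers.coe_injective) hainj hne N hN
  exact ⟨C, fun n _ => hC n⟩
end
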